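/- Assume the Riemann Hypothesis. Fix ε > 0, c₂ ∈ (1,2), and a weight W as described. Then there exists a constant C > 0 (depending only on ε, c₂ and W) such that for all large real numbers x, y with x < y ≤ x², one has |C(x,y) − (y x²/ζ(2)) · Ŵ(1) · (1/(2πi)) ∫_{Re s = c₂} Ŵ(2−s) Ŵ(s) ds| ≤ C ( y^{−1/2+ε} x^{7/2−ε} + y^{3/2−ε} x^{1+2ε} ). -/

import Mathlib

open Complex Filter

/-- The Ramanujan sum `c_q(n) = ∑_{a mod q, gcd(a,q)=1} e(na/q)`. -/
noncomputable def ramanujanSum (q n : ℕ) : ℂ :=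
  ∑ a ∈ (Finset.range q).filter (fun a => Nat.Coprime a q),
    Complex.exp (2 * Real.pi * Complex.I * (((n * a : ℕ) : ℂ) / (q : ℂ)))

/-- A smooth weight function attached to a parameter `U ≥ 2`: `0 ≤ W ≤ 1`, supported in
`[1/(2U), 1 + 1/(2U)]`, equal to `1` on `[1/U, 1]`, with `j`-th derivative `≪_j U^j`. -/
structure Weight (U : ℝ) : Type where
  toFun : ℝ → ℝ
  smooth : ContDiff ℝ (⊤ : ℕ∞) toFun
  nonneg : ∀ t, 0 ≤ toFun t
  le_one : ∀ t, toFun t ≤ 1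
  support_subset : ∀ t, t ∉ Set.Icc (1 / (2 * U)) (1 + 1 / (2 * U)) → toFun t = 0
  eq_one : ∀ t ∈ Set.Icc (1 / U) 1, toFun t = 1
  deriv_bound : ∀ j : ℕ, ∃ Cj : ℝ, ∀ t, |iteratedDeriv j toFun t| ≤ Cj * U ^ j

/-- The Mellin transform `Ŵ(s) = ∫_0^∞ W(t) t^{s-1} dt`. -/
noncomputable def mellinW (W : ℝ → ℝ) (s : ℂ) : ℂ :=
  ∫ t in Set.Ioi (0 : ℝ), (W t : ℂ) * (t : ℂ) ^ (s - 1)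

/-- `(1/(2πi)) ∫_{Re s = c} f(s) ds`, the normalized vertical line integral. -/
noncomputable def VI (c : ℝ) (f : ℂ → ℂ) : ℂ :=
  (1 / (2 * Real.pi * Complex.I)) * ∫ t : ℝ, f (c + t * Complex.I) * Complex.I

/-- The smoothed second moment `C(x,y) = ∑_n (∑_q c_q(n) W(q/x))² W(n/y)`. -/
noncomputable def Cxy {U : ℝ} (W : Weight U) (x y : ℝ) : ℂ :=
  ∑' n : ℕ+, (∑' q : ℕ+, ramanujanSum q n * (W.toFun ((q : ℕ) / x) : ℂ)) ^ 2
    * (W.toFun ((n : ℕ) / y) : ℂ)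

/-- The generalized divisor sum `σ_z(n) = ∑_{d ∣ n} d^z`. -/
noncomputable def sigmaC (z : ℂ) (n : ℕ) : ℂ := ∑ d ∈ n.divisors, (d : ℂ) ^ z

open MeasureTheory Topology in
/-- The Mellin transform of the fractional part on `(1, ∞)` is bounded in a right half plane. -/
theorem norm_mellin_fract_le {s : ℂ} (hs : 0 < s.re) :
    ‖mellin (Set.indicator (Set.Ioi 1) fun t : ℝ => ((Int.fract t : ℝ) : ℂ)) (-s)‖ ≤ 1 / s.re := by
  have h1 : ∫ t in Set.Ioi (1 : ℝ), t ^ (-s.re - 1) = 1 / s.re := by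
    rw [integral_Ioi_rpow_of_lt (by linarith) one_pos]
    simp
  rw [← h1, mellin]
  have h2 : ∫ t in Set.Ioi (0 : ℝ), (t : ℂ) ^ (-s - 1) •
        Set.indicator (Set.Ioi 1) (fun t : ℝ => ((Int.fract t : ℝ) : ℂ)) t
      = ∫ t in Set.Ioi (1 : ℝ), (t : ℂ) ^ (-s - 1) • ((Int.fract t : ℝ) : ℂ) := by
    rw [← integral_indicator measurableSet_Ioi, ← integral_indicator measurableSet_Ioi]
    congr 1
    ext t
    by_cases h : (1 : ℝ) < t
    · simp [Set.indicator, h, zero_lt_one.trans h]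
    · simp [Set.indicator, h]
  rw [h2]
  refine norm_integral_le_of_norm_le (integrableOn_Ioi_rpow_of_lt (by linarith) one_pos) ?_
  filter_upwards [ae_restrict_mem measurableSet_Ioi] with t ht
  have ht0 : (0 : ℝ) < t := zero_lt_one.trans ht
  rw [norm_smul, Complex.norm_cpow_eq_rpow_re_of_pos ht0, Complex.norm_real, Real.norm_eq_abs,
    abs_of_nonneg (Int.fract_nonneg t)]
  simpa using mul_le_of_le_one_right (Real.rpow_nonneg ht0.le _) (Int.fract_lt_one t).le

open MeasureTheory Topology Asymptotics in
theorem differentiableAt_mellin_fract {s : ℂ} (hs : 0 < s.re) :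
    DifferentiableAt ℂ
      (fun s => mellin (Set.indicator (Set.Ioi 1) fun t : ℝ => ((Int.fract t : ℝ) : ℂ)) (-s)) s := by
  have hmeas : Measurable (Set.indicator (Set.Ioi (1:ℝ)) fun t : ℝ => ((Int.fract t : ℝ) : ℂ)) :=
    (Complex.measurable_ofReal.comp measurable_fract).indicator measurableSet_Ioi
  have hbd : ∀ t, ‖Set.indicator (Set.Ioi (1:ℝ)) (fun t : ℝ => ((Int.fract t : ℝ) : ℂ)) t‖ ≤ 1 := by
    intro t
    refine (norm_indicator_le_norm_self _ _).trans ?_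
    rw [Complex.norm_real, Real.norm_eq_abs, abs_of_nonneg (Int.fract_nonneg t)]
    exact (Int.fract_lt_one t).le
  have := mellin_differentiableAt_of_isBigO_rpow (a := 0) (b := -s.re - 1) (s := -s)
    (f := Set.indicator (Set.Ioi (1:ℝ)) fun t : ℝ => ((Int.fract t : ℝ) : ℂ)) ?_ ?_ (by simpa) ?_
    (by simp)
  · exact this.comp s differentiableAt_id.neg
  · refine LocallyIntegrable.locallyIntegrableOn ?_ _
    intro x
    refine ⟨Set.Icc (x-1) (x+1), Icc_mem_nhds (by linarith) (by linarith), ?_⟩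
    exact Measure.integrableOn_of_bounded (M := 1) (by simp) hmeas.aestronglyMeasurable
      (ae_of_all _ hbd)
  · refine IsBigO.of_bound 1 (Eventually.of_forall fun t => ?_)
    simpa using hbd t
  · refine IsBigO.of_bound 1 ?_
    filter_upwards [Ioo_mem_nhdsGT (zero_lt_one' ℝ)] with t ht
    rw [Set.indicator_of_notMem (by simpa using ht.2.le)]
    simp only [norm_zero]; positivity

open MeasureTheory Topology Asymptotics in
/-- The integral representation of `(s - 1) ζ(s)` to the right of the imaginary axis. -/
theorem riemannZeta₁_eq {s : ℂ} (hs : 0 < s.re) :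
    riemannZeta₁ s = s - s * (s - 1) *
      mellin (Set.indicator (Set.Ioi 1) fun t : ℝ => ((Int.fract t : ℝ) : ℂ)) (-s) := by
  have hU : IsOpen {s : ℂ | 0 < s.re} := isOpen_lt continuous_const Complex.continuous_re
  have hV : IsOpen {s : ℂ | 1 < s.re} := isOpen_lt continuous_const Complex.continuous_re
  have hpre : IsPreconnected {s : ℂ | 0 < s.re} := (convex_halfSpace_re_gt 0).isPreconnected
  refine AnalyticOnNhd.eqOn_of_preconnected_of_eventuallyEq (𝕜 := ℂ) (z₀ := 2)
    (f := riemannZeta₁) (g := fun s => s - s * (s - 1) *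
      mellin (Set.indicator (Set.Ioi 1) fun t : ℝ => ((Int.fract t : ℝ) : ℂ)) (-s))
    (DifferentiableOn.analyticOnNhd differentiable_riemannZeta₁.differentiableOn hU)
    (DifferentiableOn.analyticOnNhd (fun z hz => ?_) hU) hpre (by simp) ?_ hs
  · have := differentiableAt_mellin_fract hz
    exact (DifferentiableAt.sub (by fun_prop)
      (DifferentiableAt.mul (by fun_prop) this)).differentiableWithinAt
  · filter_upwards [hV.mem_nhds (by simp : (1:ℝ) < (2:ℂ).re)] with s hs
    have hs1 : 1 < s.re := hs
    have hne : s ≠ 1 := by rintro rfl; simp at hs1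
    have hs0 : s ≠ 0 := by rintro rfl; simp at hs1; linarith
    have hsum := LSeries_eq_mul_integral' (fun _ => (1 : ℂ)) (r := 1) zero_le_one hs1 (by
      refine IsBigO.of_bound 1 (Eventually.of_forall fun n => by simp))
    have hz : LSeries (fun _ => (1:ℂ)) s = riemannZeta s := LSeries_one_eq_riemannZeta hs1
    rw [hz] at hsum
    have hint : ∫ t in Set.Ioi (1 : ℝ), (∑ k ∈ Finset.Icc 1 ⌊t⌋₊, (1:ℂ)) * (t:ℂ) ^ (-(s + 1))
        = 1 / (s - 1) -
        mellin (Set.indicator (Set.Ioi 1) fun t : ℝ => ((Int.fract t : ℝ) : ℂ)) (-s) := by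
      have hA : ∫ t in Set.Ioi (1 : ℝ), (t:ℂ) ^ (-s) = 1 / (s - 1) := by
        rw [integral_Ioi_cpow_of_lt (by simpa using hs1) one_pos]
        simp only [ofReal_one, one_cpow]
        rw [show -s + 1 = -(s-1) by ring, neg_div_neg_eq]
      have hB : mellin (Set.indicator (Set.Ioi 1) fun t : ℝ => ((Int.fract t : ℝ) : ℂ)) (-s)
          = ∫ t in Set.Ioi (1 : ℝ), ((Int.fract t : ℝ) : ℂ) * (t : ℂ) ^ (-(s + 1)) := by
        rw [mellin, ← integral_indicator measurableSet_Ioi, ← integral_indicator measurableSet_Ioi]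
        congr 1
        ext t
        by_cases h : (1 : ℝ) < t
        · simp [Set.indicator, h, zero_lt_one.trans h, mul_comm]
          left; ring_nf
        · simp [Set.indicator, h]
      rw [hB, ← hA, ← integral_sub]
      · refine setIntegral_congr_fun measurableSet_Ioi fun t ht => ?_
        have ht0 : (0 : ℝ) < t := zero_lt_one.trans ht
        have hfl : ((⌊t⌋₊ : ℝ)) = t - Int.fract t := by
          rw [natCast_floor_eq_intCast_floor ht0.le, Int.self_sub_fract]
        have hfl' : ((⌊t⌋₊ : ℂ)) = t - (Int.fract t : ℝ) := by exact_mod_cast congrArg ofReal hfl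
        have hne : (t : ℂ) ≠ 0 := by exact_mod_cast ht0.ne'
        simp only [Finset.sum_const, Nat.card_Icc, add_tsub_cancel_right, nsmul_eq_mul, mul_one]
        rw [hfl', sub_mul]
        congr 1
        rw [show -s = -(s+1) + 1 by ring, Complex.cpow_add _ _ hne, cpow_one, mul_comm]
      · exact integrableOn_Ioi_cpow_of_lt (by simpa using hs1) one_pos
      · refine Integrable.mono' (g := fun t : ℝ => t ^ (-s.re - 1))
          (integrableOn_Ioi_rpow_of_lt (by linarith) one_pos) ?_ ?_
        · refine AEStronglyMeasurable.mul
            (Complex.measurable_ofReal.comp measurable_fract).aestronglyMeasurable ?_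
          refine ContinuousOn.aestronglyMeasurable (fun t ht => ?_) measurableSet_Ioi
          exact (Complex.continuousAt_ofReal_cpow_const _ _
            (Or.inr (zero_lt_one.trans ht).ne')).continuousWithinAt
        · filter_upwards [ae_restrict_mem measurableSet_Ioi] with t ht
          have ht0 : (0 : ℝ) < t := zero_lt_one.trans ht
          rw [norm_mul, Complex.norm_cpow_eq_rpow_re_of_pos ht0, Complex.norm_real,
            Real.norm_eq_abs, abs_of_nonneg (Int.fract_nonneg t)]
          rw [show (-(s+1)).re = -s.re - 1 by simp; ring]
          exact mul_le_of_le_one_left (Real.rpow_nonneg ht0.le _) (Int.fract_lt_one t).le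
    rw [hint, riemannZeta_eq_inv_sub_mul hne] at hsum
    have h3 : s - 1 ≠ 0 := sub_ne_zero.mpr hne
    have : riemannZeta₁ s = (s - 1) * ((s - 1)⁻¹ * riemannZeta₁ s) := by field_simp
    rw [this, hsum]
    field_simp

/-- Polynomial growth of `(s - 1) ζ(s)` for `Re s ≥ 1/2`. -/
theorem norm_riemannZeta₁_le {s : ℂ} (hs : 1 / 2 ≤ s.re) :
    ‖riemannZeta₁ s‖ ≤ 3 * (1 + ‖s‖) ^ 2 := by
  have h0 : 0 < s.re := by linarith
  rw [riemannZeta₁_eq h0]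
  have h1 := norm_mellin_fract_le h0
  have h2 : 1 / s.re ≤ 2 := by rw [div_le_iff₀ h0]; linarith
  have h3 : ‖s - 1‖ ≤ 1 + ‖s‖ := (norm_sub_le _ _).trans (by simp [add_comm])
  refine (norm_sub_le _ _).trans ?_
  rw [norm_mul, norm_mul]
  have := norm_nonneg s
  calc ‖s‖ + ‖s‖ * ‖s - 1‖ * _ ≤ ‖s‖ + ‖s‖ * (1 + ‖s‖) * 2 := by
        gcongr; exact h1.trans h2
    _ ≤ _ := by nlinarith

/-- A nonvanishing holomorphic function on a disc is a constant times an exponential. -/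
theorem exists_eq_mul_exp_of_ball {f : ℂ → ℂ} {R : ℝ} (hR : 0 < R)
    (hf : DifferentiableOn ℂ f (Metric.ball 0 R)) (h0 : ∀ z ∈ Metric.ball 0 R, f z ≠ 0) :
    ∃ L : ℂ → ℂ, L 0 = 0 ∧ DifferentiableOn ℂ L (Metric.ball 0 R) ∧
      ∀ z ∈ Metric.ball 0 R, f z = f 0 * Complex.exp (L z) := by
  have hd : DifferentiableOn ℂ (fun z => deriv f z / f z) (Metric.ball 0 R) :=
    (hf.deriv Metric.isOpen_ball).div hf h0
  obtain ⟨L, hL0, hL⟩ := hd.isExactOn_ball.with_val_at 0 0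
  refine ⟨L, hL0, fun z hz => (hL z hz).differentiableAt.differentiableWithinAt, fun z hz => ?_⟩
  have hder : ∀ w ∈ Metric.ball (0:ℂ) R,
      HasDerivAt (fun z => f z * Complex.exp (-L z)) 0 w := by
    intro w hw
    have h1 : HasDerivAt f (deriv f w) w :=
      (hf.differentiableAt (Metric.isOpen_ball.mem_nhds hw)).hasDerivAt
    have h2 := h1.fun_mul (hL w hw).fun_neg.cexp
    refine h2.congr_deriv ?_
    have := h0 w hw
    field_simp
    ring
  have hconst := (convex_ball (0:ℂ) R).is_const_of_fderivWithin_eq_zero (𝕜 := ℂ)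
    (f := fun z => f z * Complex.exp (-L z))
    (fun w hw => (hder w hw).differentiableAt.differentiableWithinAt)
    (fun w hw => by
      rw [fderivWithin_of_isOpen Metric.isOpen_ball hw]
      ext
      simpa using (hder w hw).deriv)
    hz (Metric.mem_ball_self hR)
  simp only [hL0, neg_zero, Complex.exp_zero, mul_one] at hconst
  rw [← hconst, mul_assoc, ← Complex.exp_add]
  simp

theorem riemannZeta₁_ne_zero_of_rh (hRH : RiemannHypothesis) {s : ℂ} (hs : 1 / 2 < s.re) :
    riemannZeta₁ s ≠ 0 := by
  by_cases h1 : s = 1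
  · simp [h1]
  intro h
  have hz : riemannZeta s = 0 := by rw [riemannZeta_eq_inv_sub_mul h1, h, mul_zero]
  have := hRH s hz (by
    rintro ⟨n, hn⟩
    rw [hn] at hs
    simp at hs
    have : (0:ℝ) ≤ n := Nat.cast_nonneg n
    linarith) h1
  linarith

open scoped ArithmeticFunction.Moebius in
/-- `(s - 1) ζ(s)` is bounded below on the line `Re s = 2`. -/
theorem exists_inv_riemannZeta₁_two_le :
    ∃ B : ℝ, 1 ≤ B ∧ ∀ s : ℂ, s.re = 2 → ‖(riemannZeta₁ s)⁻¹‖ ≤ B := by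
  set f : ℕ → ℂ := fun n => ((μ n : ℤ) : ℂ) with hf
  have hsum : LSeriesSummable f 2 := ArithmeticFunction.LSeriesSummable_moebius_iff.mpr (by simp)
  refine ⟨max 1 (∑' n, ‖LSeries.term f 2 n‖), le_max_left _ _, fun s hs => ?_⟩
  have hs1 : 1 < s.re := by rw [hs]; norm_num
  have hne : s ≠ 1 := by rintro rfl; simp at hs1
  have hmu := LSeries_one_mul_Lseries_moebius hs1
  rw [LSeries_one_eq_riemannZeta hs1, riemannZeta_eq_inv_sub_mul hne] at hmu
  have h3 : s - 1 ≠ 0 := sub_ne_zero.mpr hne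
  have hz : riemannZeta₁ s ≠ 0 := by rintro h; simp [h] at hmu
  have hnorm : ∀ n, ‖LSeries.term f s n‖ = ‖LSeries.term f 2 n‖ := by
    intro n
    simp [LSeries.norm_term_eq, hs]
  have heq : (riemannZeta₁ s)⁻¹ = (s - 1)⁻¹ * LSeries f s := by
    rw [inv_eq_iff_eq_inv]
    have := hmu
    field_simp at this ⊢
    rw [eq_div_iff]
    · exact this
    · rintro h; simp only [hf] at h; rw [h] at hmu; simp at hmu
  rw [heq, norm_mul]
  have h4 : ‖(s - 1)⁻¹‖ ≤ 1 := by
    rw [norm_inv]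
    refine inv_le_one_of_one_le₀ ?_
    refine le_trans ?_ (Complex.abs_re_le_norm _)
    simp [hs]; norm_num
  have h5 : ‖LSeries f s‖ ≤ ∑' n, ‖LSeries.term f 2 n‖ := by
    rw [LSeries]
    refine (norm_tsum_le_tsum_norm ?_).trans_eq (tsum_congr hnorm)
    exact hsum.norm.congr fun n => (hnorm n).symm
  calc _ ≤ 1 * ∑' n, ‖LSeries.term f 2 n‖ := by gcongr
    _ ≤ _ := by rw [one_mul]; exact le_max_right _ _

/-- Under RH, `1 / ((s - 1) ζ(s))` has polynomial growth in `1/2 + δ ≤ Re s ≤ 2`. -/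
theorem exists_norm_inv_riemannZeta₁_le (hRH : RiemannHypothesis) {δ : ℝ} (hδ : 0 < δ)
    (hδ' : δ ≤ 1 / 2) :
    ∃ C A : ℝ, 0 < C ∧ 0 ≤ A ∧ ∀ s : ℂ, 1 / 2 + δ ≤ s.re → s.re ≤ 2 →
      ‖(riemannZeta₁ s)⁻¹‖ ≤ C * (1 + |s.im|) ^ A := by
  obtain ⟨B, hB1, hB⟩ := exists_inv_riemannZeta₁_two_le
  have hB0 : 0 < B := by linarith
  set k : ℝ := 6 / δ with hk
  have hk0 : 0 < k := by positivity
  refine ⟨B * (75 * B) ^ k, 2 * k, by positivity, by positivity, fun s hs1 hs2 => ?_⟩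
  set t := s.im
  set c : ℂ := ⟨2, t⟩ with hc
  set R : ℝ := 3 / 2 - δ / 2 with hR
  have hR0 : 0 < R := by rw [hR]; linarith
  set G : ℂ → ℂ := fun z => riemannZeta₁ (c + z) with hG
  have hre : ∀ z ∈ Metric.ball (0:ℂ) R, 1 / 2 < (c + z).re := by
    intro z hz
    rw [mem_ball_zero_iff] at hz
    have := (abs_le.mp (Complex.abs_re_le_norm z)).1
    simp only [hc, add_re]
    linarith
  obtain ⟨L, hL0, hLd, hL⟩ := exists_eq_mul_exp_of_ball (f := G) hR0
    ((differentiable_riemannZeta₁.comp (differentiable_id.const_add c)).differentiableOn)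
    (fun z hz => riemannZeta₁_ne_zero_of_rh hRH (hre z hz))
  have hG0 : ‖(G 0)⁻¹‖ ≤ B := hB _ (by simp [hc])
  have hG0ne : G 0 ≠ 0 := riemannZeta₁_ne_zero_of_rh hRH (hre 0 (Metric.mem_ball_self hR0))
  set P : ℝ := 75 * B * (1 + |t|) ^ 2 with hP
  have ht0 := abs_nonneg t
  have hP1 : 1 < P := by
    rw [hP]
    nlinarith [mul_nonneg ht0 ht0, mul_nonneg hB0.le ht0, mul_nonneg hB0.le (mul_nonneg ht0 ht0)]
  have hM : 0 < Real.log P := Real.log_pos hP1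
  have hbound : ∀ z ∈ Metric.ball (0:ℂ) R, ‖G z‖ ≤ 75 * (1 + |t|) ^ 2 := by
    intro z hz
    have h1 := norm_riemannZeta₁_le (hre z hz).le
    rw [mem_ball_zero_iff] at hz
    have h2 : ‖c + z‖ ≤ 4 + |t| := by
      have : ‖c‖ ≤ |(2:ℝ)| + |t| := Complex.norm_le_abs_re_add_abs_im c
      have h3 : |(2:ℝ)| = 2 := by norm_num
      have := norm_add_le c z
      linarith
    have := norm_nonneg (c + z)
    calc ‖G z‖ ≤ 3 * (1 + ‖c + z‖) ^ 2 := h1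
      _ ≤ 3 * (1 + (4 + |t|)) ^ 2 := by gcongr
      _ ≤ _ := by nlinarith
  have hmaps : Set.MapsTo L (Metric.ball 0 R) {z | z.re ≤ Real.log P} := by
    intro z hz
    have h1 : ‖Complex.exp (L z)‖ ≤ P := by
      have : Complex.exp (L z) = (G 0)⁻¹ * G z := by rw [hL z hz]; field_simp
      rw [this, norm_mul, hP]
      calc _ ≤ B * (75 * (1 + |t|) ^ 2) := by gcongr; exact hbound z hz
        _ = _ := by ring
    rw [Complex.norm_exp] at h1
    exact (Real.le_log_iff_exp_le (by linarith)).mpr h1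
  set z : ℂ := ((s.re - 2 : ℝ) : ℂ) with hz
  have hzn : ‖z‖ ≤ 3 / 2 - δ := by
    rw [hz, Complex.norm_real, Real.norm_eq_abs, abs_le]; constructor <;> linarith
  have hzb : z ∈ Metric.ball (0:ℂ) R := by rw [mem_ball_zero_iff]; linarith
  have hBC := Complex.borelCaratheodory_zero hM hLd hmaps hR0 hzb hL0
  have hcz : c + z = s := by apply Complex.ext <;> simp [hc, hz, t]
  have hLz : ‖L z‖ ≤ k * Real.log P := by
    refine hBC.trans ?_
    rw [div_le_iff₀ (by linarith)]
    have h1 : δ / 2 ≤ R - ‖z‖ := by linarith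
    calc 2 * Real.log P * ‖z‖ ≤ 2 * Real.log P * (3 / 2) := by gcongr; linarith
      _ = k * Real.log P * (δ / 2) := by rw [hk]; field_simp; norm_num
      _ ≤ _ := by gcongr
  have hGs : riemannZeta₁ s = G 0 * Complex.exp (L z) := by rw [← hL z hzb, hG]; simp [hcz]
  rw [hGs, mul_inv, norm_mul, ← Complex.exp_neg, Complex.norm_exp]
  calc ‖(G 0)⁻¹‖ * Real.exp (-L z).re ≤ B * Real.exp (Real.log P * k) := by
        gcongr
        refine (Complex.re_le_norm _).trans ?_
        rw [norm_neg]; linarith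
    _ = B * P ^ k := by rw [Real.rpow_def_of_pos (by linarith)]
    _ = _ := by
      rw [hP, Real.mul_rpow (by positivity) (by positivity), Real.rpow_mul (by positivity),
        Real.rpow_two]
      ring

theorem integral_Ioi_of_hasDerivAt_of_tendsto_zero {A : Type*} [NormedRing A] [NormedAlgebra ℝ A]
    [CompleteSpace A] {f f' : ℝ → A} {l m : A} (hd : ∀ t ∈ Set.Ioi (0 : ℝ), HasDerivAt f (f' t) t)
    (hi : MeasureTheory.IntegrableOn f' (Set.Ioi 0))
    (h0 : Tendsto f (nhdsWithin 0 (Set.Ioi 0)) (nhds l)) (h1 : Tendsto f atTop (nhds m)) :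
    ∫ t in Set.Ioi (0 : ℝ), f' t = m - l := by
  have := MeasureTheory.integral_Ioi_deriv_mul_eq_sub (a := (0 : ℝ)) (u := f) (u' := f')
    (v := fun _ => (1 : A)) (v' := fun _ => 0) (a' := l) (b' := m) hd
    (fun x _ => hasDerivAt_const x 1)
    (by simpa [Pi.mul_def, Pi.add_def] using hi) (by simpa [Pi.mul_def] using h0)
    (by simpa [Pi.mul_def] using h1)
  simpa using this

/-- A smooth function on the line supported in `[a, b]` with `0 < a ≤ b`. -/
structure BumpOn (w : ℝ → ℝ) (a b : ℝ) : Prop where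
  smooth : ContDiff ℝ (⊤ : ℕ∞) w
  pos : 0 < a
  le : a ≤ b
  zero : ∀ t, t ∉ Set.Icc a b → w t = 0

namespace BumpOn

variable {w : ℝ → ℝ} {a b : ℝ}

theorem continuous (hw : BumpOn w a b) : Continuous w := hw.smooth.continuous

theorem hasDerivAt (hw : BumpOn w a b) (t : ℝ) : HasDerivAt w (deriv w t) t :=
  ((hw.smooth.differentiable (by simp)) t).hasDerivAt

theorem deriv_zero (hw : BumpOn w a b) {t : ℝ} (ht : t ∉ Set.Icc a b) : deriv w t = 0 := by
  have h : w =ᶠ[nhds t] fun _ => 0 := by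
    filter_upwards [isClosed_Icc.isOpen_compl.mem_nhds (show t ∈ (Set.Icc a b)ᶜ from ht)] with x hx
    exact hw.zero x hx
  rw [h.deriv_eq]
  simp

theorem mul_deriv (hw : BumpOn w a b) : BumpOn (fun t => t * deriv w t) a b where
  smooth := by
    have h : ContDiff ℝ (⊤ : ℕ∞) (deriv w) :=
      (contDiff_infty_iff_deriv.1 hw.smooth).2
    exact contDiff_id.mul h
  pos := hw.pos
  le := hw.le
  zero t ht := by simp [hw.deriv_zero ht]

theorem add {v : ℝ → ℝ} (hw : BumpOn w a b) (hv : BumpOn v a b) :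
    BumpOn (fun t => w t + v t) a b where
  smooth := hw.smooth.add hv.smooth
  pos := hw.pos
  le := hw.le
  zero t ht := by simp [hw.zero t ht, hv.zero t ht]

theorem div_id (hw : BumpOn w a b) : BumpOn (fun t => w t / t) a b where
  smooth := by
    rw [contDiff_iff_contDiffAt]
    intro t
    by_cases ht : t = 0
    · subst ht
      have h : (fun t => w t / t) =ᶠ[nhds 0] fun _ => 0 := by
        filter_upwards [eventually_lt_nhds hw.pos] with x hx
        rw [hw.zero x (fun h => absurd h.1 (not_le.2 hx)), zero_div]
      exact contDiffAt_const.congr_of_eventuallyEq h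
    · exact hw.smooth.contDiffAt.div contDiffAt_id ht
  pos := hw.pos
  le := hw.le
  zero t ht := by simp [hw.zero t ht]

theorem bounded (hw : BumpOn w a b) : ∃ C, 0 < C ∧ ∀ t, |w t| ≤ C := by
  obtain ⟨C, hC⟩ := isCompact_Icc.exists_bound_of_continuousOn (s := Set.Icc a b)
    hw.continuous.continuousOn
  refine ⟨max C 1, by positivity, fun t => ?_⟩
  by_cases ht : t ∈ Set.Icc a b
  · exact (hC t ht).trans (le_max_left _ _)
  · rw [hw.zero t ht, abs_zero]; positivity

theorem eventually_zero_top (hw : BumpOn w a b) : ∀ᶠ t in atTop, w t = 0 := by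
  filter_upwards [eventually_gt_atTop b] with t ht
  exact hw.zero t fun h => absurd h.2 (not_le.2 ht)

theorem eventually_zero_zero (hw : BumpOn w a b) : ∀ᶠ t in nhdsWithin 0 (Set.Ioi 0), w t = 0 := by
  filter_upwards [nhdsWithin_le_nhds (eventually_lt_nhds hw.pos)] with t ht
  exact hw.zero t fun h => absurd h.1 (not_le.2 ht)

theorem isBigO_top (hw : BumpOn w a b) (c : ℝ) :
    (fun t => (w t : ℂ)) =O[atTop] (fun t : ℝ => t ^ (-c)) := by
  refine Asymptotics.IsBigO.of_bound 1 ?_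
  filter_upwards [hw.eventually_zero_top] with t ht
  simp [ht]

theorem isBigO_zero (hw : BumpOn w a b) (c : ℝ) :
    (fun t => (w t : ℂ)) =O[nhdsWithin 0 (Set.Ioi 0)] (fun t : ℝ => t ^ (-c)) := by
  refine Asymptotics.IsBigO.of_bound 1 ?_
  filter_upwards [hw.eventually_zero_zero] with t ht
  simp [ht]

theorem locallyIntegrableOn (hw : BumpOn w a b) :
    MeasureTheory.LocallyIntegrableOn (fun t => (w t : ℂ)) (Set.Ioi 0) :=
  (continuous_ofReal.comp hw.continuous).locallyIntegrable.locallyIntegrableOn _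

theorem mellinConvergent (hw : BumpOn w a b) (s : ℂ) :
    MellinConvergent (fun t => (w t : ℂ)) s :=
  mellinConvergent_of_isBigO_rpow hw.locallyIntegrableOn (hw.isBigO_top (s.re + 1)) (by linarith)
    (hw.isBigO_zero (s.re - 1)) (by linarith)

theorem differentiable_mellin (hw : BumpOn w a b) :
    Differentiable ℂ (mellin fun t => (w t : ℂ)) := fun s =>
  mellin_differentiableAt_of_isBigO_rpow hw.locallyIntegrableOn (hw.isBigO_top (s.re + 1))
    (by linarith) (hw.isBigO_zero (s.re - 1)) (by linarith)

theorem mellin_mul_deriv (hw : BumpOn w a b) (s : ℂ) :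
    mellin (fun t => ((t * deriv w t : ℝ) : ℂ)) s = -s * mellin (fun t => (w t : ℂ)) s := by
  have hd : ∀ t ∈ Set.Ioi (0 : ℝ), HasDerivAt (fun t : ℝ => (t : ℂ) ^ s * (w t : ℂ))
      ((t : ℂ) ^ (s - 1) • ((t * deriv w t : ℝ) : ℂ) + s * ((t : ℂ) ^ (s - 1) • (w t : ℂ))) t := by
    intro t ht
    have h1 : HasDerivAt (fun t : ℝ => (t : ℂ) ^ s) (s * (t : ℂ) ^ (s - 1)) t := by
      have := (hasDerivAt_id (t : ℂ)).cpow_const (c := s) (Or.inl (by simpa using ht))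
      simpa using this.comp_ofReal
    refine (h1.mul (hw.hasDerivAt t).ofReal_comp).congr_deriv ?_
    have ht0 : (t : ℂ) ≠ 0 := by exact_mod_cast (ne_of_gt ht)
    have : (t : ℂ) ^ s = (t : ℂ) ^ (s - 1) * t := by
      rw [cpow_sub _ _ ht0, cpow_one, div_mul_cancel₀ _ ht0]
    rw [this, smul_eq_mul, smul_eq_mul]
    push_cast
    ring
  have hi1 := hw.mul_deriv.mellinConvergent s
  have hi2 := (hw.mellinConvergent s).const_mul s
  have h0 : Tendsto (fun t : ℝ => (t : ℂ) ^ s * (w t : ℂ)) (nhdsWithin 0 (Set.Ioi 0)) (nhds 0) := by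
    refine tendsto_const_nhds.congr' ?_
    filter_upwards [hw.eventually_zero_zero] with t ht
    simp [ht]
  have h1 : Tendsto (fun t : ℝ => (t : ℂ) ^ s * (w t : ℂ)) atTop (nhds 0) := by
    refine tendsto_const_nhds.congr' ?_
    filter_upwards [hw.eventually_zero_top] with t ht
    simp [ht]
  have key : ∫ t : ℝ in Set.Ioi 0, ((t : ℂ) ^ (s - 1) • ((t * deriv w t : ℝ) : ℂ)
      + s * ((t : ℂ) ^ (s - 1) • (w t : ℂ))) = 0 - 0 :=
    integral_Ioi_of_hasDerivAt_of_tendsto_zero hd (hi1.add hi2) h0 h1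
  have h2 := MeasureTheory.integral_add hi1 hi2
  rw [MeasureTheory.integral_const_mul] at h2
  rw [mellin, mellin]
  linear_combination key - h2

theorem exists_norm_mellin_le (hw : BumpOn w a b) :
    ∃ C, 0 < C ∧ ∀ s : ℂ, |s.re| ≤ 3 → ‖mellin (fun t => (w t : ℂ)) s‖ ≤ C := by
  obtain ⟨B, hB0, hB⟩ := hw.bounded
  obtain ⟨D, hD⟩ : ∃ D, D = ∫ t in Set.Ioi (0 : ℝ), Set.indicator (Set.Icc a b)
    (fun t => (t ^ (2 : ℝ) + t ^ (-4 : ℝ)) * B) t := ⟨_, rfl⟩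
  refine ⟨max D 1, by positivity, fun s hs => le_trans ?_ (le_max_left _ _)⟩
  rw [hD, mellin]
  have hsub : ∀ c : ℝ, ContinuousOn (fun t : ℝ => t ^ c) (Set.Icc a b) := fun c =>
    ContinuousOn.rpow_const continuousOn_id fun x hx => Or.inl (ne_of_gt (hw.pos.trans_le hx.1))
  refine MeasureTheory.norm_integral_le_of_norm_le ?_ ?_
  · refine MeasureTheory.Integrable.integrableOn ?_
    rw [MeasureTheory.integrable_indicator_iff measurableSet_Icc]
    exact (((hsub 2).add (hsub (-4))).mul continuousOn_const).integrableOn_Icc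
  · filter_upwards [MeasureTheory.ae_restrict_mem measurableSet_Ioi] with t ht
    by_cases htm : t ∈ Set.Icc a b
    · rw [Set.indicator_of_mem htm, norm_smul, norm_cpow_eq_rpow_re_of_pos ht, norm_real]
      have ht' : (0 : ℝ) < t := ht
      obtain ⟨h1, h2⟩ := abs_le.1 hs
      refine mul_le_mul ?_ (hB t) (abs_nonneg _) (by positivity)
      rw [sub_re, one_re]
      rcases le_total t 1 with h | h
      · have := Real.rpow_le_rpow_of_exponent_ge ht' h (show (-4 : ℝ) ≤ s.re - 1 by linarith)
        have : 0 < t ^ (2 : ℝ) := by positivity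
        linarith
      · have := Real.rpow_le_rpow_of_exponent_le h (show s.re - 1 ≤ (2 : ℝ) by linarith)
        have : 0 < t ^ (-4 : ℝ) := by positivity
        linarith
    · simp [Set.indicator_of_notMem htm, hw.zero t htm]

theorem exists_pow_mul_norm_mellin_le (k : ℕ) :
    ∀ {w : ℝ → ℝ}, BumpOn w a b →
    ∃ C, 0 < C ∧ ∀ s : ℂ, |s.re| ≤ 3 → ‖s‖ ^ k * ‖mellin (fun t => (w t : ℂ)) s‖ ≤ C := by
  induction k with
  | zero => intro w hw; simpa using hw.exists_norm_mellin_le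
  | succ k ih =>
    intro w hw
    obtain ⟨C, hC, h⟩ := ih hw.mul_deriv
    refine ⟨C, hC, fun s hs => ?_⟩
    have := h s hs
    rw [hw.mellin_mul_deriv s, norm_mul, norm_neg] at this
    rw [pow_succ]; linarith

theorem exists_norm_mellin_le_div (hw : BumpOn w a b) (k : ℕ) :
    ∃ C, 0 < C ∧ ∀ s : ℂ, |s.re| ≤ 3 →
      ‖mellin (fun t => (w t : ℂ)) s‖ ≤ C / (1 + |s.im|) ^ k := by
  obtain ⟨C0, hC0, h0⟩ := hw.exists_norm_mellin_le
  obtain ⟨C, hC, h⟩ := exists_pow_mul_norm_mellin_le k hw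
  refine ⟨2 ^ k * (C0 + C), by positivity, fun s hs => ?_⟩
  rw [le_div_iff₀ (by positivity)]
  have h1 : (1 + |s.im|) ^ k ≤ 2 ^ k * (1 + ‖s‖ ^ k) := by
    have hi : |s.im| ≤ ‖s‖ := abs_im_le_norm s
    rcases le_total ‖s‖ 1 with h | h
    · calc (1 + |s.im|) ^ k ≤ 2 ^ k := by gcongr; linarith
        _ ≤ 2 ^ k * (1 + ‖s‖ ^ k) := by
          refine le_mul_of_one_le_right (by positivity) ?_
          have : 0 ≤ ‖s‖ ^ k := by positivity
          linarith
    · calc (1 + |s.im|) ^ k ≤ (2 * ‖s‖) ^ k := by gcongr; linarith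
        _ = 2 ^ k * ‖s‖ ^ k := mul_pow _ _ _
        _ ≤ _ := by gcongr; linarith
  calc _ ≤ ‖mellin (fun t => (w t : ℂ)) s‖ * (2 ^ k * (1 + ‖s‖ ^ k)) := by gcongr
    _ = 2 ^ k * (‖mellin (fun t => (w t : ℂ)) s‖ + ‖s‖ ^ k * ‖mellin (fun t => (w t : ℂ)) s‖) := by
      ring
    _ ≤ _ := by gcongr; exacts [h0 s hs, h s hs]

theorem verticalIntegrable_mellin (hw : BumpOn w a b) {σ : ℝ} (hσ : |σ| ≤ 3) :
    VerticalIntegrable (mellin fun t => (w t : ℂ)) σ := by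
  obtain ⟨C, hC, h⟩ := hw.exists_norm_mellin_le_div 2
  refine (integrable_inv_one_add_sq.const_mul C).mono' ?_ ?_
  · exact (hw.differentiable_mellin.continuous.comp (by fun_prop)).aestronglyMeasurable
  · refine Eventually.of_forall fun y => ?_
    refine (h (σ + y * I) (by simpa using hσ)).trans ?_
    rw [div_eq_mul_inv]
    have : (σ + y * I : ℂ).im = y := by simp
    rw [this]
    gcongr
    nlinarith [sq_abs y, abs_nonneg y]

end BumpOn

open MeasureTheory Topology in
/-- Shifting a vertical line of integration inside a strip of holomorphy. -/
theorem integral_vertical_eq {f : ℂ → ℂ} {σ₁ σ₂ C : ℝ} (h12 : σ₁ ≤ σ₂)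
    (hd : ∀ s : ℂ, σ₁ ≤ s.re → s.re ≤ σ₂ → DifferentiableAt ℂ f s)
    (hb : ∀ s : ℂ, σ₁ ≤ s.re → s.re ≤ σ₂ → ‖f s‖ ≤ C / (1 + s.im ^ 2)) :
    ∫ y : ℝ, f (σ₁ + y * I) = ∫ y : ℝ, f (σ₂ + y * I) := by
  have hint : ∀ σ : ℝ, σ₁ ≤ σ → σ ≤ σ₂ → Integrable fun y : ℝ => f (σ + y * I) := by
    intro σ h1 h2
    refine (integrable_inv_one_add_sq.const_mul C).mono' ?_ ?_
    · refine (continuous_iff_continuousAt.2 fun y => ?_).aestronglyMeasurable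
      have := (hd (σ + y * I) (by simpa using h1) (by simpa using h2)).continuousAt
      exact ContinuousAt.comp (f := fun y : ℝ => (σ + y * I : ℂ)) this (by fun_prop)
    · refine Eventually.of_forall fun y => ?_
      have := hb (σ + y * I) (by simpa using h1) (by simpa using h2)
      simpa [div_eq_mul_inv] using this
  have hv : ∀ σ : ℝ, σ₁ ≤ σ → σ ≤ σ₂ → Tendsto (fun T : ℝ => ∫ y in (-T)..T, f (σ + y * I)) atTop
      (𝓝 (∫ y : ℝ, f (σ + y * I))) := fun σ h1 h2 =>
    intervalIntegral_tendsto_integral (hint σ h1 h2) tendsto_neg_atTop_atBot tendsto_id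
  have hT : Tendsto (fun T : ℝ => C / (1 + T ^ 2) * |σ₂ - σ₁|) atTop (𝓝 0) := by
    rw [← zero_mul |σ₂ - σ₁|]
    refine Tendsto.mul_const _ ?_
    exact tendsto_const_nhds.div_atTop
      (tendsto_atTop_add_const_left _ _ (tendsto_pow_atTop (by norm_num)))
  have hh : ∀ T : ℝ, ‖∫ x in σ₁..σ₂, f (x + T * I)‖ ≤ C / (1 + T ^ 2) * |σ₂ - σ₁| := by
    intro T
    refine intervalIntegral.norm_integral_le_of_norm_le_const fun x hx => ?_
    rw [Set.uIoc_of_le h12] at hx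
    have := hb (x + T * I) (by simpa using hx.1.le) (by simpa using hx.2)
    simpa using this
  have hp := squeeze_zero_norm hh hT
  have hm : Tendsto (fun T : ℝ => ∫ x in σ₁..σ₂, f (x + (-T : ℝ) * I)) atTop (𝓝 0) := by
    refine squeeze_zero_norm (fun T => ?_) hT
    simpa using hh (-T)
  have hrect : ∀ T : ℝ, 0 ≤ T → (((∫ x in σ₁..σ₂, f (x + (-T : ℝ) * I)) - ∫ x in σ₁..σ₂, f (x + T * I))
      + I • ∫ y in (-T)..T, f (σ₂ + y * I)) - I • ∫ y in (-T)..T, f (σ₁ + y * I) = 0 := by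
    intro T hT0
    have := integral_boundary_rect_eq_zero_of_differentiableOn f (⟨σ₁, -T⟩ : ℂ) ⟨σ₂, T⟩ (by
      intro s hs
      rw [mem_reProdIm] at hs
      simp only [Set.uIcc_of_le h12] at hs
      exact (hd s hs.1.1 hs.1.2).differentiableWithinAt)
    simpa using this
  have hlim := (((hm.sub hp).add ((hv σ₂ h12 le_rfl).const_smul I)).sub
    ((hv σ₁ le_rfl h12).const_smul I)).congr'
    (show _ =ᶠ[atTop] fun _ => (0 : ℂ) by
      filter_upwards [eventually_ge_atTop 0] with T hT0 using hrect T hT0)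
  have := tendsto_nhds_unique hlim tendsto_const_nhds
  simp only [sub_self, zero_add, smul_eq_mul, ← mul_sub] at this
  rcases mul_eq_zero.1 this with h | h
  · exact absurd h I_ne_zero
  · exact (sub_eq_zero.1 h).symm

theorem LSeries_moebius_eq {s : ℂ} (hs : 1 < s.re) :
    LSeries (fun n => (ArithmeticFunction.moebius n : ℂ)) s = (s - 1) * (riemannZeta₁ s)⁻¹ := by
  have h1 := LSeries_one_mul_Lseries_moebius hs
  rw [LSeries_one_eq_riemannZeta hs] at h1
  have hs1 : s ≠ 1 := by rintro rfl; simp at hs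
  rw [riemannZeta_eq_inv_sub_mul hs1] at h1
  have hs0 : s - 1 ≠ 0 := sub_ne_zero.2 hs1
  have hz : riemannZeta₁ s ≠ 0 := by rintro h; simp [h] at h1
  field_simp at h1 ⊢
  linear_combination h1

namespace BumpOn

variable {w : ℝ → ℝ} {a b : ℝ}

open MeasureTheory in
theorem ofReal_eq_integral_mellin (hw : BumpOn w a b) {σ : ℝ} (hσ : |σ| ≤ 3) {u : ℝ} (hu : 0 < u) :
    (w u : ℂ) = (1 / (2 * Real.pi) : ℝ) *
      ∫ y : ℝ, (u : ℂ) ^ (-(σ + y * I : ℂ)) * mellin (fun t => (w t : ℂ)) (σ + y * I) := by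
  have := mellinInv_mellin_eq σ (fun t => (w t : ℂ)) hu (hw.mellinConvergent σ)
    (hw.verticalIntegrable_mellin hσ) (continuous_ofReal.comp hw.continuous).continuousAt
  rw [← this, mellinInv]
  simp

open MeasureTheory in
theorem moebius_sum_eq (hw : BumpOn w a b) {u : ℝ} (hu : 0 < u) :
    ((∑' m : ℕ, (ArithmeticFunction.moebius m : ℝ) * w (m * u) : ℝ) : ℂ) =
      (1 / (2 * Real.pi) : ℝ) * ∫ y : ℝ, (fun s : ℂ => (u : ℂ) ^ (-s) *
        mellin (fun t => (w t : ℂ)) s * ((s - 1) * (riemannZeta₁ s)⁻¹)) ((2 : ℝ) + y * I) := by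
  set F : ℕ → ℝ → ℂ := fun m y => LSeries.term (fun n => (ArithmeticFunction.moebius n : ℂ))
    ((2 : ℝ) + y * I) m * ((u : ℂ) ^ (-((2 : ℝ) + y * I)) * mellin (fun t => (w t : ℂ)) ((2 : ℝ) + y * I))
    with hF
  have hVI := hw.verticalIntegrable_mellin (σ := 2) (by norm_num)
  have hVI' : Integrable fun y : ℝ => mellin (fun t => (w t : ℂ)) ((2 : ℝ) + y * I) := hVI
  have hterm : ∀ (m : ℕ) (y : ℝ), ‖LSeries.term (fun n => (ArithmeticFunction.moebius n : ℂ))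
      ((2 : ℝ) + y * I) m‖ ≤ 1 / (m : ℝ) ^ 2 := by
    intro m y
    rcases eq_or_ne m 0 with rfl | hm
    · simp
    · rw [LSeries.term_of_ne_zero hm, norm_div]
      have h1 : ‖(m : ℂ) ^ (((2 : ℝ) : ℂ) + y * I)‖ = (m : ℝ) ^ 2 := by
        rw [norm_natCast_cpow_of_pos (Nat.pos_of_ne_zero hm)]
        have : (((2 : ℝ) : ℂ) + y * I).re = 2 := by simp
        rw [this, Real.rpow_two]
      rw [h1]
      gcongr
      rw [norm_intCast]
      exact_mod_cast ArithmeticFunction.abs_moebius_le_one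
  have hupow : ∀ y : ℝ, ‖(u : ℂ) ^ (-(((2 : ℝ) : ℂ) + y * I))‖ = u ^ (-2 : ℝ) := by
    intro y
    rw [norm_cpow_eq_rpow_re_of_pos hu]
    simp
  have hbound : ∀ m y, ‖F m y‖ ≤ 1 / (m : ℝ) ^ 2 *
      (u ^ (-2 : ℝ) * ‖mellin (fun t => (w t : ℂ)) ((2 : ℝ) + y * I)‖) := by
    intro m y
    simp only [hF, norm_mul, hupow]
    gcongr
    exact hterm m y
  have hFm : ∀ m, Continuous (F m) := by
    intro m
    have hlin : Continuous fun y : ℝ => (((2 : ℝ) : ℂ) + y * I) := by fun_prop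
    refine Continuous.mul ?_ (Continuous.mul ?_ (hw.differentiable_mellin.continuous.comp hlin))
    · rcases eq_or_ne m 0 with rfl | hm
      · simpa using continuous_const
      · simp only [LSeries.term_of_ne_zero hm]
        have hm' : (m : ℂ) ≠ 0 := by exact_mod_cast hm
        refine continuous_const.div (hlin.const_cpow (Or.inl hm')) fun y => ?_
        simp [cpow_eq_zero_iff, hm']
    · have hu' : (u : ℂ) ≠ 0 := by exact_mod_cast hu.ne'
      exact hlin.neg.const_cpow (Or.inl hu')
  have hFi : ∀ m, Integrable (F m) := fun m =>
    ((hVI'.norm.const_mul _).const_mul _).mono' (hFm m).aestronglyMeasurable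
      (Eventually.of_forall (hbound m))
  have hsum : Summable fun m => ∫ y, ‖F m y‖ := by
    refine Summable.of_nonneg_of_le (fun m => integral_nonneg fun y => norm_nonneg _)
      (fun m => integral_mono (hFi m).norm ((hVI'.norm.const_mul _).const_mul _) (hbound m)) ?_
    simp only [integral_const_mul]
    exact (Real.summable_one_div_nat_pow.2 (by norm_num)).mul_right _
  have key := (hasSum_integral_of_summable_integral_norm hFi hsum).mul_left
    (((1 / (2 * Real.pi) : ℝ)) : ℂ)
  rw [← integral_const_mul] at key
  rw [ofReal_tsum, ← integral_const_mul]
  refine Eq.trans (tsum_congr fun m => ?_) (key.tsum_eq.trans (integral_congr_ae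
    (Eventually.of_forall fun y => ?_)))
  · rcases eq_or_ne m 0 with rfl | hm
    · simp [hF]
    · push_cast
      rw [hw.ofReal_eq_integral_mellin (σ := 2) (by norm_num)
        (mul_pos (Nat.cast_pos.2 (Nat.pos_of_ne_zero hm)) hu)]
      rw [mul_left_comm, ← integral_const_mul]
      push_cast
      congr 2
      ext y
      simp only [hF]
      rw [LSeries.term_of_ne_zero hm, div_eq_mul_inv, ← cpow_neg, ofReal_ofNat,
        ← ofReal_natCast, mul_cpow_ofReal_nonneg (Nat.cast_nonneg m) hu.le]
      ring
  · simp only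
    congr 1
    simp only [hF]
    rw [tsum_mul_right, ← LSeries_moebius_eq (by simp)]
    rw [LSeries]
    ring

/-- Under RH, smoothed sums of the Möbius function have square root cancellation. -/
theorem exists_moebius_sum_le (hRH : RiemannHypothesis) (hw : BumpOn w a b) {δ : ℝ} (hδ : 0 < δ)
    (hδ' : δ ≤ 1 / 2) : ∃ C, 0 < C ∧ ∀ u : ℝ, 0 < u →
      |∑' m : ℕ, (ArithmeticFunction.moebius m : ℝ) * w (m * u)| ≤ C * u ^ (-(1 / 2) - δ) := by
  obtain ⟨C, A, hC, hA, hz⟩ := exists_norm_inv_riemannZeta₁_le hRH hδ hδ'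
  obtain ⟨D, hD, hm⟩ := hw.exists_norm_mellin_le_div (⌈A⌉₊ + 3)
  have hbase : ∀ s : ℂ, 1 / 2 + δ ≤ s.re → s.re ≤ 2 →
      ‖mellin (fun t => (w t : ℂ)) s * ((s - 1) * (riemannZeta₁ s)⁻¹)‖ ≤ D * C / (1 + s.im ^ 2) := by
    intro s h1 h2
    have hp : (0 : ℝ) < 1 + |s.im| := by positivity
    have hs1 : ‖s - 1‖ ≤ 1 + |s.im| := by
      refine (norm_le_abs_re_add_abs_im _).trans ?_
      simp only [sub_re, one_re, sub_im, one_im, sub_zero]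
      gcongr
      rw [abs_le]; constructor <;> linarith
    have hA' : (1 + |s.im|) ^ A ≤ (1 + |s.im|) ^ ⌈A⌉₊ := by
      rw [← Real.rpow_natCast]
      exact Real.rpow_le_rpow_of_exponent_le (by linarith [abs_nonneg s.im]) (Nat.le_ceil A)
    rw [norm_mul, norm_mul]
    calc _ ≤ D / (1 + |s.im|) ^ (⌈A⌉₊ + 3) * ((1 + |s.im|) * (C * (1 + |s.im|) ^ ⌈A⌉₊)) := by
          gcongr
          · exact hm s (by rw [abs_le]; constructor <;> linarith)
          · exact (hz s h1 h2).trans (by gcongr)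
      _ = D * C / (1 + |s.im|) ^ 2 := by
          rw [pow_add]; field_simp
      _ ≤ _ := by
          gcongr
          nlinarith [sq_abs s.im, abs_nonneg s.im]
  refine ⟨(1 / (2 * Real.pi)) * ∫ y : ℝ, D * C / (1 + y ^ 2) , ?_, fun u hu => ?_⟩
  · simp only [div_eq_mul_inv (D * C), MeasureTheory.integral_const_mul, integral_univ_inv_one_add_sq]
    positivity
  · have hpos : ∀ s : ℂ, ‖(u : ℂ) ^ (-s)‖ = u ^ (-s.re) := fun s => by
      rw [norm_cpow_eq_rpow_re_of_pos hu, neg_re]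
    have hu' : (u : ℂ) ≠ 0 := by exact_mod_cast hu.ne'
    have hshift := integral_vertical_eq (σ₁ := 1 / 2 + δ) (σ₂ := 2)
      (C := (u ^ (-(2 : ℝ)) + u ^ (-(1 / 2) - δ)) * (D * C))
      (f := fun s : ℂ => (u : ℂ) ^ (-s) * mellin (fun t => (w t : ℂ)) s *
        ((s - 1) * (riemannZeta₁ s)⁻¹)) (by linarith) (by
        intro s h1 h2
        have h3 : DifferentiableAt ℂ (fun s : ℂ => (u : ℂ) ^ (-s)) s :=
          (differentiableAt_id.neg).const_cpow (Or.inl hu')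
        have h4 := hw.differentiable_mellin s
        have h5 := differentiable_riemannZeta₁ s
        have h6 := riemannZeta₁_ne_zero_of_rh hRH (s := s) (by linarith)
        exact (h3.mul h4).mul ((differentiableAt_id.sub_const 1).mul (h5.inv h6))) (by
        intro s h1 h2
        rw [mul_assoc, norm_mul, hpos, mul_div_assoc]
        refine mul_le_mul ?_ (hbase s h1 h2) (norm_nonneg _) (by positivity)
        rcases le_total u 1 with h | h
        · have := Real.rpow_le_rpow_of_exponent_ge hu h (show -(2 : ℝ) ≤ -s.re by linarith)
          have : 0 < u ^ (-(1 / 2) - δ) := by positivity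
          linarith
        · have := Real.rpow_le_rpow_of_exponent_le h (show -s.re ≤ -(1 / 2) - δ by linarith)
          have : 0 < u ^ (-(2 : ℝ)) := by positivity
          linarith)
    rw [← Real.norm_eq_abs, ← norm_real, hw.moebius_sum_eq hu, ← hshift, norm_mul, norm_real,
      Real.norm_of_nonneg (by positivity), mul_assoc]
    gcongr
    have hI : MeasureTheory.Integrable fun y : ℝ => D * C / (1 + y ^ 2) := by
      simpa [div_eq_mul_inv] using integrable_inv_one_add_sq.const_mul (D * C)
    rw [← MeasureTheory.integral_mul_const]
    refine MeasureTheory.norm_integral_le_of_norm_le (hI.mul_const _)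
      (Eventually.of_forall fun y => ?_)
    rw [mul_assoc, norm_mul, hpos, mul_comm]
    refine mul_le_mul ?_ (le_of_eq ?_) (by positivity) (by positivity)
    · refine (hbase _ (by simp) (by simp; linarith)).trans (le_of_eq ?_)
      simp
    · congr 1
      simp
      ring

end BumpOn

open MeasureTheory in
theorem hasSum_integral_Ioc_nat {F : ℝ → ℝ} {c : ℝ} (hF : IntegrableOn F (Set.Ioi c)) :
    HasSum (fun j : ℕ => ∫ t in Set.Ioc (c + j) (c + j + 1), F t) (∫ t in Set.Ioi c, F t) := by
  have hU : (⋃ j : ℕ, Set.Ioc (c + j) (c + j + 1)) = Set.Ioi c := by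
    ext t
    simp only [Set.mem_iUnion, Set.mem_Ioc, Set.mem_Ioi]
    constructor
    · rintro ⟨j, h1, -⟩
      have : (0 : ℝ) ≤ j := Nat.cast_nonneg j
      linarith
    · intro ht
      obtain ⟨n, hn⟩ : ∃ n : ℕ, ⌈t - c⌉₊ = n + 1 :=
        Nat.exists_eq_succ_of_ne_zero (Nat.ceil_pos.2 (by linarith)).ne'
      refine ⟨n, ?_, ?_⟩
      · have := Nat.lt_ceil.1 (show n < ⌈t - c⌉₊ by omega)
        linarith
      · have := Nat.le_ceil (t - c)
        rw [hn] at this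
        push_cast at this
        linarith
  have hd : Pairwise (Function.onFun Disjoint fun j : ℕ => Set.Ioc (c + j) (c + j + 1)) := by
    intro i j hij
    rw [Function.onFun, Set.disjoint_left]
    rintro t ⟨h1, h2⟩ ⟨h3, h4⟩
    apply hij
    have h5 : (i : ℝ) < j + 1 := by linarith
    have h6 : (j : ℝ) < i + 1 := by linarith
    norm_cast at h5 h6
    omega
  have := hasSum_integral_iUnion (f := F) (μ := volume) (fun j : ℕ => measurableSet_Ioc) hd
    (by rw [hU]; exact hF)
  rwa [hU] at this

open MeasureTheory in
/-- First order comparison of a sum with an integral. -/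
theorem abs_tsum_sub_integral_le {F F' : ℝ → ℝ} (hd : ∀ t, 0 < t → HasDerivAt F (F' t) t)
    (hF : IntegrableOn F (Set.Ioi 0)) (hF' : IntegrableOn F' (Set.Ioi 0)) :
    |∑' j : ℕ, F ((j : ℝ) + 1) - ∫ t in Set.Ioi (0 : ℝ), F t| ≤ ∫ t in Set.Ioi (0 : ℝ), |F' t| := by
  have h1 := hasSum_integral_Ioc_nat hF
  have h2 := hasSum_integral_Ioc_nat (F := fun t => |F' t|) hF'.norm
  simp only [zero_add] at h1 h2
  have hsub : ∀ j : ℕ, Set.Ioc (j : ℝ) (j + 1) ⊆ Set.Ioi 0 := fun j t ht =>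
    lt_of_le_of_lt (Nat.cast_nonneg j) ht.1
  have hj : ∀ j : ℕ, |F ((j : ℝ) + 1) - ∫ t in Set.Ioc (j : ℝ) (j + 1), F t| ≤
      ∫ t in Set.Ioc (j : ℝ) (j + 1), |F' t| := by
    intro j
    have hpt : ∀ t ∈ Set.Ioc (j : ℝ) (j + 1), ‖F ((j : ℝ) + 1) - F t‖ ≤
        ∫ t in Set.Ioc (j : ℝ) (j + 1), |F' t| := by
      intro t ht
      have hs : Set.Ioc t ((j : ℝ) + 1) ⊆ Set.Ioc (j : ℝ) (j + 1) := Set.Ioc_subset_Ioc_left ht.1.le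
      have hii : IntervalIntegrable F' volume t ((j : ℝ) + 1) :=
        (intervalIntegrable_iff_integrableOn_Ioc_of_le ht.2).2 (hF'.mono_set (hs.trans (hsub j)))
      have := intervalIntegral.integral_eq_sub_of_hasDerivAt (f := F) (f' := F')
        (a := t) (b := (j : ℝ) + 1) (fun x hx => hd x (by
          rw [Set.uIcc_of_le ht.2] at hx
          exact (hsub j ht).trans_le hx.1)) hii
      rw [← this, intervalIntegral.integral_of_le ht.2]
      refine (norm_integral_le_integral_norm _).trans ?_
      exact setIntegral_mono_set (hF'.mono_set (hsub j)).norm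
        (Eventually.of_forall fun _ => abs_nonneg _) hs.eventuallyLE
    have hc : ∫ t in Set.Ioc (j : ℝ) (j + 1), (F ((j : ℝ) + 1) - F t) =
        F ((j : ℝ) + 1) - ∫ t in Set.Ioc (j : ℝ) (j + 1), F t := by
      rw [integral_sub (integrable_const _) (hF.mono_set (hsub j))]
      simp
    rw [← hc]
    have := norm_setIntegral_le_of_norm_le_const (μ := volume) (s := Set.Ioc (j : ℝ) (j + 1))
      (by simp) hpt
    simpa using this
  have hs1 : Summable fun j : ℕ => F ((j : ℝ) + 1) - ∫ t in Set.Ioc (j : ℝ) (j + 1), F t :=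
    Summable.of_norm_bounded h2.summable hj
  have hs2 : HasSum (fun j : ℕ => F ((j : ℝ) + 1))
      (∑' j : ℕ, (F ((j : ℝ) + 1) - ∫ t in Set.Ioc (j : ℝ) (j + 1), F t) +
        ∫ t in Set.Ioi (0 : ℝ), F t) := by
    simpa using hs1.hasSum.add h1
  rw [hs2.tsum_eq, add_sub_cancel_right, ← h2.tsum_eq]
  exact (norm_tsum_le_tsum_norm hs1.norm).trans (hs1.norm.tsum_le_tsum hj h2.summable)

open MeasureTheory in
/-- Midpoint rule with a second derivative bound that is a power of the variable. -/
theorem abs_tsum_sub_integral_Ioi_half_le {F F' F'' : ℝ → ℝ} {B κ : ℝ} (hκ : κ < 1)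
    (hd : ∀ t, 0 < t → HasDerivAt F (F' t) t) (hd' : ∀ t, 0 < t → HasDerivAt F' (F'' t) t)
    (hF : IntegrableOn F (Set.Ioi (1 / 2))) (hB : ∀ t, 0 < t → |F'' t| ≤ B * t ^ (κ - 2)) :
    |∑' j : ℕ, F ((j : ℝ) + 1) - ∫ t in Set.Ioi (1 / 2 : ℝ), F t| ≤
      B * (∑' j : ℕ, ((j : ℝ) + 1 / 2) ^ (κ - 2)) := by
  have h1 := hasSum_integral_Ioc_nat hF
  have hB0 : 0 ≤ B := by simpa using (abs_nonneg _).trans (hB 1 one_pos)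
  have hsm : Summable fun j : ℕ => ((j : ℝ) + 1 / 2) ^ (κ - 2) := by
    have := (Real.summable_one_div_nat_add_rpow (1 / 2) (2 - κ)).2 (by linarith)
    refine this.congr fun j => ?_
    rw [abs_of_pos (by positivity), one_div, ← Real.rpow_neg (by positivity), neg_sub]
  have hj : ∀ j : ℕ, ‖F ((j : ℝ) + 1) - ∫ t in Set.Ioc (1 / 2 + j : ℝ) (1 / 2 + j + 1), F t‖ ≤
      B * ((j : ℝ) + 1 / 2) ^ (κ - 2) := by
    intro j
    have hj0 : (0 : ℝ) ≤ j := Nat.cast_nonneg j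
    set I := Set.Icc (1 / 2 + j : ℝ) (1 / 2 + j + 1) with hI
    set M := B * ((j : ℝ) + 1 / 2) ^ (κ - 2) with hM
    have hM0 : 0 ≤ M := by positivity
    have hpos : ∀ t ∈ I, 0 < t := fun t ht => by have := ht.1; linarith
    have hmid : (j : ℝ) + 1 ∈ I := ⟨by linarith, by linarith⟩
    have hdist : ∀ t ∈ I, |t - (j + 1)| ≤ 1 / 2 := by
      rintro t ⟨h1, h2⟩
      rw [abs_le]; constructor <;> linarith
    have hF2 : ∀ t ∈ I, ‖F'' t‖ ≤ M := by
      intro t ht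
      refine (hB t (hpos t ht)).trans ?_
      rw [hM]
      gcongr B * ?_
      exact Real.rpow_le_rpow_of_nonpos (by positivity) (by linarith [ht.1]) (by linarith)
    have hF1 : ∀ t ∈ I, ‖F' t - F' (j + 1)‖ ≤ M := by
      intro t ht
      refine (Convex.norm_image_sub_le_of_norm_hasDerivWithin_le (f := F') (f' := F'')
        (fun x hx => (hd' x (hpos x hx)).hasDerivWithinAt) hF2 (convex_Icc _ _) hmid ht).trans ?_
      have := hdist t ht
      rw [Real.norm_eq_abs]
      nlinarith
    have hF0 : ∀ t ∈ I, ‖(F t - (t - (j + 1)) * F' (j + 1)) - F (j + 1)‖ ≤ M := by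
      intro t ht
      have := (Convex.norm_image_sub_le_of_norm_hasDerivWithin_le
        (f := fun t => F t - (t - (j + 1)) * F' (j + 1)) (f' := fun t => F' t - F' (j + 1))
        (fun x hx => ((((hd x (hpos x hx)).sub (((hasDerivAt_id x).sub_const _).mul_const _)).congr_deriv
          (by simp)).hasDerivWithinAt)) hF1 (convex_Icc _ _) hmid ht)
      simp only [sub_self, zero_mul, sub_zero] at this
      refine this.trans ?_
      have := hdist t ht
      rw [Real.norm_eq_abs]
      nlinarith
    have hsub : Set.Ioc (1 / 2 + j : ℝ) (1 / 2 + j + 1) ⊆ Set.Ioi (1 / 2) := fun t ht => by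
      have := ht.1
      simp only [Set.mem_Ioi]
      linarith
    have hlin : ∫ t in Set.Ioc (1 / 2 + j : ℝ) (1 / 2 + j + 1), (t - (j + 1)) * F' (j + 1) = 0 := by
      rw [← intervalIntegral.integral_of_le (by linarith), intervalIntegral.integral_mul_const,
        intervalIntegral.integral_sub (by simp) (by simp), integral_id,
        intervalIntegral.integral_const, smul_eq_mul]
      ring
    have hlini : IntegrableOn (fun t : ℝ => (t - (j + 1)) * F' (j + 1))
        (Set.Ioc (1 / 2 + j : ℝ) (1 / 2 + j + 1)) :=
      (Continuous.integrableOn_Icc (by fun_prop)).mono_set Set.Ioc_subset_Icc_self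
    have hc : ∫ t in Set.Ioc (1 / 2 + j : ℝ) (1 / 2 + j + 1),
        ((F t - (t - (j + 1)) * F' (j + 1)) - F (j + 1)) =
        -(F ((j : ℝ) + 1) - ∫ t in Set.Ioc (1 / 2 + j : ℝ) (1 / 2 + j + 1), F t) := by
      have e1 := integral_sub (μ := volume.restrict (Set.Ioc (1 / 2 + j : ℝ) (1 / 2 + j + 1)))
        (f := fun t => F t - (t - (j + 1)) * F' (j + 1)) (g := fun _ => F (j + 1))
        ((hF.mono_set hsub).sub hlini) (integrable_const _)
      rw [e1, integral_sub (hF.mono_set hsub) hlini, hlin]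
      simp
    rw [← norm_neg, ← hc]
    have := norm_setIntegral_le_of_norm_le_const (μ := volume)
      (s := Set.Ioc (1 / 2 + j : ℝ) (1 / 2 + j + 1)) (by simp)
      (fun t ht => hF0 t (Set.Ioc_subset_Icc_self ht))
    simpa using this
  have hs1 : Summable fun j : ℕ => F ((j : ℝ) + 1) -
      ∫ t in Set.Ioc (1 / 2 + j : ℝ) (1 / 2 + j + 1), F t :=
    Summable.of_norm_bounded (hsm.mul_left B) hj
  have hs2 : HasSum (fun j : ℕ => F ((j : ℝ) + 1))
      (∑' j : ℕ, (F ((j : ℝ) + 1) - ∫ t in Set.Ioc (1 / 2 + j : ℝ) (1 / 2 + j + 1), F t) +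
        ∫ t in Set.Ioi (1 / 2 : ℝ), F t) := by
    simpa using hs1.hasSum.add h1
  rw [hs2.tsum_eq, add_sub_cancel_right, ← tsum_mul_left]
  exact (norm_tsum_le_tsum_norm hs1.norm).trans (hs1.norm.tsum_le_tsum hj (hsm.mul_left B))

open MeasureTheory in
/-- The Mellin transform of an absolutely convergent combination of dilates. -/
theorem mellin_tsum_comp_mul_left {f : ℝ → ℂ} {s : ℂ} (hf : MellinConvergent f s) {c : ℕ → ℂ}
    {a : ℕ → ℝ} (ha : ∀ n, 0 < a n ∨ c n = 0) (hs : Summable fun n => ‖c n‖ * a n ^ (-s.re)) :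
    mellin (fun t => ∑' n, c n * f (a n * t)) s = (∑' n, c n * (a n : ℂ) ^ (-s)) * mellin f s := by
  set F : ℕ → ℝ → ℂ := fun n t => (t : ℂ) ^ (s - 1) • (c n * f (a n * t)) with hF
  have hFi : ∀ n, Integrable (F n) (volume.restrict (Set.Ioi 0)) := by
    intro n
    rcases ha n with h | h
    · have := ((MellinConvergent.comp_mul_left h).2 hf).const_smul (c n)
      exact this
    · simp [hF, h]
  have hFn : ∀ n, ∫ t in Set.Ioi (0 : ℝ), ‖F n t‖ =
      ‖c n‖ * a n ^ (-s.re) * ∫ t in Set.Ioi (0 : ℝ), t ^ (s.re - 1) * ‖f t‖ := by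
    intro n
    rcases ha n with h | h
    · have hc := integral_comp_mul_left_Ioi (fun t => t ^ (s.re - 1) * ‖f t‖) 0 h
      rw [mul_zero, smul_eq_mul] at hc
      have e : ∫ t in Set.Ioi (0 : ℝ), ‖F n t‖ = ∫ t in Set.Ioi (0 : ℝ),
          ‖c n‖ * a n ^ (1 - s.re) * ((a n * t) ^ (s.re - 1) * ‖f (a n * t)‖) := by
        refine setIntegral_congr_fun measurableSet_Ioi fun t ht => ?_
        have ht' : (0 : ℝ) < t := ht
        simp only [hF, norm_smul, norm_mul]
        rw [norm_cpow_eq_rpow_re_of_pos ht', Real.mul_rpow h.le ht'.le, sub_re, one_re,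
          show (1 - s.re) = -(s.re - 1) by ring, Real.rpow_neg h.le]
        have : a n ^ (s.re - 1) ≠ 0 := by positivity
        field_simp
      rw [e, integral_const_mul, hc, sub_eq_add_neg, Real.rpow_add h, Real.rpow_one]
      field_simp
    · simp [hF, h]
  have key := hasSum_integral_of_summable_integral_norm hFi (by
    simp only [hFn]; exact hs.mul_right _)
  rw [← tsum_mul_right]
  refine Eq.trans ?_ (key.tsum_eq.symm.trans (tsum_congr fun n => ?_))
  · rw [mellin]
    refine integral_congr_ae (Eventually.of_forall fun t => ?_)
    simp only [hF, smul_eq_mul]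
    rw [tsum_mul_left]
  · rcases ha n with h | h
    · have h1 := mellin_const_smul (fun t => f (a n * t)) s (c n)
      rw [mellin_comp_mul_left f s h] at h1
      simp only [smul_eq_mul] at h1
      rw [mul_assoc]
      simpa [mellin, hF] using h1
    · simp [hF, h]

/-- The transform `u ↦ u ∑ μ(m) w(mu)`. -/
noncomputable def moebiusTransform (w : ℝ → ℝ) (u : ℝ) : ℝ :=
  u * ∑' m : ℕ, (ArithmeticFunction.moebius m : ℝ) * w (m * u)

/-- A function on `(0, b]` of size `u ^ κ` whose logarithmic derivative has the same size. -/
structure PowerPair (h h₁ : ℝ → ℝ) (κ b C : ℝ) : Prop where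
  hasDerivAt : ∀ u, 0 < u → HasDerivAt h (h₁ u / u) u
  bound : ∀ u, 0 < u → |h u| ≤ C * u ^ κ
  bound₁ : ∀ u, 0 < u → |h₁ u| ≤ C * u ^ κ
  zero : ∀ u, b < u → h u = 0
  zero₁ : ∀ u, b < u → h₁ u = 0
  b_pos : 0 < b
  cont₁ : ContinuousOn h₁ (Set.Ioi 0)

namespace BumpOn

variable {w : ℝ → ℝ} {a b : ℝ}

theorem b_pos (hw : BumpOn w a b) : 0 < b := hw.pos.trans_le hw.le

theorem moebiusTransform_zero (hw : BumpOn w a b) {u : ℝ} (hu : b < u) :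
    moebiusTransform w u = 0 := by
  rw [moebiusTransform]
  convert mul_zero u
  convert tsum_zero with m
  rcases Nat.eq_zero_or_pos m with rfl | hm
  · simp
  · have h1 : (1 : ℝ) ≤ m := by exact_mod_cast hm
    have := hw.b_pos
    rw [hw.zero _ fun h => ?_, mul_zero]
    have := h.2
    nlinarith

theorem moebiusTransform_eq_sum (hw : BumpOn w a b) {u v : ℝ} {N : ℕ} (hu : 0 < u)
    (hN : b < N * u) (hv : u ≤ v) : moebiusTransform w v =
      v * ∑ m ∈ Finset.range N, (ArithmeticFunction.moebius m : ℝ) * w (m * v) := by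
  rw [moebiusTransform, tsum_eq_sum fun m hm => ?_]
  have h1 : (N : ℝ) ≤ m := by exact_mod_cast not_lt.1 fun h => hm (Finset.mem_range.2 h)
  rw [hw.zero _ fun h => ?_, mul_zero]
  have := h.2
  have : (N : ℝ) * u ≤ m * v := by gcongr
  linarith

theorem hasDerivAt_moebiusTransform (hw : BumpOn w a b) {u : ℝ} (hu : 0 < u) :
    HasDerivAt (moebiusTransform w) (moebiusTransform (fun t => w t + t * deriv w t) u / u) u := by
  obtain ⟨N, hN⟩ := exists_nat_gt (b / (u / 2))
  rw [div_lt_iff₀ (by positivity)] at hN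
  rw [(hw.add hw.mul_deriv).moebiusTransform_eq_sum (by positivity) hN (by linarith)]
  have he : moebiusTransform w =ᶠ[nhds u] fun v =>
      v * ∑ m ∈ Finset.range N, (ArithmeticFunction.moebius m : ℝ) * w (m * v) := by
    filter_upwards [lt_mem_nhds (show u / 2 < u by linarith)] with v hv
    exact hw.moebiusTransform_eq_sum (by positivity) hN hv.le
  refine HasDerivAt.congr_of_eventuallyEq ?_ he
  have hs : HasDerivAt (fun v => ∑ m ∈ Finset.range N, (ArithmeticFunction.moebius m : ℝ) * w (m * v))
      (∑ m ∈ Finset.range N, (ArithmeticFunction.moebius m : ℝ) * (deriv w (m * u) * m)) u := by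
    refine HasDerivAt.fun_sum fun m _ => HasDerivAt.const_mul _ ?_
    have h1 : HasDerivAt (fun v : ℝ => (m : ℝ) * v) m u := by
      simpa using (hasDerivAt_id u).const_mul (m : ℝ)
    exact (hw.hasDerivAt (m * u)).comp u h1
  refine ((hasDerivAt_id u).mul hs).congr_deriv ?_
  rw [mul_div_cancel_left₀ _ hu.ne', id, one_mul, Finset.mul_sum, ← Finset.sum_add_distrib]
  refine Finset.sum_congr rfl fun m _ => ?_
  ring

theorem continuousOn_moebiusTransform (hw : BumpOn w a b) :
    ContinuousOn (moebiusTransform w) (Set.Ioi 0) := fun _ hu =>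
  (hw.hasDerivAt_moebiusTransform hu).continuousAt.continuousWithinAt

theorem exists_moebiusTransform_le (hRH : RiemannHypothesis) (hw : BumpOn w a b) {κ : ℝ}
    (hκ : 0 ≤ κ) (hκ' : κ < 1 / 2) :
    ∃ C, 0 < C ∧ ∀ u : ℝ, 0 < u → |moebiusTransform w u| ≤ C * u ^ κ := by
  obtain ⟨C, hC, h⟩ := hw.exists_moebius_sum_le hRH (δ := 1 / 2 - κ) (by linarith) (by linarith)
  refine ⟨C, hC, fun u hu => ?_⟩
  rw [moebiusTransform, abs_mul, abs_of_pos hu]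
  calc _ ≤ u * (C * u ^ (-(1 / 2) - (1 / 2 - κ))) := by gcongr; exact h u hu
    _ = C * (u ^ (1 : ℝ) * u ^ (-(1 / 2) - (1 / 2 - κ))) := by rw [Real.rpow_one]; ring
    _ = _ := by rw [← Real.rpow_add hu]; ring_nf

theorem exists_powerPair (hRH : RiemannHypothesis) (hw : BumpOn w a b) {κ : ℝ}
    (hκ : 0 ≤ κ) (hκ' : κ < 1 / 2) : ∃ C, 0 < C ∧ PowerPair (moebiusTransform w)
      (moebiusTransform fun t => w t + t * deriv w t) κ b C := by
  obtain ⟨C, hC, h⟩ := hw.exists_moebiusTransform_le hRH hκ hκ'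
  have hw' := hw.add hw.mul_deriv
  obtain ⟨D, hD, h'⟩ := hw'.exists_moebiusTransform_le hRH hκ hκ'
  refine ⟨C + D, by positivity, fun u hu => hw.hasDerivAt_moebiusTransform hu, fun u hu => ?_,
    fun u hu => ?_, fun u hu => hw.moebiusTransform_zero hu, fun u hu => hw'.moebiusTransform_zero hu,
    hw.b_pos, hw'.continuousOn_moebiusTransform⟩
  · refine (h u hu).trans ?_
    gcongr
    linarith
  · refine (h' u hu).trans ?_
    gcongr
    linarith

/-- The Mellin transform of `moebiusTransform w` in the region of absolute convergence. -/
theorem mellin_moebiusTransform (hw : BumpOn w a b) {s : ℂ} (hs : 0 < s.re) :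
    mellin (fun u => (moebiusTransform w u : ℂ)) s =
      LSeries (fun n => (ArithmeticFunction.moebius n : ℂ)) (1 + s) *
        mellin (fun t => (w t : ℂ)) (1 + s) := by
  have hf : MellinConvergent (fun t : ℝ => (t : ℂ) ^ (1 : ℂ) • (w t : ℂ)) s :=
    MellinConvergent.cpow_smul.2 (hw.mellinConvergent _)
  have hnorm : ∀ n : ℕ, ‖(ArithmeticFunction.moebius n : ℂ)‖ ≤ 1 := fun n => by
    rw [norm_intCast]
    exact_mod_cast ArithmeticFunction.abs_moebius_le_one
  have := mellin_tsum_comp_mul_left hf (c := fun n => (ArithmeticFunction.moebius n : ℂ) / n)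
    (a := fun n => n) (fun n => by
      rcases Nat.eq_zero_or_pos n with rfl | h
      · exact Or.inr (by simp)
      · exact Or.inl (by exact_mod_cast h)) (by
      refine Summable.of_nonneg_of_le (fun n => by positivity) (fun n => ?_)
        (Real.summable_one_div_nat_rpow.2 (show 1 < 1 + s.re by linarith))
      rcases Nat.eq_zero_or_pos n with rfl | h
      · simp; positivity
      · have hn : (0 : ℝ) < n := by exact_mod_cast h
        rw [norm_div, norm_natCast, Real.rpow_add hn, Real.rpow_one, Real.rpow_neg hn.le,
          ← div_eq_mul_inv, div_div]
        gcongr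
        exact hnorm n)
  rw [mellin_cpow_smul, add_comm s 1] at this
  refine Eq.trans ?_ (this.trans ?_)
  · congr 1
    ext u
    rw [moebiusTransform]
    push_cast
    rw [← tsum_mul_left]
    refine tsum_congr fun n => ?_
    rcases eq_or_ne n 0 with rfl | h
    · simp
    · have : (n : ℂ) ≠ 0 := by exact_mod_cast h
      rw [cpow_one, smul_eq_mul]
      field_simp
  · congr 1
    rw [LSeries]
    refine tsum_congr fun n => ?_
    rcases eq_or_ne n 0 with rfl | h
    · simp
    · have : (n : ℂ) ≠ 0 := by exact_mod_cast h
      rw [LSeries.term_of_ne_zero h, cpow_add _ _ this, cpow_one, ofReal_natCast, cpow_neg]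
      field_simp

end BumpOn

namespace PowerPair

variable {h h₁ : ℝ → ℝ} {κ b C : ℝ}

theorem continuousOn (H : PowerPair h h₁ κ b C) : ContinuousOn h (Set.Ioi 0) := fun u hu =>
  (H.hasDerivAt u hu).continuousAt.continuousWithinAt

theorem locallyIntegrableOn (H : PowerPair h h₁ κ b C) :
    MeasureTheory.LocallyIntegrableOn (fun t => (h t : ℂ)) (Set.Ioi 0) :=
  (continuous_ofReal.comp_continuousOn H.continuousOn).locallyIntegrableOn measurableSet_Ioi

theorem isBigO_top (H : PowerPair h h₁ κ b C) (c : ℝ) :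
    (fun t => (h t : ℂ)) =O[atTop] (fun t : ℝ => t ^ (-c)) := by
  refine Asymptotics.IsBigO.of_bound 1 ?_
  filter_upwards [eventually_gt_atTop b] with t ht
  rw [H.zero t ht]
  simp

theorem isBigO_zero (H : PowerPair h h₁ κ b C) :
    (fun t => (h t : ℂ)) =O[nhdsWithin 0 (Set.Ioi 0)] (fun t : ℝ => t ^ (-(-κ))) := by
  refine Asymptotics.IsBigO.of_bound C ?_
  filter_upwards [self_mem_nhdsWithin] with t ht
  rw [neg_neg, norm_real, Real.norm_eq_abs, Real.norm_of_nonneg (Real.rpow_nonneg (le_of_lt ht) _)]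
  exact H.bound t ht

theorem mellinConvergent (H : PowerPair h h₁ κ b C) {s : ℂ} (hs : -κ < s.re) :
    MellinConvergent (fun t => (h t : ℂ)) s :=
  mellinConvergent_of_isBigO_rpow H.locallyIntegrableOn (H.isBigO_top (s.re + 1)) (by linarith)
    H.isBigO_zero hs

theorem differentiableAt_mellin (H : PowerPair h h₁ κ b C) {s : ℂ} (hs : -κ < s.re) :
    DifferentiableAt ℂ (mellin fun t => (h t : ℂ)) s :=
  mellin_differentiableAt_of_isBigO_rpow H.locallyIntegrableOn (H.isBigO_top (s.re + 1))
    (by linarith) H.isBigO_zero hs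

end PowerPair

/-- The transform `v ↦ ∑ h(v/e)/e`. -/
noncomputable def harmonicTransform (h : ℝ → ℝ) (v : ℝ) : ℝ := ∑' e : ℕ, h (v / e) / e

namespace PowerPair

variable {h h₁ : ℝ → ℝ} {κ b C : ℝ}

theorem C_nonneg (H : PowerPair h h₁ κ b C) : 0 ≤ C := by
  simpa using (abs_nonneg _).trans (H.bound 1 one_pos)

theorem abs_term_le (H : PowerPair h h₁ κ b C) {v : ℝ} (hv : 0 < v) (e : ℕ) :
    |h (v / e) / e| ≤ C * v ^ κ * (1 / (e : ℝ) ^ (1 + κ)) := by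
  rcases Nat.eq_zero_or_pos e with rfl | he
  · have := H.C_nonneg
    simp; positivity
  · have he' : (0 : ℝ) < e := by exact_mod_cast he
    rw [abs_div, abs_of_pos he', div_le_iff₀ he']
    refine (H.bound _ (div_pos hv he')).trans (le_of_eq ?_)
    rw [Real.div_rpow hv.le he'.le, Real.rpow_add he', Real.rpow_one]
    field_simp

theorem summable_term (H : PowerPair h h₁ κ b C) (hκ : 0 < κ) {v : ℝ} (hv : 0 < v) :
    Summable fun e : ℕ => h (v / e) / e :=
  Summable.of_norm_bounded ((Real.summable_one_div_nat_rpow.2 (by linarith)).mul_left _)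
    (H.abs_term_le hv)

theorem abs_harmonicTransform_le (H : PowerPair h h₁ κ b C) (hκ : 0 < κ) {v : ℝ} (hv : 0 < v) :
    |harmonicTransform h v| ≤ C * (∑' e : ℕ, 1 / (e : ℝ) ^ (1 + κ)) * v ^ κ := by
  have hs := (Real.summable_one_div_nat_rpow.2 (show 1 < 1 + κ by linarith)).mul_left (C * v ^ κ)
  have := tsum_of_norm_bounded (f := fun e : ℕ => h (v / e) / e) hs.hasSum (H.abs_term_le hv)
  rw [tsum_mul_left] at this
  refine this.trans (le_of_eq (by ring))

theorem continuousOn_harmonicTransform (H : PowerPair h h₁ κ b C) (hκ : 0 < κ) :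
    ContinuousOn (harmonicTransform h) (Set.Ioi 0) := by
  intro v hv
  have hv' : (0 : ℝ) < v := hv
  have : ContinuousOn (harmonicTransform h) (Set.Ioo 0 (2 * v)) := by
    refine continuousOn_tsum (u := fun e : ℕ => C * (2 * v) ^ κ * (1 / (e : ℝ) ^ (1 + κ)))
      (fun e => ?_) ((Real.summable_one_div_nat_rpow.2 (by linarith)).mul_left _)
      fun e x hx => (H.abs_term_le hx.1 e).trans ?_
    · rcases Nat.eq_zero_or_pos e with rfl | he
      · simpa using continuousOn_const
      · have he' : (0 : ℝ) < e := by exact_mod_cast he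
        refine ContinuousOn.div_const (H.continuousOn.comp (by fun_prop) fun x hx => ?_) _
        exact div_pos hx.1 he'
    · have := H.C_nonneg
      have := hx.1
      have := hx.2
      gcongr
  exact (this.continuousAt (Ioo_mem_nhds hv' (by linarith))).continuousWithinAt

open MeasureTheory in
theorem exists_abs_harmonicTransform_le_inv (H : PowerPair h h₁ κ b C) (hκ : 0 < κ)
    (h0 : mellin (fun t => (h t : ℂ)) 0 = 0) :
    ∃ D, 0 < D ∧ ∀ v, 0 < v → |harmonicTransform h v| ≤ D * v ^ (-1 : ℝ) := by
  have hb := H.b_pos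
  have hC := H.C_nonneg
  refine ⟨2 * C * ((2 * b) ^ (κ + 1) / (κ + 1)) + 1, by positivity, fun v hv => ?_⟩
  set c := v / (2 * b) with hc
  have hc0 : 0 < c := by positivity
  have hzero : ∀ t, 0 < t → t ≤ c → b < v / t := by
    intro t ht htc
    rw [hc, le_div_iff₀ (by positivity)] at htc
    rw [lt_div_iff₀ ht]
    nlinarith
  have hbd : ∀ t, 0 < t → (v / t) ^ κ = v ^ κ * t ^ (-κ) := fun t ht => by
    rw [Real.div_rpow hv.le ht.le, Real.rpow_neg ht.le]; rfl
  have hmain : ∀ p : ℝ, p < -1 → IntegrableOn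
      (Set.indicator (Set.Ioi c) fun t : ℝ => 2 * C * v ^ κ * t ^ p) (Set.Ioi 0) := by
    intro p hp
    refine Integrable.integrableOn ?_
    rw [integrable_indicator_iff measurableSet_Ioi]
    exact (integrableOn_Ioi_rpow_of_lt hp hc0).const_mul _
  have hcomp : ContinuousOn (fun t : ℝ => v / t) (Set.Ioi 0) :=
    continuousOn_const.div continuousOn_id fun t ht => ne_of_gt ht
  have hmaps : Set.MapsTo (fun t : ℝ => v / t) (Set.Ioi 0) (Set.Ioi 0) := fun t ht => div_pos hv ht
  have hd : ∀ t, 0 < t → HasDerivAt (fun t => h (v / t) / t)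
      (-(h₁ (v / t) + h (v / t)) / t ^ 2) t := by
    intro t ht
    have h1 : HasDerivAt (fun t : ℝ => v / t) (-v / t ^ 2) t := by
      have := (hasDerivAt_inv ht.ne').const_mul v
      refine this.congr_deriv ?_
      ring
    have h2 := (H.hasDerivAt _ (div_pos hv ht)).comp t h1
    refine (h2.fun_div (hasDerivAt_id t) ht.ne').congr_deriv ?_
    simp only [Function.comp, id]
    field_simp
    ring
  have hFi : IntegrableOn (fun t => h (v / t) / t) (Set.Ioi 0) := by
    refine (hmain (-1 - κ) (by linarith)).mono' ?_ ?_
    · exact ((H.continuousOn.comp hcomp hmaps).div continuousOn_id fun t ht =>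
        ne_of_gt ht).aestronglyMeasurable measurableSet_Ioi
    · filter_upwards [ae_restrict_mem measurableSet_Ioi] with t ht
      have ht' : 0 < t := ht
      by_cases htc : t ≤ c
      · simp [H.zero _ (hzero t ht' htc), Set.indicator, not_lt.2 htc]
      · rw [Set.indicator_of_mem (show t ∈ Set.Ioi c from not_le.1 htc), norm_div, Real.norm_eq_abs, Real.norm_of_nonneg ht'.le,
          div_le_iff₀ ht']
        refine (H.bound _ (div_pos hv ht')).trans ?_
        rw [hbd t ht', sub_eq_add_neg, Real.rpow_add ht', Real.rpow_neg_one]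
        have : 0 ≤ C * (v ^ κ * t ^ (-κ)) := by positivity
        calc _ ≤ 2 * (C * (v ^ κ * t ^ (-κ))) := by linarith
          _ = _ := by field_simp
  have hF'b : ∀ t, 0 < t → ‖-(h₁ (v / t) + h (v / t)) / t ^ 2‖ ≤
      Set.indicator (Set.Ioi c) (fun t : ℝ => 2 * C * v ^ κ * t ^ (-(κ + 2))) t := by
    intro t ht'
    by_cases htc : t ≤ c
    · simp [H.zero _ (hzero t ht' htc), H.zero₁ _ (hzero t ht' htc), Set.indicator, not_lt.2 htc]
    · rw [Set.indicator_of_mem (show t ∈ Set.Ioi c from not_le.1 htc), norm_div, norm_neg, Real.norm_eq_abs,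
        Real.norm_of_nonneg (by positivity), div_le_iff₀ (by positivity)]
      refine (abs_add_le _ _).trans ((add_le_add (H.bound₁ _ (div_pos hv ht'))
        (H.bound _ (div_pos hv ht'))).trans (le_of_eq ?_))
      rw [hbd t ht', neg_add, Real.rpow_add ht', Real.rpow_neg ht'.le 2, Real.rpow_two]
      field_simp
      ring
  have hF'i : IntegrableOn (fun t => -(h₁ (v / t) + h (v / t)) / t ^ 2) (Set.Ioi 0) := by
    refine (hmain (-(κ + 2)) (by linarith)).mono' ?_ ?_
    · exact (((H.cont₁.comp hcomp hmaps).add (H.continuousOn.comp hcomp hmaps)).neg.div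
        (continuousOn_id.pow 2) fun t ht => pow_ne_zero 2 (ne_of_gt ht)).aestronglyMeasurable
          measurableSet_Ioi
    · filter_upwards [ae_restrict_mem measurableSet_Ioi] with t ht using hF'b t ht
  have hint : ∫ t in Set.Ioi (0 : ℝ), h (v / t) / t = 0 := by
    have h1 := mellin_comp_inv (fun t => (h (v * t) : ℂ)) 0
    rw [mellin_comp_mul_left (fun t => (h t : ℂ)) _ hv, neg_zero, h0, smul_zero, mellin] at h1
    rw [← ofReal_inj, ofReal_zero, ← h1, ← integral_complex_ofReal]
    refine setIntegral_congr_fun measurableSet_Ioi fun t ht => ?_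
    rw [zero_sub, cpow_neg_one, smul_eq_mul]
    push_cast
    rw [div_eq_mul_inv, div_eq_mul_inv, mul_comm]
  have hsum := abs_tsum_sub_integral_le hd hFi hF'i
  rw [hint, sub_zero] at hsum
  have hK : harmonicTransform h v = ∑' j : ℕ, h (v / ((j : ℝ) + 1)) / ((j : ℝ) + 1) := by
    rw [harmonicTransform, (H.summable_term hκ hv).tsum_eq_zero_add]
    simp
  rw [hK]
  refine hsum.trans ?_
  calc _ ≤ ∫ t in Set.Ioi (0 : ℝ), Set.indicator (Set.Ioi c)
          (fun t : ℝ => 2 * C * v ^ κ * t ^ (-(κ + 2))) t :=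
        setIntegral_mono_on hF'i.norm (hmain _ (by linarith)) measurableSet_Ioi
          fun t ht => hF'b t ht
    _ = 2 * C * v ^ κ * (c ^ (-(κ + 1)) / (κ + 1)) := by
        rw [setIntegral_indicator measurableSet_Ioi, Set.inter_eq_right.2
          (Set.Ioi_subset_Ioi hc0.le), integral_const_mul, integral_Ioi_rpow_of_lt (by linarith) hc0]
        congr 1
        rw [show -(κ + 2) + 1 = -(κ + 1) by ring, neg_div_neg_eq]
    _ = 2 * C * ((2 * b) ^ (κ + 1) / (κ + 1)) * v ^ (-1 : ℝ) := by
        rw [hc, Real.div_rpow hv.le (by positivity), Real.rpow_neg (by positivity : 0 ≤ 2 * b),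
          show (-1 : ℝ) = κ + -(κ + 1) by ring, Real.rpow_add hv]
        field_simp
    _ ≤ _ := by gcongr; linarith

theorem mellin_harmonicTransform (H : PowerPair h h₁ κ b C) {s : ℂ} (hs : -κ < s.re)
    (hs' : s.re < 0) : mellin (fun v => (harmonicTransform h v : ℂ)) s =
      riemannZeta (1 - s) * mellin (fun t => (h t : ℂ)) s := by
  have := mellin_tsum_comp_mul_left (H.mellinConvergent hs) (c := fun n : ℕ => 1 / (n : ℂ))
    (a := fun n : ℕ => 1 / (n : ℝ)) (fun n => by
      rcases Nat.eq_zero_or_pos n with rfl | h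
      · exact Or.inr (by simp)
      · exact Or.inl (by positivity)) (by
      refine (Real.summable_one_div_nat_rpow.2 (show 1 < 1 - s.re by linarith)).congr fun n => ?_
      rcases Nat.eq_zero_or_pos n with rfl | h
      · simp
        rw [Real.zero_rpow (by linarith)]
      · have hn : (0 : ℝ) < n := by exact_mod_cast h
        rw [norm_div, norm_natCast, norm_one, Real.div_rpow one_pos.le hn.le, Real.one_rpow,
          sub_eq_add_neg, Real.rpow_add hn, Real.rpow_one]
        field_simp)
  rw [zeta_eq_tsum_one_div_nat_cpow (by rw [sub_re, one_re]; linarith)]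
  refine Eq.trans ?_ (this.trans ?_)
  · congr 1
    ext v
    rw [harmonicTransform]
    push_cast
    refine tsum_congr fun n => ?_
    rw [show (1 / (n : ℝ)) * v = v / n by ring]
    ring
  · congr 1
    refine tsum_congr fun n => ?_
    rcases Nat.eq_zero_or_pos n with rfl | h
    · have : (1 - s) ≠ 0 := fun h => by
        have := congrArg re h
        simp at this
        linarith
      simp [zero_cpow this]
    · have hn : (n : ℂ) ≠ 0 := by exact_mod_cast h.ne'
      rw [cpow_sub _ _ hn, cpow_one]
      have : ((1 / (n : ℝ) : ℝ) : ℂ) ^ (-s) = (n : ℂ) ^ s := by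
        rw [one_div, ofReal_inv, ofReal_natCast, inv_cpow _ _ (by
          rw [natCast_arg]; exact Real.pi_pos.ne), cpow_neg, inv_inv]
      rw [this]
      field_simp

end PowerPair

open MeasureTheory in
/-- Parseval's formula for the Mellin transform. -/
theorem integral_mul_eq_integral_mellin_mul {f g : ℝ → ℂ} {σ τ : ℝ} (hf : MellinConvergent f σ)
    (hFf : VerticalIntegrable (mellin f) σ) (hfc : ContinuousOn f (Set.Ioi 0))
    (hg : MellinConvergent g ((τ - σ : ℝ) : ℂ)) :
    ∫ t in Set.Ioi (0 : ℝ), (t : ℂ) ^ ((τ : ℂ) - 1) * (f t * g t) =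
      (1 / (2 * Real.pi) : ℝ) *
        ∫ y : ℝ, mellin f (σ + y * I) * mellin g (τ - (σ + y * I)) := by
  have hFf' : Integrable fun y : ℝ => mellin f (σ + y * I) := hFf
  have hg' : Integrable (fun t : ℝ => (t : ℂ) ^ (((τ - σ : ℝ) : ℂ) - 1) • g t)
    (volume.restrict (Set.Ioi 0)) := hg
  have hG : Integrable (Function.uncurry fun (t y : ℝ) => exp (-((y * Real.log t : ℝ) : ℂ) * I) *
      (((t : ℂ) ^ (((τ - σ : ℝ) : ℂ) - 1) • g t) * mellin f (σ + y * I)))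
      ((volume.restrict (Set.Ioi 0)).prod volume) := by
    refine (hg'.mul_prod hFf').bdd_mul (c := 1) ?_ (Eventually.of_forall fun p => ?_)
    · refine Measurable.aestronglyMeasurable ?_
      fun_prop
    · rw [← ofReal_neg, norm_exp_ofReal_mul_I]
  have hexp : ∀ t : ℝ, 0 < t → ∀ y : ℝ, exp (-((y * Real.log t : ℝ) : ℂ) * I) =
      (t : ℂ) ^ (-(y * I)) := by
    intro t ht y
    rw [cpow_def_of_ne_zero (by exact_mod_cast ht.ne'), ← ofReal_log ht.le]
    push_cast
    ring_nf
  have hswap := integral_integral_swap hG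
  rw [← integral_const_mul]
  have hleft : ∫ t in Set.Ioi (0 : ℝ), (t : ℂ) ^ ((τ : ℂ) - 1) * (f t * g t) =
      (1 / (2 * Real.pi) : ℝ) * ∫ t in Set.Ioi (0 : ℝ), ∫ y : ℝ,
        exp (-((y * Real.log t : ℝ) : ℂ) * I) *
      (((t : ℂ) ^ (((τ - σ : ℝ) : ℂ) - 1) • g t) * mellin f (σ + y * I)) := by
    rw [← integral_const_mul]
    refine setIntegral_congr_fun measurableSet_Ioi fun t ht => ?_
    have ht' : (0 : ℝ) < t := ht
    have ht0 : (t : ℂ) ≠ 0 := by exact_mod_cast ht'.ne'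
    have hinv := mellinInv_mellin_eq σ f ht' hf hFf (hfc.continuousAt (Ioi_mem_nhds ht'))
    conv_lhs => rw [← hinv, mellinInv]
    rw [real_smul, mul_assoc, mul_left_comm, mul_comm _ (g t), ← mul_assoc _ (g t),
      ← integral_const_mul]
    congr 2
    ext y
    rw [hexp t ht', smul_eq_mul, smul_eq_mul]
    have : (t : ℂ) ^ ((τ : ℂ) - 1) * (t : ℂ) ^ (-(σ + y * I : ℂ)) =
        (t : ℂ) ^ (-(y * I)) * (t : ℂ) ^ (((τ - σ : ℝ) : ℂ) - 1) := by
      rw [← cpow_add _ _ ht0, ← cpow_add _ _ ht0]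
      push_cast
      ring_nf
    linear_combination (g t * mellin f (σ + y * I)) * this
  rw [hleft, hswap, ← integral_const_mul]
  congr 1
  ext y
  congr 1
  rw [mellin, mellin, mul_comm (∫ t in Set.Ioi (0 : ℝ), (t : ℂ) ^ ((σ : ℂ) + y * I - 1) • f t),
    ← mellin, ← integral_mul_const]
  refine setIntegral_congr_fun measurableSet_Ioi fun t ht => ?_
  have ht' : (0 : ℝ) < t := ht
  have ht0 : (t : ℂ) ≠ 0 := by exact_mod_cast ht'.ne'
  rw [hexp t ht', smul_eq_mul, smul_eq_mul]
  have : (t : ℂ) ^ ((τ : ℂ) - (σ + y * I) - 1) =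
        (t : ℂ) ^ (-(y * I)) * (t : ℂ) ^ (((τ - σ : ℝ) : ℂ) - 1) := by
    rw [← cpow_add _ _ ht0]
    push_cast
    ring_nf
  rw [this]
  ring

theorem mellinW_eq_mellin (w : ℝ → ℝ) (s : ℂ) : mellinW w s = mellin (fun t => (w t : ℂ)) s := by
  rw [mellinW, mellin]
  refine MeasureTheory.integral_congr_ae (Eventually.of_forall fun t => ?_)
  simp [mul_comm]

namespace BumpOn

variable {w : ℝ → ℝ} {a b : ℝ}

open MeasureTheory in
theorem integral_sq_mul_eq (hw : BumpOn w a b) {c : ℝ} (hc : |c| ≤ 3) :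
    ((∫ t in Set.Ioi (0 : ℝ), w t ^ 2 * t : ℝ) : ℂ) = (1 / (2 * Real.pi) : ℝ) *
      ∫ y : ℝ, mellin (fun t => (w t : ℂ)) (c + y * I) *
        mellin (fun t => (w t : ℂ)) (2 - (c + y * I)) := by
  have := integral_mul_eq_integral_mellin_mul (τ := 2) (hw.mellinConvergent c)
    (hw.verticalIntegrable_mellin hc) (continuous_ofReal.comp hw.continuous).continuousOn
    (hw.mellinConvergent ((2 - c : ℝ) : ℂ))
  rw [ofReal_ofNat] at this
  rw [← this, ← integral_complex_ofReal]
  refine setIntegral_congr_fun measurableSet_Ioi fun t ht => ?_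
  rw [show (2 : ℂ) - 1 = 1 by norm_num, cpow_one]
  push_cast
  ring

theorem VI_mellinW (hw : BumpOn w a b) {c : ℝ} (hc : |c| ≤ 3) :
    VI c (fun s => mellinW w (2 - s) * mellinW w s) =
      ((∫ t in Set.Ioi (0 : ℝ), w t ^ 2 * t : ℝ) : ℂ) := by
  rw [hw.integral_sq_mul_eq hc, VI, MeasureTheory.integral_mul_const]
  simp only [mellinW_eq_mellin]
  push_cast
  have := I_ne_zero
  have : (Real.pi : ℂ) ≠ 0 := by exact_mod_cast Real.pi_ne_zero
  simp only [mul_comm (mellin (fun t => (w t : ℂ)) (2 - _))]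
  field_simp

/-- A line approaching `s` horizontally from the right. -/
theorem tendsto_add_ofReal (s : ℂ) :
    Tendsto (fun x : ℝ => s + x) (nhdsWithin 0 (Set.Ioi 0)) (nhds s) := by
  have : Continuous fun x : ℝ => s + (x : ℂ) := by fun_prop
  simpa using (this.tendsto 0).mono_left nhdsWithin_le_nhds

theorem zeta_mul_mellin_moebiusTransform (hw : BumpOn w a b) {h₁ : ℝ → ℝ} {κ C : ℝ} (hκ : 0 < κ)
    (H : PowerPair (moebiusTransform w) h₁ κ b C) {s : ℂ} (hs : 0 ≤ s.re) :
    riemannZeta₁ (1 + s) * mellin (fun u => (moebiusTransform w u : ℂ)) s =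
      s * mellin (fun t => (w t : ℂ)) (1 + s) := by
  have hpos : ∀ s : ℂ, 0 < s.re →
      riemannZeta₁ (1 + s) * mellin (fun u => (moebiusTransform w u : ℂ)) s =
      s * mellin (fun t => (w t : ℂ)) (1 + s) := by
    intro s hs
    have h1 : 1 < (1 + s).re := by simpa using hs
    have hs0 : 1 + s ≠ 1 := by
      intro h
      rw [h] at h1
      simp at h1
    have hz : riemannZeta₁ (1 + s) ≠ 0 := by
      intro h
      have := riemannZeta_ne_zero_of_one_lt_re h1
      rw [riemannZeta_eq_inv_sub_mul hs0, h, mul_zero] at this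
      exact this rfl
    rw [hw.mellin_moebiusTransform hs, LSeries_moebius_eq h1]
    field_simp
    ring
  have hL : ContinuousAt (fun s => riemannZeta₁ (1 + s) *
      mellin (fun u => (moebiusTransform w u : ℂ)) s) s := by
    refine ContinuousAt.mul ?_ (H.differentiableAt_mellin (by linarith)).continuousAt
    exact (differentiable_riemannZeta₁.continuous.comp (by fun_prop)).continuousAt
  have hR : ContinuousAt (fun s => s * mellin (fun t => (w t : ℂ)) (1 + s)) s :=
    (continuous_id.mul (hw.differentiable_mellin.continuous.comp (by fun_prop))).continuousAt
  have hl := tendsto_add_ofReal s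
  refine tendsto_nhds_unique ((hL.tendsto.comp hl)) ((hR.tendsto.comp hl).congr' ?_)
  filter_upwards [self_mem_nhdsWithin] with x hx
  refine (hpos _ ?_).symm
  have : (0 : ℝ) < x := hx
  simp
  linarith

theorem mellin_moebiusTransform_zero (hw : BumpOn w a b) {h₁ : ℝ → ℝ} {κ C : ℝ} (hκ : 0 < κ)
    (H : PowerPair (moebiusTransform w) h₁ κ b C) :
    mellin (fun u => (moebiusTransform w u : ℂ)) 0 = 0 := by
  have := hw.zeta_mul_mellin_moebiusTransform hκ H (s := 0) (by simp)
  simpa using this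

end BumpOn

namespace PowerPair

variable {h h₁ : ℝ → ℝ} {κ b C : ℝ}

theorem isBigO_harmonicTransform_zero (H : PowerPair h h₁ κ b C) (hκ : 0 < κ) :
    (fun v => (harmonicTransform h v : ℂ)) =O[nhdsWithin 0 (Set.Ioi 0)]
      (fun t : ℝ => t ^ (-(-κ))) := by
  refine Asymptotics.IsBigO.of_bound (C * (∑' e : ℕ, 1 / (e : ℝ) ^ (1 + κ))) ?_
  filter_upwards [self_mem_nhdsWithin] with t ht
  rw [neg_neg, norm_real, Real.norm_eq_abs, Real.norm_of_nonneg (Real.rpow_nonneg (le_of_lt ht) _)]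
  exact H.abs_harmonicTransform_le hκ ht

theorem isBigO_harmonicTransform_top (H : PowerPair h h₁ κ b C) (hκ : 0 < κ)
    (h0 : mellin (fun t => (h t : ℂ)) 0 = 0) :
    (fun v => (harmonicTransform h v : ℂ)) =O[atTop] (fun t : ℝ => t ^ (-(1 : ℝ))) := by
  obtain ⟨D, hD, hb⟩ := H.exists_abs_harmonicTransform_le_inv hκ h0
  refine Asymptotics.IsBigO.of_bound D ?_
  filter_upwards [eventually_gt_atTop 0] with t ht
  rw [norm_real, Real.norm_eq_abs, Real.norm_of_nonneg (Real.rpow_nonneg (le_of_lt ht) _)]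
  exact hb t ht

theorem locallyIntegrableOn_harmonicTransform (H : PowerPair h h₁ κ b C) (hκ : 0 < κ) :
    MeasureTheory.LocallyIntegrableOn (fun t => (harmonicTransform h t : ℂ)) (Set.Ioi 0) :=
  (continuous_ofReal.comp_continuousOn (H.continuousOn_harmonicTransform hκ)).locallyIntegrableOn
    measurableSet_Ioi

theorem mellinConvergent_harmonicTransform (H : PowerPair h h₁ κ b C) (hκ : 0 < κ)
    (h0 : mellin (fun t => (h t : ℂ)) 0 = 0) {s : ℂ} (hs : -κ < s.re) (hs' : s.re < 1) :
    MellinConvergent (fun v => (harmonicTransform h v : ℂ)) s :=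
  mellinConvergent_of_isBigO_rpow (H.locallyIntegrableOn_harmonicTransform hκ)
    (H.isBigO_harmonicTransform_top hκ h0) hs' (H.isBigO_harmonicTransform_zero hκ) hs

theorem differentiableAt_mellin_harmonicTransform (H : PowerPair h h₁ κ b C) (hκ : 0 < κ)
    (h0 : mellin (fun t => (h t : ℂ)) 0 = 0) {s : ℂ} (hs : -κ < s.re) (hs' : s.re < 1) :
    DifferentiableAt ℂ (mellin fun v => (harmonicTransform h v : ℂ)) s :=
  mellin_differentiableAt_of_isBigO_rpow (H.locallyIntegrableOn_harmonicTransform hκ)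
    (H.isBigO_harmonicTransform_top hκ h0) hs' (H.isBigO_harmonicTransform_zero hκ) hs

theorem mul_mellin_harmonicTransform (H : PowerPair h h₁ κ b C) (hκ : 0 < κ)
    (h0 : mellin (fun t => (h t : ℂ)) 0 = 0) (y : ℝ) :
    (-(y * I)) * mellin (fun v => (harmonicTransform h v : ℂ)) (y * I) =
      riemannZeta₁ (1 - y * I) * mellin (fun t => (h t : ℂ)) (y * I) := by
  set s : ℂ := y * I with hs
  have hre : s.re = 0 := by simp [hs]
  have hL : ContinuousAt (fun s => (-s) * mellin (fun v => (harmonicTransform h v : ℂ)) s) s :=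
    continuousAt_id.neg.mul (H.differentiableAt_mellin_harmonicTransform hκ h0 (by linarith)
      (by linarith)).continuousAt
  have hR : ContinuousAt (fun s => riemannZeta₁ (1 - s) * mellin (fun t => (h t : ℂ)) s) s := by
    refine ContinuousAt.mul ?_ (H.differentiableAt_mellin (by linarith)).continuousAt
    exact (differentiable_riemannZeta₁.continuous.comp (by fun_prop)).continuousAt
  have hl : Tendsto (fun x : ℝ => s - x) (nhdsWithin 0 (Set.Ioi 0)) (nhds s) := by
    have : Continuous fun x : ℝ => s - (x : ℂ) := by fun_prop
    simpa using (this.tendsto 0).mono_left nhdsWithin_le_nhds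
  refine tendsto_nhds_unique (hL.tendsto.comp hl) ((hR.tendsto.comp hl).congr' ?_)
  filter_upwards [self_mem_nhdsWithin, nhdsWithin_le_nhds (eventually_lt_nhds hκ)] with x hx hxκ
  have hx' : (0 : ℝ) < x := hx
  have hre' : (s - x).re = -x := by simp [hre]
  have hne : 1 - (s - x) ≠ 1 := by
    intro h
    have := congrArg re h
    rw [sub_re, hre', one_re] at this
    linarith
  simp only [Function.comp]
  rw [H.mellin_harmonicTransform (by rw [hre']; linarith) (by rw [hre']; linarith),
    riemannZeta_eq_inv_sub_mul hne]
  have : s - x ≠ 0 := fun h => by simp [h] at hne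
  rw [show 1 - (s - x) - 1 = -(s - x) by ring]
  field_simp

end PowerPair

namespace BumpOn

variable {w : ℝ → ℝ} {a b : ℝ}

open MeasureTheory ComplexConjugate in
/-- The composite of the two transforms is an isometry up to a change of measure. -/
theorem integral_harmonicTransform_sq (hw : BumpOn w a b) {h₁ : ℝ → ℝ} {κ C : ℝ} (hκ : 0 < κ)
    (H : PowerPair (moebiusTransform w) h₁ κ b C) :
    ∫ v in Set.Ioi (0 : ℝ), harmonicTransform (moebiusTransform w) v ^ 2 / v =
      ∫ t in Set.Ioi (0 : ℝ), w t ^ 2 * t := by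
  have h0 := hw.mellin_moebiusTransform_zero hκ H
  set K := fun v => (harmonicTransform (moebiusTransform w) v : ℂ) with hK
  set M := mellin fun t => (w t : ℂ) with hM
  have hz : ∀ y : ℝ, y ≠ 0 → riemannZeta₁ (1 + y * I) ≠ 0 := by
    intro y hy h
    have hne : (1 + y * I : ℂ) ≠ 1 := by simpa using hy
    have := riemannZeta_ne_zero_of_one_le_re (s := 1 + y * I) (by simp)
    rw [riemannZeta_eq_inv_sub_mul hne, h, mul_zero] at this
    exact this rfl
  have hKM : ∀ y : ℝ, y ≠ 0 → riemannZeta₁ (1 + y * I) * mellin K (y * I) =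
      -(riemannZeta₁ (1 - y * I)) * M (1 + y * I) := by
    intro y hy
    have e1 := H.mul_mellin_harmonicTransform hκ h0 y
    have e2 := hw.zeta_mul_mellin_moebiusTransform hκ H (s := y * I) (by simp)
    have hyI : (y * I : ℂ) ≠ 0 := by simpa using hy
    apply mul_left_cancel₀ hyI
    linear_combination -(riemannZeta₁ (1 + y * I)) * e1 - riemannZeta₁ (1 - y * I) * e2
  have hconj : ∀ y : ℝ, ‖riemannZeta₁ (1 - y * I)‖ = ‖riemannZeta₁ (1 + y * I)‖ := by
    intro y
    rcases eq_or_ne y 0 with rfl | hy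
    · simp
    have h1 : (1 + y * I : ℂ) ≠ 1 := by simpa using hy
    have h2 : (1 - y * I : ℂ) ≠ 1 := by simpa using hy
    have h3 : (starRingEnd ℂ) (1 + y * I) = 1 - y * I := by
      simp [sub_eq_add_neg]
    have h4 := congrArg norm (riemannZeta_conj (1 + y * I))
    rw [h3, norm_conj, riemannZeta_eq_inv_sub_mul h1, riemannZeta_eq_inv_sub_mul h2, norm_mul,
      norm_mul, add_sub_cancel_left, show (1 - y * I - 1 : ℂ) = -(y * I) by ring, norm_inv,
      norm_inv, norm_neg] at h4
    exact mul_left_cancel₀ (inv_ne_zero (norm_ne_zero_iff.2 (by simpa using hy))) h4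
  have hnorm : ∀ y : ℝ, y ≠ 0 → ‖mellin K (y * I)‖ = ‖M (1 + y * I)‖ := by
    intro y hy
    have := congrArg norm (hKM y hy)
    rw [norm_mul, norm_mul, norm_neg, hconj] at this
    exact mul_left_cancel₀ (norm_ne_zero_iff.2 (hz y hy)) this
  have hprod : ∀ y : ℝ, y ≠ 0 → mellin K (y * I) * mellin K (-(y * I)) =
      M (1 + y * I) * M (1 - y * I) := by
    intro y hy
    have e1 := hKM y hy
    have e2 := hKM (-y) (neg_ne_zero.2 hy)
    have z1 := hz y hy
    have z2 := hz (-y) (neg_ne_zero.2 hy)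
    push_cast at e2 z2
    rw [neg_mul, ← sub_eq_add_neg, sub_neg_eq_add] at e2
    rw [neg_mul, ← sub_eq_add_neg] at z2
    apply mul_left_cancel₀ (mul_ne_zero z1 z2)
    linear_combination riemannZeta₁ (1 - y * I) * mellin K (-(y * I)) * e1
      - riemannZeta₁ (1 - y * I) * M (1 + y * I) * e2
  have hae : ∀ᵐ y : ℝ, y ≠ 0 := by
    simp [ae_iff, measure_singleton]
  have hVI : VerticalIntegrable (mellin K) ((0 : ℝ)) := by
    have h1 : Integrable fun y : ℝ => M ((1 : ℝ) + y * I) :=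
      hw.verticalIntegrable_mellin (by norm_num)
    refine h1.mono ?_ ?_
    · refine (continuous_iff_continuousAt.2 fun y => ?_).aestronglyMeasurable
      have := (H.differentiableAt_mellin_harmonicTransform hκ h0
        (s := ((0 : ℝ) : ℂ) + y * I) (by simpa using hκ) (by simp)).continuousAt
      exact ContinuousAt.comp (f := fun y : ℝ => (((0 : ℝ) : ℂ) + y * I)) this (by fun_prop)
    · filter_upwards [hae] with y hy
      simp only [ofReal_zero, zero_add, ofReal_one]
      exact (hnorm y hy).le
  have hKc : ∀ s : ℝ, s = 0 → MellinConvergent K s := fun s hs =>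
    H.mellinConvergent_harmonicTransform hκ h0 (by simpa [hs] using hκ) (by simp [hs])
  have hP := integral_mul_eq_integral_mellin_mul (σ := 0) (τ := 0) (hKc 0 rfl) hVI
    (continuous_ofReal.comp_continuousOn (H.continuousOn_harmonicTransform hκ))
    (hKc (0 - 0) (by simp))
  have hW := hw.integral_sq_mul_eq (c := 1) (by norm_num)
  rw [← ofReal_inj, hW, ← integral_complex_ofReal]
  refine Eq.trans ?_ (hP.trans ?_)
  · refine setIntegral_congr_fun measurableSet_Ioi fun v hv => ?_
    rw [ofReal_zero, zero_sub, cpow_neg_one]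
    simp only [hK]
    push_cast
    rw [div_eq_inv_mul, sq]
  · congr 1
    refine integral_congr_ae ?_
    filter_upwards [hae] with y hy
    rw [ofReal_zero, zero_add, zero_sub, hprod y hy, ofReal_one,
      show (2 : ℂ) - (1 + y * I) = 1 - y * I by ring]

end BumpOn

/-- Rearrangement of a finitely supported sum over divisor pairs. -/
theorem tsum_sum_divisorsAntidiagonal {F : ℕ → ℕ → ℝ} {N : ℕ} (h0 : ∀ m, F 0 m = 0)
    (h0' : ∀ d, F d 0 = 0) (hN : ∀ d m, N < d * m → F d m = 0) :
    ∑' q : ℕ, ∑ p ∈ q.divisorsAntidiagonal, F p.1 p.2 = ∑' d : ℕ, ∑' m : ℕ, F d m := by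
  set R := Finset.range (N + 1) with hR
  have hz : ∀ d m, d ∉ R ∨ m ∉ R → F d m = 0 := by
    intro d m h
    rcases Nat.eq_zero_or_pos d with rfl | hd
    · exact h0 m
    rcases Nat.eq_zero_or_pos m with rfl | hm
    · exact h0' d
    refine hN d m ?_
    simp only [hR, Finset.mem_range, not_lt] at h
    rcases h with h | h <;> nlinarith
  have hq : ∀ q : ℕ, ∑ p ∈ q.divisorsAntidiagonal, F p.1 p.2 =
      ∑ d ∈ R, ∑ m ∈ R, if d * m = q then F d m else 0 := by
    intro q
    rw [← Finset.sum_product', ← Finset.sum_filter]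
    refine Finset.sum_congr_of_eq_on_inter ?_ ?_ fun _ _ _ => rfl
    · rintro ⟨d, m⟩ hp hp'
      refine hz d m ?_
      simp only [Nat.mem_divisorsAntidiagonal, Finset.mem_filter, Finset.mem_product, not_and] at hp hp'
      by_contra! hc
      exact hp' hc hp.1
    · rintro ⟨d, m⟩ hp hp'
      simp only [Nat.mem_divisorsAntidiagonal, Finset.mem_filter, Finset.mem_product, not_and,
        not_not] at hp hp'
      have := hp' hp.2
      rcases Nat.mul_eq_zero.1 (hp.2.trans this) with h | h
      · rw [h, h0]
      · rw [h, h0']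
  have hq0 : ∀ q, q ∉ R → ∑ p ∈ q.divisorsAntidiagonal, F p.1 p.2 = 0 := by
    intro q hqR
    refine Finset.sum_eq_zero fun p hp => hN _ _ ?_
    rw [Nat.mem_divisorsAntidiagonal] at hp
    rw [hp.1]
    rw [hR, Finset.mem_range] at hqR
    omega
  rw [tsum_eq_sum (s := R) (fun q h => hq0 q h), Finset.sum_congr rfl fun q _ => hq q,
    Finset.sum_comm, tsum_eq_sum (s := R) fun d hd => by
      rw [tsum_congr fun m => hz d m (Or.inl hd), tsum_zero]]
  refine Finset.sum_congr rfl fun d _ => ?_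
  rw [Finset.sum_comm, tsum_eq_sum (s := R) fun m hm => hz d m (Or.inr hm)]
  refine Finset.sum_congr rfl fun m _ => ?_
  rw [Finset.sum_ite_eq]
  split_ifs with h
  · rfl
  · refine (hN d m ?_).symm
    rw [hR, Finset.mem_range] at h
    omega

theorem sum_moebius_div_eq (g : ℕ) :
    ∑ p ∈ g.divisorsAntidiagonal, (ArithmeticFunction.moebius p.1 : ℝ) / p.1 =
      (g.totient : ℝ) / g := by
  rcases Nat.eq_zero_or_pos g with rfl | hg
  · simp
  have h := (ArithmeticFunction.sum_eq_iff_sum_mul_moebius_eq (R := ℝ)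
    (f := fun n => (n.totient : ℝ)) (g := fun n => (n : ℝ))).1
    (fun n _ => by exact_mod_cast congrArg (Nat.cast : ℕ → ℝ) n.sum_totient) g hg
  have hg' : (g : ℝ) ≠ 0 := by exact_mod_cast hg.ne'
  rw [eq_div_iff hg', ← h, Finset.sum_mul]
  refine Finset.sum_congr rfl fun p hp => ?_
  rw [Nat.mem_divisorsAntidiagonal] at hp
  have : (p.1 : ℝ) ≠ 0 := by
    rintro h0
    apply hp.2
    rw [← hp.1, show p.1 = 0 by exact_mod_cast h0, zero_mul]
  have e : (g : ℝ) = p.1 * p.2 := by exact_mod_cast hp.1.symm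
  rw [e]
  field_simp

namespace BumpOn

variable {w : ℝ → ℝ} {a b : ℝ}

theorem tsum_totient_mul_eq (hw : BumpOn w a b) {r : ℝ} (hr : 0 < r) :
    ∑' g : ℕ, (g.totient : ℝ) / g * w (g / r) =
      ∑' k : ℕ, moebiusTransform (fun t => w t / t) (((k : ℝ) + 1) / r) := by
  obtain ⟨N, hN⟩ := exists_nat_gt (b * r)
  have hw0 : w 0 = 0 := hw.zero 0 fun h => absurd h.1 (not_le.2 hw.pos)
  have hF := tsum_sum_divisorsAntidiagonal (N := N)
    (F := fun d k => if k = 0 then 0 else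
      (ArithmeticFunction.moebius d : ℝ) / d * w ((d * k : ℕ) / r)) (by simp) (by simp) (by
      intro d m hdm
      split_ifs with h
      · rfl
      rw [hw.zero _ fun h => ?_, mul_zero]
      have h1 := h.2
      rw [div_le_iff₀ hr] at h1
      have : (N : ℝ) < (d * m : ℕ) := by exact_mod_cast hdm
      linarith)
  have hsupp : ∀ d k : ℕ, d ∉ Finset.range (N + 1) → (if k = 0 then 0 else
      (ArithmeticFunction.moebius d : ℝ) / d * w ((d * k : ℕ) / r)) = 0 := by
    intro d k hd
    split_ifs with h
    · rfl
    rw [hw.zero _ fun h => ?_, mul_zero]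
    have h1 := h.2
    rw [div_le_iff₀ hr] at h1
    rw [Finset.mem_range, not_lt] at hd
    have : N + 1 ≤ d * k := hd.trans (Nat.le_mul_of_pos_right _ (by omega))
    have : (N + 1 : ℝ) ≤ (d * k : ℕ) := by exact_mod_cast this
    linarith
  have hsupp' : ∀ d k : ℕ, k ∉ Finset.range (N + 1) → (if k = 0 then 0 else
      (ArithmeticFunction.moebius d : ℝ) / d * w ((d * k : ℕ) / r)) = 0 := by
    intro d k hd
    rcases Nat.eq_zero_or_pos d with rfl | hdp
    · simp
    split_ifs with h
    · rfl
    rw [hw.zero _ fun h => ?_, mul_zero]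
    have h1 := h.2
    rw [div_le_iff₀ hr] at h1
    rw [Finset.mem_range, not_lt] at hd
    have : N + 1 ≤ d * k := hd.trans (Nat.le_mul_of_pos_left _ (by omega))
    have : (N + 1 : ℝ) ≤ (d * k : ℕ) := by exact_mod_cast this
    linarith
  have hlhs : ∀ g : ℕ, (g.totient : ℝ) / g * w (g / r) =
      ∑ p ∈ g.divisorsAntidiagonal, (if p.2 = 0 then 0 else
      (ArithmeticFunction.moebius p.1 : ℝ) / p.1 * w ((p.1 * p.2 : ℕ) / r)) := by
    intro g
    rw [← sum_moebius_div_eq, Finset.sum_mul]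
    refine Finset.sum_congr rfl fun p hp => ?_
    rw [Nat.mem_divisorsAntidiagonal] at hp
    rw [hp.1, if_neg]
    rintro h
    apply hp.2
    rw [← hp.1, h, mul_zero]
  rw [tsum_congr hlhs, hF]
  have hfin : ∀ d : ℕ, ∑' k : ℕ, (if k = 0 then 0 else
      (ArithmeticFunction.moebius d : ℝ) / d * w ((d * k : ℕ) / r)) =
      ∑ k ∈ Finset.range (N + 1), (if k = 0 then 0 else
      (ArithmeticFunction.moebius d : ℝ) / d * w ((d * k : ℕ) / r)) := fun d =>
    tsum_eq_sum fun k hk => hsupp' d k hk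
  rw [tsum_congr hfin, tsum_eq_sum (s := Finset.range (N + 1)) fun d hd =>
    Finset.sum_eq_zero fun k _ => hsupp d k hd, Finset.sum_comm, Finset.sum_range_succ']
  simp only [if_true, Finset.sum_const_zero, add_zero, Nat.add_eq_zero_iff, one_ne_zero, and_false,
    if_false]
  have hk : ∀ k : ℕ, moebiusTransform (fun t => w t / t) (((k : ℝ) + 1) / r) =
      ∑ d ∈ Finset.range (N + 1), (ArithmeticFunction.moebius d : ℝ) / d * w ((d * (k + 1) : ℕ) / r) := by
    intro k
    rw [moebiusTransform, tsum_eq_sum (s := Finset.range (N + 1)), Finset.mul_sum]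
    · refine Finset.sum_congr rfl fun d _ => ?_
      rcases Nat.eq_zero_or_pos d with rfl | hdp
      · simp
      have hk0 : (0 : ℝ) < k + 1 := by positivity
      have hd0 : (0 : ℝ) < d := by exact_mod_cast hdp
      push_cast
      rw [mul_div_assoc]
      field_simp
    · intro d hd
      have := hsupp d (k + 1) hd
      rw [if_neg (by omega)] at this
      rcases Nat.eq_zero_or_pos d with rfl | hdp
      · simp
      have hd0 : (0 : ℝ) < d := by exact_mod_cast hdp
      push_cast at this
      rw [mul_div_assoc, div_mul_eq_mul_div, div_eq_zero_iff] at this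
      rcases this with h | h
      · rw [← mul_div_assoc, h, zero_div]
      · exact absurd h hd0.ne'
  rw [tsum_congr hk, tsum_eq_sum]
  intro k hk'
  refine Finset.sum_eq_zero fun d _ => ?_
  have := hsupp' d (k + 1) (by rw [Finset.mem_range] at hk' ⊢; omega)
  rwa [if_neg (by omega)] at this

end BumpOn

section

open MeasureTheory

namespace PowerPair

variable {h h₁ : ℝ → ℝ} {κ b C : ℝ}

theorem integrableOn (H : PowerPair h h₁ κ b C) (hκ : 0 ≤ κ) : IntegrableOn h (Set.Ioi 0) := by
  have := (H.mellinConvergent (s := 1) (by simp; linarith)).re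
  refine this.congr ?_
  filter_upwards [ae_restrict_mem measurableSet_Ioi] with t _
  simp

theorem abs_setIntegral_Ioc_le (H : PowerPair h h₁ κ b C) (hκ : 0 ≤ κ) {r : ℝ} (hr : 0 < r) :
    |∫ t in Set.Ioc (0 : ℝ) (1 / 2), h (t / r)| ≤ C * r ^ (-κ) := by
  have hC := H.C_nonneg
  have := norm_setIntegral_le_of_norm_le_const (μ := volume) (s := Set.Ioc (0 : ℝ) (1 / 2))
    (f := fun t => h (t / r)) (C := C * r ^ (-κ)) (by simp) (by
      intro t ht
      refine (H.bound _ (div_pos ht.1 hr)).trans ?_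
      rw [div_eq_mul_inv, Real.mul_rpow ht.1.le (by positivity), Real.inv_rpow hr.le,
        ← Real.rpow_neg hr.le]
      have h1 : t ^ κ ≤ 1 := Real.rpow_le_one ht.1.le (by linarith [ht.2]) hκ
      have h2 : 0 ≤ r ^ (-κ) := by positivity
      nlinarith [mul_nonneg hC h2, mul_le_mul_of_nonneg_left h1 (mul_nonneg hC h2)])
  refine this.trans ?_
  have h2 : 0 ≤ C * r ^ (-κ) := by positivity
  simp
  nlinarith

end PowerPair

namespace BumpOn

variable {w : ℝ → ℝ} {a b : ℝ}

/-- Weighted sums of `φ(g) / g` under the Riemann hypothesis. -/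
theorem exists_abs_tsum_totient_sub_le (hRH : RiemannHypothesis) (hw : BumpOn w a b) {κ : ℝ}
    (hκ : 0 ≤ κ) (hκ' : κ < 1 / 2) : ∃ D, 0 < D ∧ ∀ r : ℝ, 0 < r →
      |∑' g : ℕ, (g.totient : ℝ) / g * w (g / r) -
        r * ∫ t in Set.Ioi (0 : ℝ), moebiusTransform (fun t => w t / t) t| ≤ D * r ^ (-κ) := by
  have hv := hw.div_id
  have hv' := hv.add hv.mul_deriv
  obtain ⟨C₁, hC₁, H₁⟩ := hv.exists_powerPair hRH hκ hκ'
  obtain ⟨C₂, hC₂, H₂⟩ := hv'.exists_powerPair hRH hκ hκ'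
  set h₀ := moebiusTransform fun t => w t / t with hh₀
  set h₁ := moebiusTransform fun t => w t / t + t * deriv (fun t => w t / t) t with hh₁
  set h₂ := moebiusTransform fun t => (w t / t + t * deriv (fun t => w t / t) t) +
    t * deriv (fun t => w t / t + t * deriv (fun t => w t / t) t) t with hh₂
  set T := ∑' j : ℕ, ((j : ℝ) + 1 / 2) ^ (κ - 2) with hT
  have hT0 : 0 ≤ T := tsum_nonneg fun j => by positivity
  refine ⟨2 * C₂ * T + C₁, by positivity, fun r hr => ?_⟩
  have hd : ∀ t, 0 < t → HasDerivAt (fun t => h₀ (t / r)) (h₁ (t / r) / t) t := by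
    intro t ht
    have h2 : HasDerivAt (fun t : ℝ => t / r) (1 / r) t := (hasDerivAt_id t).div_const r
    refine ((H₁.hasDerivAt (t / r) (by positivity)).comp t h2).congr_deriv ?_
    field_simp
  have hd' : ∀ t, 0 < t → HasDerivAt (fun t => h₁ (t / r) / t)
      ((h₂ (t / r) - h₁ (t / r)) / t ^ 2) t := by
    intro t ht
    have h2 : HasDerivAt (fun t : ℝ => t / r) (1 / r) t := (hasDerivAt_id t).div_const r
    refine (((H₂.hasDerivAt (t / r) (by positivity)).comp t h2).div (hasDerivAt_id t)
      ht.ne').congr_deriv ?_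
    simp only [id, Function.comp]
    field_simp
  have hB : ∀ t, 0 < t → |(h₂ (t / r) - h₁ (t / r)) / t ^ 2| ≤
      (2 * C₂ * r ^ (-κ)) * t ^ (κ - 2) := by
    intro t ht
    have b1 := H₂.bound (t / r) (by positivity)
    have b2 := H₂.bound₁ (t / r) (by positivity)
    have e : (t / r) ^ κ = t ^ κ * r ^ (-κ) := by
      rw [Real.div_rpow ht.le hr.le, Real.rpow_neg hr.le, div_eq_mul_inv]
    rw [e] at b1 b2
    rw [abs_div, abs_of_pos (show 0 < t ^ 2 by positivity), Real.rpow_sub ht, Real.rpow_two,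
      ← mul_div_assoc]
    gcongr
    refine (abs_sub _ _).trans ?_
    linarith
  have hFi : IntegrableOn (fun t => h₀ (t / r)) (Set.Ioi 0) := by
    have := (integrableOn_Ioi_comp_mul_left_iff h₀ 0 (inv_pos.2 hr)).2
      (by rw [mul_zero]; exact H₁.integrableOn hκ)
    refine this.congr_fun (fun t _ => ?_) measurableSet_Ioi
    simp only [div_eq_inv_mul]
  have hFint : ∫ t in Set.Ioi (0 : ℝ), h₀ (t / r) = r * ∫ t in Set.Ioi (0 : ℝ), h₀ t := by
    have := integral_comp_mul_left_Ioi h₀ 0 (inv_pos.2 hr)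
    rw [mul_zero, inv_inv, smul_eq_mul] at this
    rw [← this]
    simp only [div_eq_inv_mul]
  have hsub : Set.Ioi (1 / 2 : ℝ) ⊆ Set.Ioi 0 := Set.Ioi_subset_Ioi (by norm_num)
  have hmain := abs_tsum_sub_integral_Ioi_half_le (by linarith) hd hd' (hFi.mono_set hsub) hB
  have hsplit : ∫ t in Set.Ioi (0 : ℝ), h₀ (t / r) = (∫ t in Set.Ioc (0 : ℝ) (1 / 2), h₀ (t / r)) +
      ∫ t in Set.Ioi (1 / 2 : ℝ), h₀ (t / r) := by
    rw [← setIntegral_union (Set.Ioc_disjoint_Ioi le_rfl) measurableSet_Ioi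
      (hFi.mono_set Set.Ioc_subset_Ioi_self) (hFi.mono_set hsub),
      Set.Ioc_union_Ioi_eq_Ioi (by norm_num)]
  have hI := H₁.abs_setIntegral_Ioc_le hκ hr
  rw [hw.tsum_totient_mul_eq hr, ← hFint, hsplit, ← sub_sub, sub_right_comm]
  refine (abs_sub _ _).trans ?_
  rw [← hT] at hmain
  calc _ ≤ _ := add_le_add hmain hI
    _ = _ := by ring

theorem integral_moebiusTransform_div (hw : BumpOn w a b) :
    ((∫ t in Set.Ioi (0 : ℝ), moebiusTransform (fun t => w t / t) t : ℝ) : ℂ) =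
      mellinW w 1 / riemannZeta 2 := by
  have h1 := hw.div_id.mellin_moebiusTransform (s := 1) (by simp)
  rw [show (1 : ℂ) + 1 = 2 by norm_num, LSeries_moebius_eq (by simp)] at h1
  have h2 : mellin (fun u => ((moebiusTransform (fun t => w t / t) u : ℝ) : ℂ)) 1 =
      ((∫ t in Set.Ioi (0 : ℝ), moebiusTransform (fun t => w t / t) t : ℝ) : ℂ) := by
    rw [mellin, ← integral_complex_ofReal]
    simp
  have h3 : mellin (fun t => ((w t / t : ℝ) : ℂ)) 2 = mellinW w 1 := by
    rw [mellin, mellinW]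
    refine setIntegral_congr_fun measurableSet_Ioi fun t ht => ?_
    have : (t : ℂ) ≠ 0 := by exact_mod_cast (ne_of_gt ht)
    rw [show (2 : ℂ) - 1 = 1 by norm_num, cpow_one, sub_self, cpow_zero, smul_eq_mul]
    push_cast
    field_simp
  rw [← h2, h1, h3, riemannZeta_eq_inv_sub_mul (by norm_num)]
  norm_num
  rw [div_eq_mul_inv, mul_comm]

end BumpOn

end

theorem sum_range_exp_eq {q : ℕ} (hq : 0 < q) (n : ℕ) :
    ∑ k ∈ Finset.range q, Complex.exp (2 * Real.pi * Complex.I * (((n * k : ℕ) : ℂ) / (q : ℂ))) =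
      if q ∣ n then (q : ℂ) else 0 := by
  have hz := Complex.isPrimitiveRoot_exp q hq.ne'
  set z := Complex.exp (2 * Real.pi * Complex.I / q) with hzd
  have h1 : ∀ k : ℕ, Complex.exp (2 * Real.pi * Complex.I * (((n * k : ℕ) : ℂ) / (q : ℂ))) =
      (z ^ n) ^ k := by
    intro k
    rw [← pow_mul, hzd, ← Complex.exp_nat_mul]
    congr 1
    ring
  rw [Finset.sum_congr rfl fun k _ => h1 k]
  split_ifs with h
  · rw [(hz.pow_eq_one_iff_dvd n).2 h]
    simp
  · have hne : z ^ n - 1 ≠ 0 := sub_ne_zero.2 fun h' => h ((hz.pow_eq_one_iff_dvd n).1 h')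
    apply mul_left_cancel₀ hne
    rw [mul_geom_sum, ← pow_mul, mul_comm n q, pow_mul, hz.pow_eq_one]
    simp

theorem sum_divisors_ramanujanSum {q : ℕ} (hq : 0 < q) (n : ℕ) :
    ∑ d ∈ q.divisors, ramanujanSum d n = if q ∣ n then (q : ℂ) else 0 := by
  rw [← sum_range_exp_eq hq n, ← Finset.sum_fiberwise_of_maps_to (s := Finset.range q)
    (t := q.divisors) (g := fun k => q / q.gcd k)
    (fun k _ => Nat.mem_divisors.2 ⟨Nat.div_dvd_of_dvd (Nat.gcd_dvd_left q k), hq.ne'⟩)]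
  refine Finset.sum_congr rfl fun d hd => ?_
  obtain ⟨c, rfl⟩ := Nat.dvd_of_mem_divisors hd
  have hd0 : 0 < d := Nat.pos_of_mul_pos_right hq
  have hc0 : 0 < c := Nat.pos_of_mul_pos_left hq
  rw [ramanujanSum]
  refine Finset.sum_nbij (fun a => a * c) ?_ ?_ ?_ ?_
  · intro a ha
    simp only [Finset.mem_filter, Finset.mem_range] at ha ⊢
    refine ⟨Nat.mul_lt_mul_of_pos_right ha.1 hc0, ?_⟩
    rw [Nat.gcd_mul_right, Nat.Coprime.gcd_eq_one ha.2.symm, one_mul, Nat.mul_div_cancel _ hc0]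
  · intro a _ a' _ h
    exact Nat.eq_of_mul_eq_mul_right hc0 h
  · intro k hk
    simp only [Finset.coe_filter, Finset.mem_range, Set.mem_ofPred_eq] at hk
    have hg : 0 < (d * c).gcd k := Nat.gcd_pos_of_pos_left _ hq
    have hgc : (d * c).gcd k = c := by
      have := Nat.div_mul_cancel (Nat.gcd_dvd_left (d * c) k)
      rw [hk.2] at this
      exact Nat.eq_of_mul_eq_mul_left hd0 this
    obtain ⟨a, ha⟩ : c ∣ k := hgc ▸ Nat.gcd_dvd_right (d * c) k
    refine ⟨a, ?_, by rw [ha, mul_comm]⟩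
    simp only [Finset.coe_filter, Finset.mem_range, Set.mem_ofPred_eq]
    constructor
    · rw [ha, mul_comm c] at hk
      exact Nat.lt_of_mul_lt_mul_right hk.1
    · rw [ha, mul_comm c a, Nat.gcd_mul_right] at hgc
      have : d.gcd a = 1 := Nat.eq_of_mul_eq_mul_right hc0 (by rw [hgc, one_mul])
      exact Nat.Coprime.symm this
  · intro a _
    have : (c : ℂ) ≠ 0 := by exact_mod_cast hc0.ne'
    have : (d : ℂ) ≠ 0 := by exact_mod_cast hd0.ne'
    congr 2
    push_cast
    field_simp

theorem ramanujanSum_eq (q n : ℕ) : ramanujanSum q n =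
    ∑ p ∈ q.divisorsAntidiagonal,
      (((if p.1 ∣ n then (p.1 : ℝ) else 0) * (ArithmeticFunction.moebius p.2 : ℝ) : ℝ) : ℂ) := by
  rcases Nat.eq_zero_or_pos q with rfl | hq
  · simp [ramanujanSum]
  rw [← (ArithmeticFunction.sum_eq_iff_sum_mul_moebius_eq (R := ℂ)
    (f := fun q => ramanujanSum q n) (g := fun q => if q ∣ n then (q : ℂ) else 0)).1
    (fun q hq => sum_divisors_ramanujanSum hq n) q hq]
  refine Finset.sum_equiv (Equiv.prodComm ℕ ℕ) (fun p => by
    simp [Nat.mem_divisorsAntidiagonal]) fun p _ => ?_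
  by_cases h : p.2 ∣ n <;> simp [h, mul_comm]

namespace BumpOn

variable {w : ℝ → ℝ} {a b : ℝ}

theorem apply_zero (hw : BumpOn w a b) : w 0 = 0 := hw.zero 0 fun h => absurd h.1 (not_le.2 hw.pos)

theorem tsum_ramanujanSum_mul_eq (hw : BumpOn w a b) {x : ℝ} (hx : 0 < x) {n : ℕ} (hn : 0 < n) :
    ∑' q : ℕ+, ramanujanSum q n * (w ((q : ℕ) / x) : ℂ) =
      ((x * ∑ e ∈ n.divisors, moebiusTransform w (n / (x * e)) : ℝ) : ℂ) := by
  obtain ⟨N, hN⟩ := exists_nat_gt (b * x)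
  set F : ℕ → ℕ → ℝ := fun d m => (if d ∣ n then (d : ℝ) else 0) *
    (ArithmeticFunction.moebius m : ℝ) * w ((d * m : ℕ) / x) with hF
  have h1 : ∑' q : ℕ+, ramanujanSum q n * (w ((q : ℕ) / x) : ℂ) =
      ∑' q : ℕ, ramanujanSum q n * (w (q / x) : ℂ) := by
    refine PNat.coe_injective.tsum_eq (f := fun q : ℕ => ramanujanSum q n * (w (q / x) : ℂ)) ?_
    intro q hq
    rw [Function.mem_support] at hq
    rcases Nat.eq_zero_or_pos q with rfl | h
    · simp [hw.apply_zero] at hq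
    · exact ⟨⟨q, h⟩, rfl⟩
  have h2 : ∀ q : ℕ, ramanujanSum q n * (w (q / x) : ℂ) =
      ((∑ p ∈ q.divisorsAntidiagonal, F p.1 p.2 : ℝ) : ℂ) := by
    intro q
    rw [ramanujanSum_eq, ofReal_sum, Finset.sum_mul]
    refine Finset.sum_congr rfl fun p hp => ?_
    simp only [hF]
    rw [← (Nat.mem_divisorsAntidiagonal.1 hp).1, ofReal_mul, ofReal_mul]
    push_cast
    rfl
  have hNF : ∀ d m, N < d * m → F d m = 0 := by
    intro d m hdm
    have h1 : (N : ℝ) < (d * m : ℕ) := by exact_mod_cast hdm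
    rw [hF]
    refine mul_eq_zero_of_right _ (hw.zero _ fun h => ?_)
    have := h.2
    rw [div_le_iff₀ hx] at this
    linarith
  rw [h1, tsum_congr h2, ← ofReal_tsum, tsum_sum_divisorsAntidiagonal (fun m => by simp [hF])
    (fun d => by simp [hF]) hNF]
  have h3 : ∀ d : ℕ, ∑' m : ℕ, F d m = if d ∣ n then x * moebiusTransform w (d / x) else 0 := by
    intro d
    simp only [hF]
    split_ifs with h
    · rw [moebiusTransform, ← mul_assoc, mul_div_cancel₀ _ hx.ne', ← tsum_mul_left]
      refine tsum_congr fun m => ?_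
      rw [mul_assoc]
      congr 3
      push_cast
      ring
    · simp
  rw [tsum_congr h3, tsum_eq_sum (s := n.divisors) fun d hd => if_neg fun h =>
    hd (Nat.mem_divisors.2 ⟨h, hn.ne'⟩)]
  congr 1
  rw [Finset.mul_sum, ← Nat.sum_div_divisors]
  refine Finset.sum_congr rfl fun e he => ?_
  have he' := Nat.dvd_of_mem_divisors he
  have he0 : (e : ℝ) ≠ 0 := by exact_mod_cast (Nat.pos_of_mem_divisors he).ne'
  rw [if_pos (Nat.div_dvd_of_dvd he'), Nat.cast_div he' he0, div_div, mul_comm (e : ℝ)]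

end BumpOn

namespace BumpOn

variable {w : ℝ → ℝ} {a b : ℝ}

theorem moebiusTransform_apply_zero (w : ℝ → ℝ) : moebiusTransform w 0 = 0 := by
  simp [moebiusTransform]

theorem weight_eq_zero_of_lt (hw : BumpOn w a b) {y t : ℝ} (hy : 0 < y) (ht : b * y < t) :
    w (t / y) = 0 :=
  hw.zero _ fun h => by
    have := h.2
    rw [div_le_iff₀ hy] at this
    linarith

/-- The second moment as a sum over pairs of divisors. -/
theorem tsum_ramanujanSum_sq_mul_eq (hw : BumpOn w a b) {x y : ℝ} (hx : 0 < x) (hy : 0 < y)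
    {T : ℕ × ℕ → ℝ} (hT : ∀ e, T e = ∑' j : ℕ,
      moebiusTransform w ((e.1.lcm e.2 : ℝ) * ((j : ℝ) + 1) / (x * e.1)) *
      moebiusTransform w ((e.1.lcm e.2 : ℝ) * ((j : ℝ) + 1) / (x * e.2)) *
      w ((e.1.lcm e.2 : ℝ) * ((j : ℝ) + 1) / y)) :
    Summable T ∧
    ∑' n : ℕ+, (∑' q : ℕ+, ramanujanSum q n * (w ((q : ℕ) / x) : ℂ)) ^ 2 *
      (w ((n : ℕ) / y) : ℂ) = ((x ^ 2 * ∑' e, T e : ℝ) : ℂ) := by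
  obtain ⟨N, hN⟩ := exists_nat_gt (b * y)
  set R := Finset.range (N + 1) with hR
  set G : ℕ × ℕ → ℝ → ℝ := fun e t => moebiusTransform w (t / (x * e.1)) *
    moebiusTransform w (t / (x * e.2)) * w (t / y) with hG
  have hG0 : ∀ e, G e 0 = 0 := fun e => by simp [hG, moebiusTransform_apply_zero]
  have hGN : ∀ e, ∀ n : ℕ, n ∉ R → G e n = 0 := by
    intro e n hn
    rw [hR, Finset.mem_range, not_lt] at hn
    have : (N + 1 : ℝ) ≤ n := by exact_mod_cast hn
    exact mul_eq_zero_of_right _ (hw.weight_eq_zero_of_lt hy (by linarith))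
  have hT' : ∀ e, T e = ∑' j : ℕ, G e (e.1.lcm e.2 * (j + 1) : ℕ) := by
    intro e
    rw [hT]
    push_cast
    rfl
  have hT0 : ∀ e, e ∉ R ×ˢ R → T e = 0 := by
    intro e he
    rw [hT', ← tsum_zero]
    refine tsum_congr fun j => ?_
    rcases Nat.eq_zero_or_pos e.1 with h1 | h1
    · simp [hG, h1, moebiusTransform_apply_zero]
    rcases Nat.eq_zero_or_pos e.2 with h2 | h2
    · simp [hG, h2, moebiusTransform_apply_zero]
    refine hGN e _ fun hmem => he ?_
    have hl : 0 < e.1.lcm e.2 := Nat.lcm_pos h1 h2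
    have i1 := Nat.le_of_dvd hl (Nat.dvd_lcm_left e.1 e.2)
    have i2 := Nat.le_of_dvd hl (Nat.dvd_lcm_right e.1 e.2)
    have i3 := Nat.le_mul_of_pos_right (e.1.lcm e.2) (Nat.succ_pos j)
    rw [hR, Finset.mem_range] at hmem
    simp only [Finset.mem_product, hR, Finset.mem_range]
    rw [Nat.succ_eq_add_one] at i3
    omega
  have hTs : ∀ e ∈ R ×ˢ R, T e = ∑ n ∈ R, if e.1.lcm e.2 ∣ n then G e n else 0 := by
    intro e _
    rw [hT']
    rcases Nat.eq_zero_or_pos e.1 with h1 | h1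
    · simp [hG, h1, moebiusTransform_apply_zero]
    rcases Nat.eq_zero_or_pos e.2 with h2 | h2
    · simp [hG, h2, moebiusTransform_apply_zero]
    have hl : 0 < e.1.lcm e.2 := Nat.lcm_pos h1 h2
    rw [← tsum_eq_sum (L := .unconditional ℕ) (s := R) (f := fun n : ℕ => if e.1.lcm e.2 ∣ n then G e n else 0)
      fun n hn => by simp [hGN e n hn]]
    have hinj : Function.Injective fun j : ℕ => e.1.lcm e.2 * (j + 1) := fun i j hij => by
      simpa using Nat.eq_of_mul_eq_mul_left hl hij
    rw [← hinj.tsum_eq (f := fun n : ℕ => if e.1.lcm e.2 ∣ n then G e n else 0)]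
    · simp
    · intro n hn
      rw [Function.mem_support] at hn
      by_cases hd : e.1.lcm e.2 ∣ n
      · obtain ⟨k, rfl⟩ := hd
        rcases Nat.eq_zero_or_pos k with rfl | hk
        · simp [hG0] at hn
        · exact ⟨k - 1, by simp only; rw [Nat.sub_add_cancel hk]⟩
      · simp [hd] at hn
  refine ⟨summable_of_ne_finset_zero (s := R ×ˢ R) hT0, ?_⟩
  have h1 : ∀ n : ℕ+, (∑' q : ℕ+, ramanujanSum q n * (w ((q : ℕ) / x) : ℂ)) ^ 2 *
      (w ((n : ℕ) / y) : ℂ) =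
      ((x ^ 2 * ∑ e ∈ R ×ˢ R, (if e.1.lcm e.2 ∣ n then G e n else 0) : ℝ) : ℂ) := by
    intro n
    rw [hw.tsum_ramanujanSum_mul_eq hx n.pos, ← ofReal_pow, ← ofReal_mul]
    congr 1
    by_cases hn : (n : ℕ) ∈ R
    · have hsub : (n : ℕ).divisors = R.filter (· ∣ (n : ℕ)) := by
        ext d
        simp only [Nat.mem_divisors, Finset.mem_filter, hR, Finset.mem_range] at hn ⊢
        constructor
        · rintro ⟨hd, h0⟩
          have := Nat.le_of_dvd n.pos hd
          exact ⟨by omega, hd⟩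
        · rintro ⟨_, hd⟩
          exact ⟨hd, n.pos.ne'⟩
      rw [mul_pow, mul_assoc, hsub, Finset.sum_filter, sq (∑ _ ∈ _, _), Finset.sum_mul_sum,
        Finset.sum_product, Finset.sum_mul]
      congr 1
      refine Finset.sum_congr rfl fun d _ => ?_
      rw [Finset.sum_mul]
      refine Finset.sum_congr rfl fun d' _ => ?_
      simp only [Nat.lcm_dvd_iff, hG]
      by_cases h1 : d ∣ (n : ℕ) <;> by_cases h2 : d' ∣ (n : ℕ) <;> simp [h1, h2]
    · have h0 : w ((n : ℕ) / y) = 0 := by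
        rw [hR, Finset.mem_range, not_lt] at hn
        have : (N + 1 : ℝ) ≤ (n : ℕ) := by exact_mod_cast hn
        exact hw.weight_eq_zero_of_lt hy (by linarith)
      rw [h0, mul_zero, Finset.sum_eq_zero fun e _ => by rw [hGN e n hn, ite_self], mul_zero]
  rw [tsum_congr h1, ← ofReal_tsum, tsum_mul_left]
  congr 2
  rw [tsum_eq_sum hT0, Finset.sum_congr rfl hTs, Finset.sum_comm, ← tsum_eq_sum (L := .unconditional ℕ) (s := R)
    (f := fun n : ℕ => ∑ e ∈ R ×ˢ R, if e.1.lcm e.2 ∣ n then G e n else 0)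
    fun n hn => Finset.sum_eq_zero fun e _ => by rw [hGN e n hn, ite_self]]
  refine PNat.coe_injective.tsum_eq
    (f := fun n : ℕ => ∑ e ∈ R ×ˢ R, if e.1.lcm e.2 ∣ n then G e n else 0) fun n hn => ?_
  rw [Function.mem_support] at hn
  rcases Nat.eq_zero_or_pos n with rfl | h
  · simp [hG0] at hn
  · exact ⟨⟨n, h⟩, rfl⟩

end BumpOn

open MeasureTheory in
theorem integrableOn_and_integral_abs_le {φ : ℝ → ℝ} {α ω B : ℝ} (hα : 0 < α) (hαω : α ≤ ω)
    (hc : ContinuousOn φ (Set.Ioi 0)) (hz : ∀ t, 0 < t → t ∉ Set.Icc α ω → φ t = 0)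
    (hB : ∀ t ∈ Set.Icc α ω, |φ t| ≤ B) :
    IntegrableOn φ (Set.Ioi 0) ∧ ∫ t in Set.Ioi (0 : ℝ), |φ t| ≤ B * ω := by
  have hsub : Set.Icc α ω ⊆ Set.Ioi 0 := fun t ht => hα.trans_le ht.1
  have hB0 : 0 ≤ B := (abs_nonneg _).trans (hB α ⟨le_rfl, hαω⟩)
  constructor
  · exact ((hc.mono hsub).integrableOn_Icc).of_forall_sdiff_eq_zero measurableSet_Ioi
      fun t ht => hz t ht.1 ht.2
  · rw [setIntegral_eq_of_subset_of_forall_sdiff_eq_zero measurableSet_Ioi hsub fun t ht => by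
      rw [hz t ht.1 ht.2, abs_zero]]
    have := norm_setIntegral_le_of_norm_le_const (μ := volume) (s := Set.Icc α ω)
      (f := fun t => |φ t|) (C := B) (by simp) (fun t ht => by
        rw [Real.norm_eq_abs, abs_abs]; exact hB t ht)
    refine (le_abs_self _).trans (this.trans ?_)
    rw [Real.volume_real_Icc_of_le hαω]
    gcongr
    linarith

namespace PowerPair

variable {h h₁ : ℝ → ℝ} {κ b C : ℝ} {w : ℝ → ℝ} {a : ℝ}

theorem abs_le_of_le {g : ℝ → ℝ} (hg : ∀ u, 0 < u → |g u| ≤ C * u ^ κ) (hC : 0 ≤ C) (hκ : 0 ≤ κ)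
    {q t ω : ℝ} (hq : 0 < q) (ht : 0 < t) (htω : t ≤ ω) : |g (t / q)| ≤ C * (ω / q) ^ κ := by
  refine (hg _ (by positivity)).trans ?_
  gcongr

open MeasureTheory in
theorem exists_pair_bounds (H : PowerPair h h₁ κ b C) (hκ : 0 ≤ κ) (hw : BumpOn w a b) :
    ∃ D, 0 < D ∧ ∀ q₁ q₂ y : ℝ, 0 < q₁ → 0 < q₂ → 0 < y →
      IntegrableOn (fun t => h (t / q₁) * h (t / q₂) * w (t / y)) (Set.Ioi 0) ∧
      (∫ t in Set.Ioi (0 : ℝ), |h (t / q₁) * h (t / q₂) * w (t / y)| ≤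
        D * y * (y / q₁ * (y / q₂)) ^ κ) ∧
      ∃ G' : ℝ → ℝ, (∀ t, 0 < t →
        HasDerivAt (fun t => h (t / q₁) * h (t / q₂) * w (t / y)) (G' t) t) ∧
        IntegrableOn G' (Set.Ioi 0) ∧
        ∫ t in Set.Ioi (0 : ℝ), |G' t| ≤ D * (y / q₁ * (y / q₂)) ^ κ := by
  obtain ⟨B₁, hB₁, hwB⟩ := hw.bounded
  obtain ⟨B₂, hB₂, hwB'⟩ := hw.mul_deriv.bounded
  have hC := H.C_nonneg
  have ha := hw.pos
  have hb := H.b_pos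
  set A := (b ^ κ) ^ 2 * C ^ 2 with hA
  have hA0 : 0 ≤ A := by positivity
  refine ⟨A * B₁ * b + (A * (2 * B₁ + B₂) / a) * b + 1, by positivity, ?_⟩
  intro q₁ q₂ y hq₁ hq₂ hy
  have hay : 0 < a * y := by positivity
  have hab : a * y ≤ b * y := by have := hw.le; gcongr
  have hP : C * (b * y / q₁) ^ κ * (C * (b * y / q₂) ^ κ) = A * (y / q₁ * (y / q₂)) ^ κ := by
    rw [hA, mul_div_assoc, mul_div_assoc, Real.mul_rpow hb.le (by positivity),
      Real.mul_rpow hb.le (by positivity), Real.mul_rpow (by positivity) (by positivity)]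
    ring
  set P := (y / q₁ * (y / q₂)) ^ κ with hPd
  have hP0 : 0 ≤ P := by positivity
  have hnot : ∀ t, t ∉ Set.Icc (a * y) (b * y) → t / y ∉ Set.Icc a b := by
    intro t ht h'
    exact ht ⟨(le_div_iff₀ hy).1 h'.1, (div_le_iff₀ hy).1 h'.2⟩
  have hcq : ∀ {g : ℝ → ℝ} {q : ℝ}, 0 < q → ContinuousOn g (Set.Ioi 0) →
      ContinuousOn (fun t => g (t / q)) (Set.Ioi 0) := by
    intro g q hq hg
    refine hg.comp (by fun_prop) fun t ht => ?_
    exact div_pos ht hq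
  have hcw : ∀ {v : ℝ → ℝ}, Continuous v → ContinuousOn (fun t => v (t / y)) (Set.Ioi 0) := by
    intro v hv
    exact (hv.comp (by fun_prop : Continuous fun t : ℝ => t / y)).continuousOn
  have hprod : ∀ {g₁ g₂ : ℝ → ℝ}, (∀ u, 0 < u → |g₁ u| ≤ C * u ^ κ) →
      (∀ u, 0 < u → |g₂ u| ≤ C * u ^ κ) → ∀ t ∈ Set.Icc (a * y) (b * y),
      |g₁ (t / q₁) * g₂ (t / q₂)| ≤ A * P := by
    intro g₁ g₂ h₁' h₂' t ht
    have ht0 : 0 < t := hay.trans_le ht.1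
    rw [abs_mul, ← hP]
    exact mul_le_mul (abs_le_of_le h₁' hC hκ hq₁ ht0 ht.2) (abs_le_of_le h₂' hC hκ hq₂ ht0 ht.2)
      (abs_nonneg _) (by positivity)
  have hG := integrableOn_and_integral_abs_le (φ := fun t => h (t / q₁) * h (t / q₂) * w (t / y))
    (B := A * P * B₁) hay hab
    (((hcq hq₁ H.continuousOn).mul (hcq hq₂ H.continuousOn)).mul (hcw hw.continuous))
    (fun t _ ht => by rw [hw.zero _ (hnot t ht), mul_zero]) (fun t ht => by
      rw [abs_mul]
      exact mul_le_mul (hprod H.bound H.bound t ht) (hwB _) (abs_nonneg _) (by positivity))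
  refine ⟨hG.1, hG.2.trans ?_, fun t => ((h₁ (t / q₁) * h (t / q₂) + h (t / q₁) * h₁ (t / q₂)) *
    w (t / y) + h (t / q₁) * h (t / q₂) * (t / y * deriv w (t / y))) / t, ?_, ?_⟩
  · calc A * P * B₁ * (b * y) = (A * B₁ * b) * y * P := by ring
      _ ≤ _ := by
        gcongr
        have : 0 ≤ A * (2 * B₁ + B₂) / a * b := by positivity
        linarith
  · intro t ht
    have hdq : ∀ q : ℝ, HasDerivAt (fun t : ℝ => t / q) (1 / q) t := fun q =>
      (hasDerivAt_id t).div_const q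
    have d1 := (H.hasDerivAt (t / q₁) (by positivity)).comp t (hdq q₁)
    have d2 := (H.hasDerivAt (t / q₂) (by positivity)).comp t (hdq q₂)
    have d3 := (hw.hasDerivAt (t / y)).comp t (hdq y)
    refine ((d1.mul d2).mul d3).congr_deriv ?_
    simp only [Function.comp, Pi.mul_apply]
    field_simp
  · have := integrableOn_and_integral_abs_le (φ := fun t =>
      ((h₁ (t / q₁) * h (t / q₂) + h (t / q₁) * h₁ (t / q₂)) *
        w (t / y) + h (t / q₁) * h (t / q₂) * (t / y * deriv w (t / y))) / t)
      (B := A * P * (2 * B₁ + B₂) / (a * y)) hay hab (by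
        refine ContinuousOn.div ?_ continuousOn_id fun t ht => (ne_of_gt ht)
        refine ContinuousOn.add (ContinuousOn.mul (ContinuousOn.add ?_ ?_) (hcw hw.continuous))
          (ContinuousOn.mul ?_ (hcw hw.mul_deriv.continuous))
        · exact (hcq hq₁ H.cont₁).mul (hcq hq₂ H.continuousOn)
        · exact (hcq hq₁ H.continuousOn).mul (hcq hq₂ H.cont₁)
        · exact (hcq hq₁ H.continuousOn).mul (hcq hq₂ H.continuousOn))
      (fun t _ ht => by rw [hw.zero _ (hnot t ht), hw.deriv_zero (hnot t ht)]; simp)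
      (fun t ht => by
        have ht0 : 0 < t := hay.trans_le ht.1
        rw [abs_div, abs_of_pos ht0]
        have p1 := hprod H.bound₁ H.bound t ht
        have p2 := hprod H.bound H.bound₁ t ht
        have p3 := hprod H.bound H.bound t ht
        refine div_le_div₀ (by positivity) ?_ hay ht.1
        calc _ ≤ |(h₁ (t / q₁) * h (t / q₂) + h (t / q₁) * h₁ (t / q₂)) * w (t / y)| +
            |h (t / q₁) * h (t / q₂) * (t / y * deriv w (t / y))| := abs_add_le _ _
          _ ≤ (A * P + A * P) * B₁ + A * P * B₂ := by
            rw [abs_mul, abs_mul (h (t / q₁) * h (t / q₂))]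
            gcongr
            · exact (abs_add_le _ _).trans (add_le_add p1 p2)
            · exact hwB _
            · exact hwB' _
          _ = _ := by ring)
    refine ⟨this.1, this.2.trans ?_⟩
    calc A * P * (2 * B₁ + B₂) / (a * y) * (b * y) = (A * (2 * B₁ + B₂) / a * b) * P := by
          field_simp
      _ ≤ _ := by
        gcongr
        have : 0 ≤ A * B₁ * b := by positivity
        linarith

theorem pair_eq_zero (H : PowerPair h h₁ κ b C) (hw : BumpOn w a b) {q₁ q₂ y t : ℝ} (hq₁ : 0 < q₁)
    (hq₂ : 0 < q₂) (hy : 0 < y) (hq : q₁ < a * y / b ∨ q₂ < a * y / b) :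
    h (t / q₁) * h (t / q₂) * w (t / y) = 0 := by
  have hb := H.b_pos
  by_cases ht : t / y ∈ Set.Icc a b
  · have h1 := ht.1
    rw [le_div_iff₀ hy] at h1
    rw [lt_div_iff₀ hb, lt_div_iff₀ hb] at hq
    rcases hq with hq | hq
    · rw [H.zero (t / q₁) (by rw [lt_div_iff₀ hq₁]; linarith)]
      ring
    · rw [H.zero (t / q₂) (by rw [lt_div_iff₀ hq₂]; linarith)]
      ring
  · rw [hw.zero _ ht, mul_zero]

open MeasureTheory in
theorem exists_pair_error (H : PowerPair h h₁ κ b C) (hκ : 0 ≤ κ) (hw : BumpOn w a b) {β : ℝ}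
    (hβ : 0 ≤ β) (hβ' : β ≤ 1) :
    ∃ D, 0 < D ∧ ∀ q₁ q₂ y l : ℝ, 0 < q₁ → 0 < q₂ → 0 < y → 0 < l →
      |∑' j : ℕ, h (l * ((j : ℝ) + 1) / q₁) * h (l * ((j : ℝ) + 1) / q₂) *
          w (l * ((j : ℝ) + 1) / y) -
        l⁻¹ * ∫ t in Set.Ioi (0 : ℝ), h (t / q₁) * h (t / q₂) * w (t / y)| ≤
      D * (y / q₁ * (y / q₂)) ^ κ * (y / l) ^ β := by
  obtain ⟨D, hD, hbd⟩ := H.exists_pair_bounds hκ hw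
  have hb := H.b_pos
  refine ⟨D * b ^ β + D * b ^ β / b, by positivity, fun q₁ q₂ y l hq₁ hq₂ hy hl => ?_⟩
  obtain ⟨hi, hia, G', hd, hi', hia'⟩ := hbd q₁ q₂ y hq₁ hq₂ hy
  set P := (y / q₁ * (y / q₂)) ^ κ with hPd
  have hP0 : 0 ≤ P := by positivity
  set G : ℝ → ℝ := fun t => h (t / q₁) * h (t / q₂) * w (t / y) with hG
  have hbl : b ^ β * (y / l) ^ β = (b * y / l) ^ β := by
    rw [← Real.mul_rpow hb.le (by positivity), mul_div_assoc]
  have hM : |l⁻¹ * ∫ t in Set.Ioi (0 : ℝ), G t| ≤ D * P * (y / l) := by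
    rw [abs_mul, abs_of_pos (inv_pos.2 hl)]
    calc _ ≤ l⁻¹ * (D * y * P) := by
          gcongr
          exact (abs_integral_le_integral_abs).trans hia
      _ = _ := by ring
  have hgoal : ∑' j : ℕ, h (l * ((j : ℝ) + 1) / q₁) * h (l * ((j : ℝ) + 1) / q₂) *
          w (l * ((j : ℝ) + 1) / y) = ∑' j : ℕ, G (l * ((j : ℝ) + 1)) := rfl
  rw [hgoal]
  have hrhs : (D * b ^ β + D * b ^ β / b) * P * (y / l) ^ β =
      D * P * (b * y / l) ^ β + D * P * (b * y / l) ^ β / b := by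
    rw [← hbl]; ring
  rw [hrhs]
  rcases le_or_gt l (b * y) with hly | hly
  · have h1 : 1 ≤ (b * y / l) ^ β := Real.one_le_rpow ((one_le_div hl).2 hly) hβ
    have hF : IntegrableOn (fun t => G (l * t)) (Set.Ioi 0) :=
      (integrableOn_Ioi_comp_mul_left_iff G 0 hl).2 (by rwa [mul_zero])
    have hF' : IntegrableOn (fun t => G' (l * t) * l) (Set.Ioi 0) :=
      ((integrableOn_Ioi_comp_mul_left_iff G' 0 hl).2 (by rwa [mul_zero])).mul_const l
    have hdF : ∀ t, 0 < t → HasDerivAt (fun t => G (l * t)) (G' (l * t) * l) t := by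
      intro t ht
      have h2 : HasDerivAt (fun t : ℝ => l * t) l t := by
        simpa using (hasDerivAt_id t).const_mul l
      exact (hd (l * t) (by positivity)).comp t h2
    have e1 := abs_tsum_sub_integral_le hdF hF hF'
    have e2 := integral_comp_mul_left_Ioi G 0 hl
    have e3 := integral_comp_mul_left_Ioi (fun t => |G' t|) 0 hl
    simp only [mul_zero, smul_eq_mul] at e2 e3
    rw [e2] at e1
    have e4 : ∫ t in Set.Ioi (0 : ℝ), |G' (l * t) * l| = ∫ t in Set.Ioi (0 : ℝ), |G' t| := by
      simp only [abs_mul, abs_of_pos hl]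
      rw [integral_mul_const, e3]
      field_simp
    rw [e4] at e1
    refine e1.trans (hia'.trans ?_)
    have : 0 ≤ D * P * (b * y / l) ^ β / b := by positivity
    have : D * P * 1 ≤ D * P * (b * y / l) ^ β := by gcongr
    linarith
  · have hz : ∀ j : ℕ, G (l * ((j : ℝ) + 1)) = 0 := by
      intro j
      refine mul_eq_zero_of_right _ (hw.weight_eq_zero_of_lt hy ?_)
      have : (0 : ℝ) ≤ j := Nat.cast_nonneg j
      nlinarith
    rw [tsum_congr hz, tsum_zero, zero_sub, abs_neg]
    refine hM.trans ?_
    have hz0 : 0 < b * y / l := by positivity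
    have h1 : b * y / l ≤ (b * y / l) ^ β := by
      conv_lhs => rw [← Real.rpow_one (b * y / l)]
      exact Real.rpow_le_rpow_of_exponent_ge hz0 ((div_le_one hl).2 hly.le) hβ'
    have : D * P * (b * y / l) / b ≤ D * P * (b * y / l) ^ β / b := by gcongr
    have e : D * P * (b * y / l) / b = D * P * (y / l) := by field_simp
    have : 0 ≤ D * P * (b * y / l) ^ β := by positivity
    linarith

end PowerPair

theorem hasSum_gcd_divisors {c : ℕ → ℝ} {F : ℕ × ℕ → ℝ} (h1 : ∀ e, F (0, e) = 0)
    (hs : Summable fun p : ℕ × ℕ × ℕ =>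
      c (p.1 + 1) * F ((p.1 + 1) * p.2.1, (p.1 + 1) * p.2.2)) :
    HasSum (fun e : ℕ × ℕ => (∑ d ∈ (e.1.gcd e.2).divisors, c d) * F e)
      (∑' p : ℕ × ℕ × ℕ, c (p.1 + 1) * F ((p.1 + 1) * p.2.1, (p.1 + 1) * p.2.2)) := by
  set τ : ℕ × ℕ × ℕ → ℝ := fun p =>
    if p.1 + 1 ∣ p.2.1 ∧ p.1 + 1 ∣ p.2.2 then c (p.1 + 1) * F p.2 else 0 with hτ
  set φ : ℕ × ℕ × ℕ → ℕ × ℕ × ℕ := fun p => (p.1, (p.1 + 1) * p.2.1, (p.1 + 1) * p.2.2) with hφ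
  have hinj : Function.Injective φ := by
    rintro ⟨d, a₁, a₂⟩ ⟨d', a₁', a₂'⟩ h
    simp only [hφ, Prod.mk.injEq] at h
    obtain ⟨rfl, e1, e2⟩ := h
    rw [Nat.eq_of_mul_eq_mul_left (Nat.succ_pos d) e1, Nat.eq_of_mul_eq_mul_left (Nat.succ_pos d) e2]
  have hcomp : τ ∘ φ = fun p : ℕ × ℕ × ℕ =>
      c (p.1 + 1) * F ((p.1 + 1) * p.2.1, (p.1 + 1) * p.2.2) := by
    ext p
    simp [hτ, hφ]
  have hτs : HasSum τ (∑' p : ℕ × ℕ × ℕ, c (p.1 + 1) * F ((p.1 + 1) * p.2.1, (p.1 + 1) * p.2.2)) := by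
    rw [← hinj.hasSum_iff, hcomp]
    · exact hs.hasSum
    · rintro ⟨d, e₁, e₂⟩ hp
      refine if_neg fun h => hp ?_
      obtain ⟨⟨a₁, ha₁⟩, ⟨a₂, ha₂⟩⟩ := h
      exact ⟨(d, a₁, a₂), by simp only [hφ, Prod.mk.injEq]; exact ⟨trivial, ha₁.symm, ha₂.symm⟩⟩
  have hsw := (Equiv.prodComm (ℕ × ℕ) ℕ).hasSum_iff.2 hτs
  refine hsw.prod_fiberwise fun e => ?_
  rcases Nat.eq_zero_or_pos e.1 with h | h
  · have : F e = 0 := by rw [← h1 e.2, ← h]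
    simp [hτ, this]
  have hg : 0 < e.1.gcd e.2 := Nat.gcd_pos_of_pos_left _ h
  have hsum : (∑ d ∈ (e.1.gcd e.2).divisors, c d) * F e =
      ∑ d ∈ Finset.range (e.1.gcd e.2), (τ ∘ Equiv.prodComm (ℕ × ℕ) ℕ) (e, d) := by
    rw [Finset.sum_mul, Nat.divisors, Finset.sum_filter, Finset.sum_Ico_eq_sum_range,
      Nat.add_sub_cancel]
    refine Finset.sum_congr rfl fun d _ => ?_
    simp [hτ, Nat.dvd_gcd_iff, add_comm 1 d]
  rw [hsum]
  refine hasSum_sum_of_ne_finset_zero fun d hd => if_neg fun hdv => hd ?_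
  have := Nat.le_of_dvd hg (Nat.dvd_gcd hdv.1 hdv.2)
  exact Finset.mem_range.2 this

open MeasureTheory in
theorem tsum_tail_le {η z : ℝ} (hη : 0 < η) (hz : 0 < z) :
    Summable (fun a : ℕ => if z ≤ a then (a : ℝ) ^ (-(1 + η)) else 0) ∧
      ∑' a : ℕ, (if z ≤ a then (a : ℝ) ^ (-(1 + η)) else 0) ≤ 2 ^ (1 + η) / η * z ^ (-η) := by
  set f : ℝ → ℝ := (Set.Ioi z).indicator fun t => t ^ (-(1 + η)) with hf
  have hint : IntegrableOn (fun t : ℝ => t ^ (-(1 + η))) (Set.Ioi z) :=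
    integrableOn_Ioi_rpow_of_lt (by linarith) hz
  have hfi : IntegrableOn f (Set.Ioi 0) :=
    ((integrable_indicator_iff measurableSet_Ioi).2 hint).integrableOn
  have hfI : ∫ t in Set.Ioi (0 : ℝ), f t = z ^ (-η) / η := by
    rw [hf, setIntegral_indicator measurableSet_Ioi, Set.Ioi_inter_Ioi, max_eq_right hz.le,
      integral_Ioi_rpow_of_lt (by linarith) hz]
    rw [show -(1 + η) + 1 = -η by ring]
    field_simp
  have hf0 : ∀ t, 0 ≤ f t := fun t =>
    Set.indicator_nonneg (fun t ht => Real.rpow_nonneg (hz.le.trans (le_of_lt ht)) _) t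
  have hs := hasSum_integral_Ioc_nat hfi
  rw [hfI] at hs
  have hs' := hs.mul_left ((2 : ℝ) ^ (1 + η))
  have hle : ∀ a : ℕ, (if z ≤ a then (a : ℝ) ^ (-(1 + η)) else 0) ≤
      2 ^ (1 + η) * ∫ t in Set.Ioc (0 + (a : ℝ)) (0 + a + 1), f t := by
    intro a
    split_ifs with h
    · have ha : (0 : ℝ) < a := hz.trans_le h
      have ha1 : (1 : ℝ) ≤ a := by exact_mod_cast (Nat.cast_pos.1 ha : 0 < a)
      have hsub : Set.Ioc (0 + (a : ℝ)) (0 + a + 1) ⊆ Set.Ioi 0 := fun t ht => by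
        have := ht.1
        rw [zero_add] at this
        exact ha.trans this
      have hlow : ∫ _ in Set.Ioc (0 + (a : ℝ)) (0 + a + 1), (2 * (a : ℝ)) ^ (-(1 + η)) ≤
          ∫ t in Set.Ioc (0 + (a : ℝ)) (0 + a + 1), f t := by
        refine setIntegral_mono_on (by simp) (hfi.mono_set hsub) measurableSet_Ioc fun t ht => ?_
        simp only [zero_add] at ht
        rw [hf, Set.indicator_of_mem (show t ∈ Set.Ioi z from h.trans_lt ht.1)]
        exact Real.rpow_le_rpow_of_nonpos (ha.trans ht.1) (by linarith [ht.2]) (by linarith)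
      rw [setIntegral_const, Real.volume_real_Ioc_of_le (by linarith)] at hlow
      simp only [add_sub_cancel_left, one_smul] at hlow
      rw [Real.mul_rpow (by norm_num) ha.le, Real.rpow_neg (by norm_num : (0 : ℝ) ≤ 2)] at hlow
      have h2 : (0 : ℝ) < 2 ^ (1 + η) := by positivity
      calc (a : ℝ) ^ (-(1 + η)) = 2 ^ (1 + η) * ((2 ^ (1 + η))⁻¹ * (a : ℝ) ^ (-(1 + η))) := by
            field_simp
        _ ≤ _ := by gcongr
    · have : 0 ≤ ∫ t in Set.Ioc (0 + (a : ℝ)) (0 + a + 1), f t := integral_nonneg hf0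
      positivity
  have hsm : Summable (fun a : ℕ => if z ≤ a then (a : ℝ) ^ (-(1 + η)) else 0) :=
    Summable.of_nonneg_of_le (fun a => by split_ifs <;> positivity) hle hs'.summable
  refine ⟨hsm, (hsm.tsum_le_tsum hle hs'.summable).trans ?_⟩
  rw [hs'.tsum_eq]
  apply le_of_eq
  ring

theorem tsum_tail_mul_le {η Y : ℝ} (hη : 0 < η) (hY : 0 < Y) {d : ℕ} (hd : 0 < d) :
    Summable (fun a : ℕ => if Y ≤ (d * a : ℕ) then ((d * a : ℕ) : ℝ) ^ (-(1 + η)) else 0) ∧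
      ∑' a : ℕ, (if Y ≤ (d * a : ℕ) then ((d * a : ℕ) : ℝ) ^ (-(1 + η)) else 0) ≤
        2 ^ (1 + η) / η * Y ^ (-η) / d := by
  have hd0 : (0 : ℝ) < d := by exact_mod_cast hd
  have h := tsum_tail_le hη (div_pos hY hd0)
  have he : ∀ a : ℕ, (if Y ≤ (d * a : ℕ) then ((d * a : ℕ) : ℝ) ^ (-(1 + η)) else 0) =
      (d : ℝ) ^ (-(1 + η)) * (if Y / d ≤ a then (a : ℝ) ^ (-(1 + η)) else 0) := by
    intro a
    push_cast
    simp only [div_le_iff₀ hd0, mul_comm (a : ℝ) d]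
    split_ifs
    · rw [Real.mul_rpow hd0.le (by positivity)]
    · simp
  refine ⟨(h.1.mul_left _).congr fun a => (he a).symm, ?_⟩
  rw [tsum_congr he, tsum_mul_left]
  calc _ ≤ (d : ℝ) ^ (-(1 + η)) * (2 ^ (1 + η) / η * (Y / d) ^ (-η)) := by gcongr; exact h.2
    _ = _ := by
      rw [Real.div_rpow hY.le hd0.le, Real.rpow_neg hd0.le (1 + η), Real.rpow_add hd0, Real.rpow_one,
        Real.rpow_neg hd0.le η]
      field_simp

theorem summable_and_tsum_prod_le {ι κ : Type*} {f : ι × κ → ℝ} {S G : ι → ℝ} (hf : ∀ p, 0 ≤ f p)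
    (hS : ∀ d, HasSum (fun a => f (d, a)) (S d)) (hSG : ∀ d, S d ≤ G d) (hG : Summable G) :
    Summable f ∧ ∑' p, f p ≤ ∑' d, G d := by
  have hS0 : ∀ d, 0 ≤ S d := fun d => (hS d).nonneg fun a => hf _
  have hSs : Summable S := Summable.of_nonneg_of_le hS0 hSG hG
  have hfs : Summable f := by
    rw [summable_prod_of_nonneg hf]
    exact ⟨fun d => (hS d).summable, hSs.congr fun d => ((hS d).tsum_eq).symm⟩
  refine ⟨hfs, ?_⟩
  rw [hfs.tsum_prod, tsum_congr fun d => (hS d).tsum_eq]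
  exact hSs.tsum_le_tsum hSG hG

/-- Summation of the pairwise errors. -/
theorem exists_tsum_pair_error {η β : ℝ} (hη : 0 < η) (hβ' : β < 1) :
    ∃ D, 0 < D ∧ ∀ (T M : ℕ × ℕ → ℝ) (Y A : ℝ), Summable T → 0 < Y → 0 ≤ A →
      (∀ e, |T e - M e| ≤ A * ((e.1.gcd e.2 : ℝ) ^ β *
        ((if Y ≤ e.1 then (e.1 : ℝ) ^ (-(1 + η)) else 0) *
          (if Y ≤ e.2 then (e.2 : ℝ) ^ (-(1 + η)) else 0)))) →
      |∑' e, T e - ∑' e, M e| ≤ D * A * Y ^ (-(2 * η)) := by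
  set E := 2 ^ (1 + η) / η with hE
  have hE0 : 0 < E := by positivity
  have hz : Summable fun d : ℕ => ((d : ℝ) + 1) ^ (β - 2) := by
    have := (Real.summable_one_div_nat_add_rpow 1 (2 - β)).2 (by linarith)
    refine this.congr fun j => ?_
    rw [abs_of_pos (by positivity), one_div, ← Real.rpow_neg (by positivity), neg_sub]
  set Z := ∑' d : ℕ, ((d : ℝ) + 1) ^ (β - 2) with hZ
  have hZ0 : 0 < Z := hz.tsum_pos (fun d => by positivity) 0 (by simp)
  refine ⟨E ^ 2 * Z, by positivity, fun T M Y A hT hY hA hTM => ?_⟩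
  set v : ℕ → ℝ := fun e => if Y ≤ e then (e : ℝ) ^ (-(1 + η)) else 0 with hv
  have hv0 : ∀ e, 0 ≤ v e := fun e => by simp only [hv]; split_ifs <;> positivity
  have hvz : v 0 = 0 := by simp [hv, hY]
  have htail : ∀ d : ℕ, Summable (fun a => v ((d + 1) * a)) ∧
      ∑' a, v ((d + 1) * a) ≤ E * Y ^ (-η) / (d + 1) := fun d => by
    have := tsum_tail_mul_le hη hY (Nat.succ_pos d)
    exact_mod_cast this
  have hinner : ∀ d : ℕ, HasSum (fun a : ℕ × ℕ => v ((d + 1) * a.1) * v ((d + 1) * a.2))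
      ((∑' a, v ((d + 1) * a)) * ∑' a, v ((d + 1) * a)) := fun d =>
    (htail d).1.hasSum.mul (htail d).1.hasSum
      ((htail d).1.mul_of_nonneg (htail d).1 (fun _ => hv0 _) (fun _ => hv0 _))
  have hin_le : ∀ d : ℕ, ((d : ℝ) + 1) ^ β * ((∑' a, v ((d + 1) * a)) * ∑' a, v ((d + 1) * a)) ≤
      E ^ 2 * Y ^ (-(2 * η)) * ((d : ℝ) + 1) ^ (β - 2) := by
    intro d
    have h0 : 0 ≤ ∑' a, v ((d + 1) * a) := tsum_nonneg fun _ => hv0 _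
    have hd : (0 : ℝ) < d + 1 := by positivity
    calc _ ≤ ((d : ℝ) + 1) ^ β * ((E * Y ^ (-η) / (d + 1)) * (E * Y ^ (-η) / (d + 1))) := by
          gcongr <;> exact (htail d).2
      _ = _ := by
        rw [Real.rpow_sub hd, Real.rpow_two, show -(2 * η) = -η + -η by ring, Real.rpow_add hY]
        field_simp
  set F : ℕ × ℕ → ℝ := fun e => v e.1 * v e.2 with hF
  set c : ℕ → ℝ := fun d => (d : ℝ) ^ β with hc
  obtain ⟨hsum, htot⟩ := summable_and_tsum_prod_le
    (f := fun p : ℕ × ℕ × ℕ => c (p.1 + 1) * F ((p.1 + 1) * p.2.1, (p.1 + 1) * p.2.2))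
    (G := fun d : ℕ => E ^ 2 * Y ^ (-(2 * η)) * ((d : ℝ) + 1) ^ (β - 2))
    (S := fun d : ℕ => c (d + 1) * ((∑' a, v ((d + 1) * a)) * ∑' a, v ((d + 1) * a)))
    (fun p => mul_nonneg (by simp only [hc]; positivity) (mul_nonneg (hv0 _) (hv0 _)))
    (fun d => (hinner d).mul_left (c (d + 1)))
    (fun d => by simp only [hc]; push_cast; exact hin_le d) (hz.mul_left _)
  rw [tsum_mul_left, ← hZ] at htot
  have hgcd := hasSum_gcd_divisors (c := c) (F := F) (fun e => by simp [hF, hvz]) hsum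
  have hbnd : ∀ e, |T e - M e| ≤ A * ((∑ d ∈ (e.1.gcd e.2).divisors, c d) * F e) := by
    intro e
    refine (hTM e).trans ?_
    rcases Nat.eq_zero_or_pos e.1 with h | h
    · have h1 : v e.1 = 0 := by rw [h, hvz]
      have h2 : (if Y ≤ e.1 then (e.1 : ℝ) ^ (-(1 + η)) else 0) = 0 := h1
      have h3 : F e = 0 := by simp [hF, h1]
      rw [h2, h3]
      simp
    have hg : e.1.gcd e.2 ∈ (e.1.gcd e.2).divisors :=
      Nat.mem_divisors_self _ (Nat.gcd_pos_of_pos_left _ h).ne'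
    have h3 : c (e.1.gcd e.2) ≤ ∑ d ∈ (e.1.gcd e.2).divisors, c d :=
      Finset.single_le_sum (f := c) (fun d _ => by simp only [hc]; positivity) hg
    have h4 : 0 ≤ F e := mul_nonneg (hv0 _) (hv0 _)
    exact mul_le_mul_of_nonneg_left (mul_le_mul_of_nonneg_right h3 h4) hA
  have hEs : Summable fun e => T e - M e :=
    Summable.of_norm_bounded (hgcd.summable.mul_left A) hbnd
  have hM : Summable M := by
    refine (hT.sub hEs).congr fun e => ?_
    ring
  rw [← hT.tsum_sub hM]
  refine (norm_tsum_le_tsum_norm hEs.norm).trans ((hEs.norm.tsum_le_tsum hbnd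
    (hgcd.summable.mul_left A)).trans ?_)
  rw [tsum_mul_left, hgcd.tsum_eq]
  calc _ ≤ A * (E ^ 2 * Y ^ (-(2 * η)) * Z) := by gcongr
    _ = _ := by ring

namespace PowerPair

variable {h h₁ : ℝ → ℝ} {κ b C : ℝ} {w : ℝ → ℝ} {a : ℝ}

/-- Replacing each sum over multiples of the least common multiple by an integral. -/
theorem exists_tsum_pair_sub_le (H : PowerPair h h₁ κ b C) (h0 : h 0 = 0) (hκ : 0 ≤ κ)
    (hw : BumpOn w a b) {β η : ℝ} (hη : 0 < η) (hβ : 0 ≤ β) (hβ' : β < 1) (hs : κ + β = 1 + η) :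
    ∃ D, 0 < D ∧ ∀ (x y : ℝ) (T M : ℕ × ℕ → ℝ), 0 < x → 0 < y → Summable T →
      (∀ e, T e = ∑' j : ℕ, h ((e.1.lcm e.2 : ℝ) * ((j : ℝ) + 1) / (x * e.1)) *
        h ((e.1.lcm e.2 : ℝ) * ((j : ℝ) + 1) / (x * e.2)) *
        w ((e.1.lcm e.2 : ℝ) * ((j : ℝ) + 1) / y)) →
      (∀ e, M e = (e.1.lcm e.2 : ℝ)⁻¹ * ∫ t in Set.Ioi (0 : ℝ),
        h (t / (x * e.1)) * h (t / (x * e.2)) * w (t / y)) →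
      |∑' e, T e - ∑' e, M e| ≤ D * ((y / x) ^ (2 * κ) * y ^ β * (y / x) ^ (-(2 * η))) := by
  obtain ⟨D₁, hD₁, hpair⟩ := H.exists_pair_error hκ hw hβ hβ'.le
  obtain ⟨D₂, hD₂, htot⟩ := exists_tsum_pair_error hη hβ'
  have ha := hw.pos
  have hb := H.b_pos
  refine ⟨D₂ * D₁ * (a / b) ^ (-(2 * η)), by positivity, fun x y T M hx hy hTs hT hM => ?_⟩
  set Y := a / b * (y / x) with hY
  have hY0 : 0 < Y := by positivity
  have := htot T M Y (D₁ * ((y / x) ^ (2 * κ) * y ^ β)) hTs hY0 (by positivity) fun e => ?_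
  · refine this.trans (le_of_eq ?_)
    rw [hY, Real.mul_rpow (by positivity) (by positivity)]
    ring
  have hYlt : ∀ n : ℕ, (n : ℝ) < Y → x * n < a * y / b := by
    intro n hn
    calc x * n < x * Y := by gcongr
      _ = a * y / b := by rw [hY]; field_simp
  have hzero : T e = 0 → M e = 0 → |T e - M e| ≤ D₁ * ((y / x) ^ (2 * κ) * y ^ β) *
      ((e.1.gcd e.2 : ℝ) ^ β * ((if Y ≤ e.1 then (e.1 : ℝ) ^ (-(1 + η)) else 0) *
        (if Y ≤ e.2 then (e.2 : ℝ) ^ (-(1 + η)) else 0))) := by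
    intro h1 h2
    rw [h1, h2, sub_zero, abs_zero]
    have : ∀ n : ℕ, 0 ≤ (if Y ≤ n then (n : ℝ) ^ (-(1 + η)) else 0) := fun n => by
      split_ifs <;> positivity
    have h3 := this e.1
    have h4 := this e.2
    positivity
  rcases Nat.eq_zero_or_pos (e.1.lcm e.2) with hl | hl
  · exact hzero (by rw [hT, hl]; simp [h0]) (by rw [hM, hl]; simp)
  have he1 : 0 < e.1 := Nat.pos_of_ne_zero fun h => by simp [h] at hl
  have he2 : 0 < e.2 := Nat.pos_of_ne_zero fun h => by simp [h] at hl
  have hn1 : (0 : ℝ) < e.1 := by exact_mod_cast he1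
  have hn2 : (0 : ℝ) < e.2 := by exact_mod_cast he2
  have hl0 : (0 : ℝ) < e.1.lcm e.2 := by exact_mod_cast hl
  by_cases hYe : Y ≤ e.1 ∧ Y ≤ e.2
  · rw [if_pos hYe.1, if_pos hYe.2, hT, hM]
    refine (hpair (x * e.1) (x * e.2) y _ (by positivity) (by positivity) hy hl0).trans
      (le_of_eq ?_)
    have hg : (0 : ℝ) < e.1.gcd e.2 := by exact_mod_cast Nat.gcd_pos_of_pos_left _ he1
    have hgl : (e.1.gcd e.2 : ℝ) * e.1.lcm e.2 = e.1 * e.2 := by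
      exact_mod_cast Nat.gcd_mul_lcm e.1 e.2
    have e1 : (y / (x * e.1) * (y / (x * e.2))) ^ κ =
        (y / x) ^ (2 * κ) * ((e.1 * e.2 : ℝ) ^ κ)⁻¹ := by
      rw [Real.rpow_mul (by positivity), ← Real.inv_rpow (by positivity),
        ← Real.mul_rpow (by positivity) (by positivity)]
      congr 1
      rw [Real.rpow_two]
      field_simp
    have e2 : (y / (e.1.lcm e.2 : ℝ)) ^ β =
        y ^ β * ((e.1.gcd e.2 : ℝ) ^ β * ((e.1 * e.2 : ℝ) ^ β)⁻¹) := by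
      rw [← Real.inv_rpow (by positivity), ← Real.mul_rpow (by positivity) (by positivity),
        ← Real.mul_rpow (by positivity) (by positivity), ← hgl]
      congr 1
      field_simp
    have e3 : (e.1 : ℝ) ^ (-(1 + η)) * (e.2 : ℝ) ^ (-(1 + η)) =
        ((e.1 * e.2 : ℝ) ^ κ)⁻¹ * ((e.1 * e.2 : ℝ) ^ β)⁻¹ := by
      rw [← Real.mul_rpow hn1.le hn2.le, ← mul_inv, ← Real.rpow_add (by positivity), hs,
        Real.rpow_neg (by positivity)]
    rw [e1, e2, e3]
    ring
  · have hor : x * e.1 < a * y / b ∨ x * e.2 < a * y / b := by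
      rcases not_and_or.1 hYe with h | h
      · exact Or.inl (hYlt _ (not_le.1 h))
      · exact Or.inr (hYlt _ (not_le.1 h))
    have hp : ∀ t, h (t / (x * e.1)) * h (t / (x * e.2)) * w (t / y) = 0 := fun t =>
      H.pair_eq_zero hw (by positivity) (by positivity) hy hor
    exact hzero (by rw [hT, tsum_congr fun j => hp _, tsum_zero]) (by simp [hM, hp])

end PowerPair

namespace PowerPair

variable {h h₁ : ℝ → ℝ} {κ b C : ℝ} {w : ℝ → ℝ} {a : ℝ}

open MeasureTheory in
theorem integrableOn_harmonicTransform_sq_mul_rpow (H : PowerPair h h₁ κ b C) (hκ : 0 < κ)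
    (h0 : mellin (fun t => (h t : ℂ)) 0 = 0) {s : ℝ} (hs : -1 < 2 * κ + s) (hs' : s < 1) :
    IntegrableOn (fun u => harmonicTransform h u ^ 2 * u ^ s) (Set.Ioi 0) := by
  obtain ⟨D, hD, hDb⟩ := H.exists_abs_harmonicTransform_le_inv hκ h0
  set B := C * ∑' e : ℕ, 1 / (e : ℝ) ^ (1 + κ) with hB
  have hm : ContinuousOn (fun u => harmonicTransform h u ^ 2 * u ^ s) (Set.Ioi 0) :=
    ((H.continuousOn_harmonicTransform hκ).pow 2).mul
      (continuousOn_id.rpow_const fun u hu => Or.inl (ne_of_gt hu))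
  have hsub : Set.Ioc (0 : ℝ) 1 ⊆ Set.Ioi 0 := fun u hu => hu.1
  have hsub' : Set.Ioi (1 : ℝ) ⊆ Set.Ioi 0 := Set.Ioi_subset_Ioi zero_le_one
  rw [← Set.Ioc_union_Ioi_eq_Ioi (zero_le_one (α := ℝ))]
  refine IntegrableOn.union ?_ ?_
  · have hi : IntegrableOn (fun u : ℝ => B ^ 2 * u ^ (2 * κ + s)) (Set.Ioc 0 1) := by
      have := (intervalIntegral.intervalIntegrable_rpow' (a := 0) (b := 1) hs).const_mul (B ^ 2)
      rwa [intervalIntegrable_iff_integrableOn_Ioc_of_le zero_le_one] at this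
    refine hi.mono' ((hm.mono hsub).aestronglyMeasurable measurableSet_Ioc) ?_
    refine (ae_restrict_iff' measurableSet_Ioc).2 (Eventually.of_forall fun u hu => ?_)
    have hu0 : 0 < u := hu.1
    rw [Real.norm_of_nonneg (by positivity), ← sq_abs, Real.rpow_add hu0, ← mul_assoc]
    gcongr
    calc |harmonicTransform h u| ^ 2 ≤ (B * u ^ κ) ^ 2 := by
          gcongr
          exact H.abs_harmonicTransform_le hκ hu0
      _ = B ^ 2 * u ^ (2 * κ) := by
          rw [mul_pow, mul_comm 2 κ, Real.rpow_mul hu0.le, Real.rpow_two]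
  · have hi : IntegrableOn (fun u : ℝ => D ^ 2 * u ^ (-2 + s)) (Set.Ioi 1) :=
      (integrableOn_Ioi_rpow_of_lt (by linarith) one_pos).const_mul _
    refine hi.mono' ((hm.mono hsub').aestronglyMeasurable measurableSet_Ioi) ?_
    refine (ae_restrict_iff' measurableSet_Ioi).2 (Eventually.of_forall fun u hu => ?_)
    have hu0 : 0 < u := one_pos.trans hu
    rw [Real.norm_of_nonneg (by positivity), ← sq_abs, Real.rpow_add hu0, ← mul_assoc]
    gcongr
    calc |harmonicTransform h u| ^ 2 ≤ (D * u ^ (-1 : ℝ)) ^ 2 := by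
          gcongr
          exact hDb u hu0
      _ = D ^ 2 * u ^ (-2 : ℝ) := by
          rw [mul_pow, ← Real.rpow_natCast (u ^ (-1 : ℝ)), ← Real.rpow_mul hu0.le]
          norm_num

end PowerPair

namespace BumpOn

variable {w : ℝ → ℝ} {a b : ℝ}

theorem weight_div_eq_zero (hw : BumpOn w a b) {r : ℝ} (hr : 0 < r) {N : ℕ}
    (hN : b * r < N) {g : ℕ} (hg : g ∉ Finset.range N) : w (g / r) = 0 := by
  have : (N : ℝ) ≤ g := by exact_mod_cast not_lt.1 (fun h => hg (Finset.mem_range.2 h))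
  exact hw.weight_eq_zero_of_lt hr (hN.trans_le this)

theorem summable_totient_mul (hw : BumpOn w a b) {r : ℝ} (hr : 0 < r) :
    Summable fun g : ℕ => (g.totient : ℝ) / g * w (g / r) := by
  obtain ⟨N, hN⟩ := exists_nat_gt (b * r)
  refine summable_of_ne_finset_zero (s := Finset.range N) fun g hg => ?_
  rw [hw.weight_div_eq_zero hr hN hg, mul_zero]

end BumpOn

namespace PowerPair

variable {h h₁ : ℝ → ℝ} {κ b C : ℝ} {w : ℝ → ℝ} {a : ℝ}

open MeasureTheory in
/-- Unfolding the main term by Fubini. -/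
theorem hasSum_integral_triple (H : PowerPair h h₁ κ b C) (hκ : 0 < κ) (hw : BumpOn w a b)
    {Z : ℝ} (hZ : 0 < Z) :
    Summable (fun p : ℕ × ℕ × ℕ => ∫ u in Set.Ioi (0 : ℝ), ((p.1 + 1).totient : ℝ) / (p.1 + 1 : ℕ) *
      w ((p.1 + 1 : ℕ) / (Z / u)) * (h (u / p.2.1) / p.2.1 * (h (u / p.2.2) / p.2.2))) ∧
    ∑' p : ℕ × ℕ × ℕ, ∫ u in Set.Ioi (0 : ℝ), ((p.1 + 1).totient : ℝ) / (p.1 + 1 : ℕ) *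
      w ((p.1 + 1 : ℕ) / (Z / u)) * (h (u / p.2.1) / p.2.1 * (h (u / p.2.2) / p.2.2)) =
    ∫ u in Set.Ioi (0 : ℝ), harmonicTransform h u ^ 2 *
      ∑' g : ℕ, (g.totient : ℝ) / g * w (g / (Z / u)) := by
  obtain ⟨D, hD, hbd⟩ := H.exists_pair_bounds hκ.le hw
  set Φ : ℕ × ℕ × ℕ → ℝ → ℝ := fun p u => ((p.1 + 1).totient : ℝ) / (p.1 + 1 : ℕ) *
      w ((p.1 + 1 : ℕ) / (Z / u)) * (h (u / p.2.1) / p.2.1 * (h (u / p.2.2) / p.2.2)) with hΦ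
  set R : ℕ × ℕ × ℕ → ℝ := fun p => D * Z ^ (1 + 2 * κ) *
    (((p.1 : ℝ) + 1) ^ (-(1 + 2 * κ)) * (1 / (p.2.1 : ℝ) ^ (1 + κ) * (1 / (p.2.2 : ℝ) ^ (1 + κ))))
    with hR
  have hRs : Summable R := by
    refine Summable.mul_left _ ?_
    have s1 : Summable fun d : ℕ => ((d : ℝ) + 1) ^ (-(1 + 2 * κ)) := by
      have := (Real.summable_one_div_nat_add_rpow 1 (1 + 2 * κ)).2 (by linarith)
      refine this.congr fun j => ?_
      rw [abs_of_pos (by positivity), one_div, ← Real.rpow_neg (by positivity)]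
    have s2 : Summable fun e : ℕ => 1 / (e : ℝ) ^ (1 + κ) :=
      Real.summable_one_div_nat_rpow.2 (by linarith)
    exact s1.mul_of_nonneg (s2.mul_of_nonneg s2 (fun _ => by positivity) fun _ => by positivity)
      (fun _ => by positivity) fun _ => by positivity
  have hkey : ∀ p, IntegrableOn (Φ p) (Set.Ioi 0) ∧ ∫ u in Set.Ioi (0 : ℝ), ‖Φ p u‖ ≤ R p := by
    rintro ⟨d, a₁, a₂⟩
    rcases Nat.eq_zero_or_pos (a₁ * a₂) with h' | h'
    · have hz : Φ (d, a₁, a₂) = fun _ => 0 := by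
        ext u
        rcases Nat.mul_eq_zero.1 h' with rfl | rfl <;> simp [hΦ]
      rw [hz]
      refine ⟨integrableOn_zero, ?_⟩
      simp only [norm_zero, integral_zero, hR]
      positivity
    have h1 : (0 : ℝ) < a₁ := by exact_mod_cast Nat.pos_of_mul_pos_right h'
    have h2 : (0 : ℝ) < a₂ := by exact_mod_cast Nat.pos_of_mul_pos_left h'
    have hd : (0 : ℝ) < (d : ℝ) + 1 := by positivity
    obtain ⟨hi, hia, -⟩ := hbd a₁ a₂ (Z / (d + 1)) h1 h2 (by positivity)
    set c := ((d + 1).totient : ℝ) / (d + 1 : ℕ) * ((a₁ : ℝ)⁻¹ * (a₂ : ℝ)⁻¹) with hc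
    have hc0 : 0 ≤ c := by positivity
    have hc1 : c ≤ (a₁ : ℝ)⁻¹ * (a₂ : ℝ)⁻¹ := by
      refine mul_le_of_le_one_left (by positivity) ?_
      exact div_le_one_of_le₀ (by exact_mod_cast Nat.totient_le _) (by positivity)
    have he : Φ (d, a₁, a₂) = fun u => c * (h (u / a₁) * h (u / a₂) * w (u / (Z / (d + 1)))) := by
      ext u
      simp only [hΦ, hc]
      rw [show ((d + 1 : ℕ) : ℝ) / (Z / u) = u / (Z / (d + 1)) by push_cast; field_simp]
      ring
    rw [he]
    refine ⟨hi.const_mul c, ?_⟩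
    simp only [norm_mul c, Real.norm_of_nonneg hc0]
    rw [integral_const_mul]
    simp only [Real.norm_eq_abs]
    calc _ ≤ (a₁ : ℝ)⁻¹ * (a₂ : ℝ)⁻¹ *
          (D * (Z / (d + 1)) * (Z / (d + 1) / a₁ * (Z / (d + 1) / a₂)) ^ κ) := by
          gcongr
      _ = _ := by
        have e : Z / (d + 1 : ℝ) / a₁ * (Z / (d + 1) / a₂) =
          Z ^ (2 : ℝ) * ((d : ℝ) + 1) ^ (-2 : ℝ) * ((a₁ : ℝ)⁻¹ * (a₂ : ℝ)⁻¹) := by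
          rw [Real.rpow_neg hd.le, Real.rpow_two, Real.rpow_two]
          field_simp
        rw [e, Real.mul_rpow (by positivity) (by positivity),
          Real.mul_rpow (by positivity) (by positivity),
          Real.mul_rpow (by positivity) (by positivity), ← Real.rpow_mul hZ.le,
          ← Real.rpow_mul hd.le, Real.inv_rpow h1.le, Real.inv_rpow h2.le]
        simp only [hR]
        rw [Real.rpow_add hZ, Real.rpow_add h1, Real.rpow_add h2, Real.rpow_one, Real.rpow_one,
          Real.rpow_one, neg_add, Real.rpow_add hd, Real.rpow_neg_one, neg_mul]
        field_simp
  have hsum := hasSum_integral_of_summable_integral_norm (fun p => (hkey p).1)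
    (Summable.of_nonneg_of_le (fun p => integral_nonneg fun u => norm_nonneg _)
      (fun p => (hkey p).2) hRs)
  refine ⟨hsum.summable, hsum.tsum_eq.trans (setIntegral_congr_fun measurableSet_Ioi fun u hu => ?_)⟩
  have hu0 : (0 : ℝ) < u := hu
  have hS := hw.summable_totient_mul (show 0 < Z / u by positivity)
  have hK := H.summable_term hκ hu0
  have hS' := (summable_nat_add_iff 1).2 hS
  have e1 : ∑' g : ℕ, (g.totient : ℝ) / g * w (g / (Z / u)) =
      ∑' d : ℕ, ((d + 1).totient : ℝ) / (d + 1 : ℕ) * w ((d + 1 : ℕ) / (Z / u)) := by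
    rw [hS.tsum_eq_zero_add]
    simp
  have e2 : ∑' q : ℕ × ℕ, h (u / q.1) / q.1 * (h (u / q.2) / q.2) = harmonicTransform h u ^ 2 := by
    rw [sq]
    exact (tsum_mul_tsum_of_summable_norm hK.norm hK.norm).symm
  simp only [hΦ]
  rw [e1, ← e2, mul_comm]
  exact (tsum_mul_tsum_of_summable_norm hS'.norm
    (summable_mul_of_summable_norm hK.norm hK.norm).norm).symm

end PowerPair

namespace PowerPair

variable {h h₁ : ℝ → ℝ} {κ b C : ℝ} {w : ℝ → ℝ} {a : ℝ}

open MeasureTheory in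
/-- The sum of the integrals over pairs as a single integral. -/
theorem tsum_pair_integral_eq (H : PowerPair h h₁ κ b C) (hκ : 0 < κ) (hw : BumpOn w a b)
    {x y : ℝ} (hx : 0 < x) (hy : 0 < y) {M : ℕ × ℕ → ℝ}
    (hM : ∀ e, M e = (e.1.lcm e.2 : ℝ)⁻¹ * ∫ t in Set.Ioi (0 : ℝ),
        h (t / (x * e.1)) * h (t / (x * e.2)) * w (t / y)) :
    ∑' e, M e = x * ∫ u in Set.Ioi (0 : ℝ), harmonicTransform h u ^ 2 *
      ∑' g : ℕ, (g.totient : ℝ) / g * w (g / (y / x / u)) := by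
  obtain ⟨hs, he⟩ := H.hasSum_integral_triple hκ hw (div_pos hy hx)
  rw [← he, ← tsum_mul_left]
  set F : ℕ × ℕ → ℝ := fun e => ((e.1 : ℝ) * e.2)⁻¹ * ∫ t in Set.Ioi (0 : ℝ),
        h (t / (x * e.1)) * h (t / (x * e.2)) * w (t / y) with hF
  set c : ℕ → ℝ := fun d => (d.totient : ℝ) with hc
  have hterm : ∀ p : ℕ × ℕ × ℕ, c (p.1 + 1) * F ((p.1 + 1) * p.2.1, (p.1 + 1) * p.2.2) =
      x * ∫ u in Set.Ioi (0 : ℝ), ((p.1 + 1).totient : ℝ) / (p.1 + 1 : ℕ) *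
      w ((p.1 + 1 : ℕ) / (y / x / u)) * (h (u / p.2.1) / p.2.1 * (h (u / p.2.2) / p.2.2)) := by
    rintro ⟨d, a₁, a₂⟩
    simp only [hc, hF]
    have hd : (0 : ℝ) < (d : ℝ) + 1 := by positivity
    have hxd : 0 < x * ((d : ℝ) + 1) := by positivity
    have hsub := integral_comp_mul_left_Ioi (fun t => h (t / (x * ((d + 1) * a₁ : ℕ))) *
      h (t / (x * ((d + 1) * a₂ : ℕ))) * w (t / y)) 0 hxd
    rw [mul_zero, smul_eq_mul, eq_inv_mul_iff_mul_eq₀ hxd.ne'] at hsub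
    rw [← hsub, ← integral_const_mul, ← integral_const_mul, ← integral_const_mul,
      ← integral_const_mul]
    refine setIntegral_congr_fun measurableSet_Ioi fun u hu => ?_
    have hu0 : (0 : ℝ) < u := hu
    have e1 : ∀ n : ℕ, x * ((d : ℝ) + 1) * u / (x * ((d + 1) * n : ℕ)) = u / n := fun n => by
      push_cast
      rw [mul_assoc, mul_div_mul_left _ _ hx.ne', mul_div_mul_left _ _ hd.ne']
    have e2 : x * ((d : ℝ) + 1) * u / y = (d + 1 : ℕ) / (y / x / u) := by
      push_cast
      field_simp
    simp only [e1, e2]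
    push_cast
    rcases eq_or_ne (a₁ : ℝ) 0 with h1 | h1
    · simp [h1]
    rcases eq_or_ne (a₂ : ℝ) 0 with h2 | h2
    · simp [h2]
    field_simp
  have hgcd := hasSum_gcd_divisors (c := c) (F := F) (fun e => by simp [hF])
    ((hs.mul_left x).congr fun p => (hterm p).symm)
  rw [← tsum_congr hterm, ← hgcd.tsum_eq]
  refine tsum_congr fun e => ?_
  have hg : (∑ d ∈ (e.1.gcd e.2).divisors, c d) = (e.1.gcd e.2 : ℝ) := by
    simp only [hc]
    exact_mod_cast Nat.sum_totient _
  rw [hM, hg, ← mul_assoc]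
  congr 1
  have hgl : (e.1.gcd e.2 : ℝ) * e.1.lcm e.2 = e.1 * e.2 := by
    exact_mod_cast Nat.gcd_mul_lcm e.1 e.2
  rw [← hgl, mul_inv, ← mul_assoc]
  rcases eq_or_ne (e.1.gcd e.2 : ℝ) 0 with h0 | h0
  · have : e.1.lcm e.2 = 0 := by
      rw [Nat.cast_eq_zero, Nat.gcd_eq_zero_iff] at h0
      simp [h0.1]
    simp [this]
  · rw [mul_inv_cancel₀ h0, one_mul]

end PowerPair

namespace BumpOn

variable {w : ℝ → ℝ} {a b : ℝ}

open MeasureTheory in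
theorem exists_abs_tsum_pair_integral_sub_le (hRH : RiemannHypothesis) (hw : BumpOn w a b)
    {κ C : ℝ} {h₁ : ℝ → ℝ} (hκ : 0 < κ) (hκ' : κ < 1 / 2)
    (H : PowerPair (moebiusTransform w) h₁ κ b C) :
    ∃ D, 0 < D ∧ ∀ (x y : ℝ) (M : ℕ × ℕ → ℝ), 0 < x → 0 < y →
      (∀ e, M e = (e.1.lcm e.2 : ℝ)⁻¹ * ∫ t in Set.Ioi (0 : ℝ),
        moebiusTransform w (t / (x * e.1)) * moebiusTransform w (t / (x * e.2)) * w (t / y)) →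
      |∑' e, M e - y * (∫ t in Set.Ioi 0, moebiusTransform (fun t => w t / t) t) *
        ∫ t in Set.Ioi (0 : ℝ), w t ^ 2 * t| ≤ D * (x * (y / x) ^ (-κ)) := by
  obtain ⟨D, hD, hSb⟩ := hw.exists_abs_tsum_totient_sub_le hRH hκ.le hκ'
  set A := ∫ t in Set.Ioi (0 : ℝ), moebiusTransform (fun t => w t / t) t with hA
  have hm0 := hw.mellin_moebiusTransform_zero hκ H
  set K := harmonicTransform (moebiusTransform w) with hK
  have hi1 := H.integrableOn_harmonicTransform_sq_mul_rpow hκ hm0 (s := κ) (by linarith)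
    (by linarith)
  have hi2 := H.integrableOn_harmonicTransform_sq_mul_rpow hκ hm0 (s := -1) (by linarith)
    (by linarith)
  rw [← hK] at hi1 hi2
  set J := ∫ u in Set.Ioi (0 : ℝ), K u ^ 2 * u ^ κ with hJ
  have hJ0 : 0 ≤ J := setIntegral_nonneg measurableSet_Ioi fun u hu => by
    have : (0 : ℝ) < u := hu
    positivity
  refine ⟨D * J + 1, by positivity, fun x y M hx hy hM => ?_⟩
  set Z := y / x with hZ
  have hZ0 : 0 < Z := div_pos hy hx
  set S : ℝ → ℝ := fun u => ∑' g : ℕ, (g.totient : ℝ) / g * w (g / (Z / u)) with hS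
  have hbd : ∀ u ∈ Set.Ioi (0 : ℝ), ‖K u ^ 2 * (S u - Z * A * u ^ (-1 : ℝ))‖ ≤
      D * Z ^ (-κ) * (K u ^ 2 * u ^ κ) := by
    intro u hu
    have hu0 : (0 : ℝ) < u := hu
    rw [norm_mul, Real.norm_of_nonneg (sq_nonneg _), Real.norm_eq_abs]
    have h1 := hSb (Z / u) (by positivity)
    have h2 : (Z / u) ^ (-κ) = Z ^ (-κ) * u ^ κ := by
      rw [Real.div_rpow hZ0.le hu0.le, Real.rpow_neg hu0.le, div_inv_eq_mul]
    have h3 : Z * A * u ^ (-1 : ℝ) = Z / u * A := by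
      rw [Real.rpow_neg_one]
      ring
    rw [h2] at h1
    rw [h3]
    calc K u ^ 2 * |S u - Z / u * A| ≤ K u ^ 2 * (D * (Z ^ (-κ) * u ^ κ)) := by gcongr
      _ = _ := by ring
  have hKm : ContinuousOn K (Set.Ioi 0) := H.continuousOn_harmonicTransform hκ
  have hSm : AEStronglyMeasurable S (volume.restrict (Set.Ioi 0)) := by
    refine aestronglyMeasurable_of_tendsto_ae atTop (f := fun n u =>
      ∑ g ∈ Finset.range n, (g.totient : ℝ) / g * w (g / (Z / u))) (fun n => ?_)
      ((ae_restrict_iff' measurableSet_Ioi).2 (Eventually.of_forall fun u hu => ?_))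
    · have : Measurable w := hw.continuous.measurable
      exact Measurable.aestronglyMeasurable (by fun_prop)
    · exact (hw.summable_totient_mul (div_pos hZ0 hu)).hasSum.tendsto_sum_nat
  have hie : IntegrableOn (fun u => K u ^ 2 * (S u - Z * A * u ^ (-1 : ℝ))) (Set.Ioi 0) := by
    refine (hi1.const_mul (D * Z ^ (-κ))).mono' ?_
      ((ae_restrict_iff' measurableSet_Ioi).2 (Eventually.of_forall hbd))
    refine ((hKm.aestronglyMeasurable measurableSet_Ioi).pow 2).mul (hSm.sub ?_)
    exact Measurable.aestronglyMeasurable (by fun_prop)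
  have hQ : ∫ u in Set.Ioi (0 : ℝ), K u ^ 2 * u ^ (-1 : ℝ) =
      ∫ t in Set.Ioi (0 : ℝ), w t ^ 2 * t := by
    rw [← hw.integral_harmonicTransform_sq hκ H]
    refine setIntegral_congr_fun measurableSet_Ioi fun u _ => ?_
    simp only [Real.rpow_neg_one, ← div_eq_mul_inv, hK]
  have hsplit : ∫ u in Set.Ioi (0 : ℝ), K u ^ 2 * S u =
      (∫ u in Set.Ioi (0 : ℝ), K u ^ 2 * (S u - Z * A * u ^ (-1 : ℝ))) +
        Z * A * ∫ u in Set.Ioi (0 : ℝ), K u ^ 2 * u ^ (-1 : ℝ) := by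
    rw [← integral_const_mul (Z * A) (fun u => K u ^ 2 * u ^ (-1 : ℝ)), ← integral_add hie (hi2.const_mul _)]
    congr 1
    ext u
    ring
  rw [H.tsum_pair_integral_eq hκ hw hx hy hM]
  change |x * (∫ u in Set.Ioi (0 : ℝ), K u ^ 2 * S u) - _| ≤ _
  rw [hsplit, hQ, mul_add, show x * (Z * A * ∫ t in Set.Ioi (0 : ℝ), w t ^ 2 * t) =
    y * A * ∫ t in Set.Ioi (0 : ℝ), w t ^ 2 * t by rw [hZ]; field_simp, add_sub_cancel_right,
    abs_mul, abs_of_pos hx]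
  have hle : |∫ u in Set.Ioi (0 : ℝ), K u ^ 2 * (S u - Z * A * u ^ (-1 : ℝ))| ≤
      D * Z ^ (-κ) * J := by
    rw [hJ, ← integral_const_mul (D * Z ^ (-κ)) (fun u => K u ^ 2 * u ^ κ)]
    exact norm_integral_le_of_norm_le (hi1.const_mul _)
      ((ae_restrict_iff' measurableSet_Ioi).2 (Eventually.of_forall hbd))
  calc _ ≤ x * (D * Z ^ (-κ) * J) := by gcongr
    _ = D * J * (x * Z ^ (-κ)) := by ring
    _ ≤ _ := by
      have : 0 ≤ x * Z ^ (-κ) := by positivity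
      nlinarith

end BumpOn

theorem Weight.bumpOn {U : ℝ} (hU : 2 ≤ U) (W : Weight U) :
    BumpOn W.toFun (1 / (2 * U)) (1 + 1 / (2 * U)) where
  smooth := W.smooth
  pos := by positivity
  le := by linarith
  zero := W.support_subset

theorem rpow_add_mul_rpow_sub_le {x y : ℝ} (hx : 0 < x) (hxy : x ≤ y) {p q s t : ℝ}
    (hst : s ≤ t) : y ^ (p + s) * x ^ (q - s) ≤ y ^ (p + t) * x ^ (q - t) := by
  have hy : 0 < y := hx.trans_le hxy
  have he : ∀ r : ℝ, y ^ (p + r) * x ^ (q - r) = y ^ p * x ^ q * (y / x) ^ r := fun r => by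
    rw [Real.rpow_add hy, Real.rpow_sub hx, Real.div_rpow hy.le hx.le]
    field_simp
  rw [he, he]
  have : 1 ≤ y / x := (one_le_div hx).2 hxy
  gcongr

theorem rpow_sub_mul_rpow_add_two_mul_le {x y : ℝ} (hx : 0 < x) (hy : 0 < y) (hxy : y ≤ x ^ 2)
    {p q s t : ℝ} (hst : s ≤ t) :
    y ^ (p - s) * x ^ (q + 2 * s) ≤ y ^ (p - t) * x ^ (q + 2 * t) := by
  have he : ∀ r : ℝ, y ^ (p - r) * x ^ (q + 2 * r) = y ^ p * x ^ q * (x ^ 2 / y) ^ r := fun r => by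
    rw [Real.rpow_add hx, Real.rpow_sub hy, Real.div_rpow (by positivity) hy.le,
      Real.rpow_mul hx.le, Real.rpow_two]
    field_simp
  rw [he, he]
  have : 1 ≤ x ^ 2 / y := (one_le_div hy).2 hxy
  gcongr

/-- The asymptotic for small `ε`, as an estimate between real numbers. -/
theorem BumpOn.exists_abs_tsum_sub_le {w : ℝ → ℝ} {a b : ℝ} (hRH : RiemannHypothesis)
    (hw : BumpOn w a b) {ε : ℝ} (hε : 0 < ε) (hε' : ε ≤ 1 / 4) :
    ∃ D, 0 < D ∧ ∀ x y : ℝ, 0 < x → x < y → ∃ R : ℝ,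
      ∑' n : ℕ+, (∑' q : ℕ+, ramanujanSum q n * (w ((q : ℕ) / x) : ℂ)) ^ 2 *
        (w ((n : ℕ) / y) : ℂ) = (R : ℂ) ∧
      |R - y * x ^ 2 * (∫ t in Set.Ioi 0, moebiusTransform (fun t => w t / t) t) *
        ∫ t in Set.Ioi (0 : ℝ), w t ^ 2 * t| ≤
        D * (y ^ (-(1 / 2 : ℝ) + ε) * x ^ ((7 : ℝ) / 2 - ε)
              + y ^ ((3 : ℝ) / 2 - ε) * x ^ (1 + 2 * ε)) := by
  have hκ : 0 < 1 / 2 - ε / 2 := by linarith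
  have hκ' : 1 / 2 - ε / 2 < 1 / 2 := by linarith
  obtain ⟨C, hC, H⟩ := hw.exists_powerPair hRH hκ.le hκ'
  obtain ⟨D₁, hD₁, h1⟩ := H.exists_tsum_pair_sub_le (moebiusTransform_apply_zero w) hκ.le hw
    (β := 1 / 2 + ε) (η := ε / 2) (by linarith) (by linarith) (by linarith) (by ring)
  obtain ⟨D₂, hD₂, h2⟩ := hw.exists_abs_tsum_pair_integral_sub_le hRH hκ hκ' H
  refine ⟨D₁ + D₂, by positivity, fun x y hx hxy => ?_⟩
  have hy : 0 < y := hx.trans hxy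
  set T : ℕ × ℕ → ℝ := fun e => ∑' j : ℕ,
      moebiusTransform w ((e.1.lcm e.2 : ℝ) * ((j : ℝ) + 1) / (x * e.1)) *
      moebiusTransform w ((e.1.lcm e.2 : ℝ) * ((j : ℝ) + 1) / (x * e.2)) *
      w ((e.1.lcm e.2 : ℝ) * ((j : ℝ) + 1) / y) with hT
  set M : ℕ × ℕ → ℝ := fun e => (e.1.lcm e.2 : ℝ)⁻¹ * ∫ t in Set.Ioi (0 : ℝ),
        moebiusTransform w (t / (x * e.1)) * moebiusTransform w (t / (x * e.2)) * w (t / y) with hM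
  obtain ⟨hTs, heq⟩ := hw.tsum_ramanujanSum_sq_mul_eq hx hy (T := T) fun _ => rfl
  refine ⟨_, heq, ?_⟩
  have b1 := h1 x y T M hx hy hTs (fun _ => rfl) fun _ => rfl
  have b2 := h2 x y M hx hy fun _ => rfl
  set A := ∫ t in Set.Ioi (0 : ℝ), moebiusTransform (fun t => w t / t) t with hA
  set Q := ∫ t in Set.Ioi (0 : ℝ), w t ^ 2 * t with hQ
  have e1 : x ^ 2 * ((y / x) ^ (2 * (1 / 2 - ε / 2)) * y ^ (1 / 2 + ε) *
      (y / x) ^ (-(2 * (ε / 2)))) = y ^ ((3 : ℝ) / 2 - ε) * x ^ (1 + 2 * ε) := by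
    rw [mul_right_comm, ← Real.rpow_add (by positivity), Real.div_rpow hy.le hx.le,
      show (3 : ℝ) / 2 - ε = (2 * (1 / 2 - ε / 2) + -(2 * (ε / 2))) + (1 / 2 + ε) by ring,
      Real.rpow_add hy (2 * (1 / 2 - ε / 2) + -(2 * (ε / 2))),
      show 1 + 2 * ε = 2 - (2 * (1 / 2 - ε / 2) + -(2 * (ε / 2))) by ring, Real.rpow_sub hx,
      Real.rpow_two]
    field_simp
  have e2 : x ^ 2 * (x * (y / x) ^ (-(1 / 2 - ε / 2))) =
      y ^ (-(1 / 2 : ℝ) + ε / 2) * x ^ ((7 : ℝ) / 2 - ε / 2) := by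
    rw [Real.div_rpow hy.le hx.le, show -(1 / 2 : ℝ) + ε / 2 = -(1 / 2 - ε / 2) by ring,
      show (7 : ℝ) / 2 - ε / 2 = (3 : ℕ) - -(1 / 2 - ε / 2) by push_cast; ring, Real.rpow_sub hx,
      Real.rpow_natCast]
    field_simp
  have e3 := rpow_add_mul_rpow_sub_le hx hxy.le (p := -(1 / 2 : ℝ)) (q := 7 / 2)
    (show ε / 2 ≤ ε by linarith)
  set P₁ := y ^ (-(1 / 2 : ℝ) + ε) * x ^ ((7 : ℝ) / 2 - ε) with hP₁
  set P₂ := y ^ ((3 : ℝ) / 2 - ε) * x ^ (1 + 2 * ε) with hP₂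
  have hP₁0 : 0 < P₁ := by positivity
  have hP₂0 : 0 < P₂ := by positivity
  calc |x ^ 2 * ∑' e, T e - y * x ^ 2 * A * Q|
      = |x ^ 2 * (∑' e, T e - ∑' e, M e) + x ^ 2 * (∑' e, M e - y * A * Q)| := by
        congr 1
        ring
    _ ≤ x ^ 2 * |∑' e, T e - ∑' e, M e| + x ^ 2 * |∑' e, M e - y * A * Q| := by
        refine (abs_add_le _ _).trans ?_
        rw [abs_mul, abs_mul, abs_of_pos (by positivity : 0 < x ^ 2)]
    _ ≤ D₁ * P₂ + D₂ * P₁ := by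
        refine add_le_add ?_ ?_
        · rw [← e1, mul_left_comm D₁]
          gcongr
        · calc _ ≤ x ^ 2 * (D₂ * (x * (y / x) ^ (-(1 / 2 - ε / 2)))) := by gcongr
            _ = D₂ * (x ^ 2 * (x * (y / x) ^ (-(1 / 2 - ε / 2)))) := by ring
            _ ≤ _ := by
              rw [e2]
              gcongr
    _ ≤ _ := by nlinarith [mul_pos hD₁ hP₁0, mul_pos hD₂ hP₂0]

/-- Under RH, asymptotic for `C(x,y)` in the range `x < y ≤ x²`. -/
theorem second_moment_asymptotic_below_x_sq
    (hRH : RiemannHypothesis) (ε : ℝ) (hε : 0 < ε)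
    (c₂ : ℝ) (hc₂ : 1 < c₂) (hc₂' : c₂ < 2)
    (U : ℝ) (hU : 2 ≤ U) (W : Weight U) :
    ∃ C : ℝ, 0 < C ∧ ∃ X : ℝ, ∀ x y : ℝ, X ≤ x → x < y → y ≤ x ^ 2 →
      ‖Cxy W x y -
          ((y : ℂ) * (x : ℂ) ^ 2 / riemannZeta 2) * mellinW W.toFun 1 *
            VI c₂ (fun s => mellinW W.toFun (2 - s) * mellinW W.toFun s)‖ ≤
        C * (y ^ (-(1 / 2 : ℝ) + ε) * x ^ ((7 : ℝ) / 2 - ε)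
              + y ^ ((3 : ℝ) / 2 - ε) * x ^ (1 + 2 * ε)) := by
  have hw := W.bumpOn hU
  obtain ⟨D, hD, hbd⟩ := hw.exists_abs_tsum_sub_le hRH (ε := min ε (1 / 4))
    (lt_min hε (by norm_num)) (min_le_right _ _)
  refine ⟨D, hD, 1, fun x y hX hxy hyx => ?_⟩
  have hx : 0 < x := by linarith
  have hy : 0 < y := hx.trans hxy
  obtain ⟨R, hR, hRb⟩ := hbd x y hx hxy
  have hmain : ((y : ℂ) * (x : ℂ) ^ 2 / riemannZeta 2) * mellinW W.toFun 1 *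
      VI c₂ (fun s => mellinW W.toFun (2 - s) * mellinW W.toFun s) =
      ((y * x ^ 2 * (∫ t in Set.Ioi 0, moebiusTransform (fun t => W.toFun t / t) t) *
        ∫ t in Set.Ioi (0 : ℝ), W.toFun t ^ 2 * t : ℝ) : ℂ) := by
    rw [hw.VI_mellinW (by rw [abs_le]; constructor <;> linarith), ofReal_mul, ofReal_mul,
      hw.integral_moebiusTransform_div]
    push_cast
    ring
  rw [hmain, Cxy, hR, ← ofReal_sub, Complex.norm_real, Real.norm_eq_abs]
  refine hRb.trans ?_
  have hm := min_le_left ε (1 / 4)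
  have h1 := rpow_add_mul_rpow_sub_le hx hxy.le (p := -(1 / 2 : ℝ)) (q := 7 / 2) hm
  have h2 := rpow_sub_mul_rpow_add_two_mul_le hx hy hyx (p := 3 / 2) (q := 1) hm
  gcongr
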